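/- Let X ⊂ P^{n+c} be a nondegenerate irreducible projective variety of dimension n ≥ 2, codimension c ≥ 4, and degree d ≥ c+3, and let Y ⊂ P^{n−1+c} be a general hyperplane section of X. If a₂(X) = C(c+1,2) − 3, then a₂(Y) = C(c+1,2) − 3. -/

import Mathlib

/-!
Common framework: a projective variety `X ⊆ ℙ^N` over a field `k` is represented by its
affine cone `C ⊆ (ι → k)` (with `ι` the index type of homogeneous coordinates,
`Fintype.card ι = N + 1`).  All projective notions (vanishing ideal, `a₂`, Hilbert
function, dimension, degree, depth, base locus of quadrics, irreducible components,
scrolls and divisors on them, sectional genus, maximal sectional regularity) are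
defined concretely below.
-/

open MvPolynomial

noncomputable section

namespace PaperQuadrics

variable (k : Type) [Field k] (ι : Type) [Fintype ι] [DecidableEq ι]

/-- The vanishing ideal of a subset `C` of the affine cone `ι → k`. -/
def vanIdeal (C : Set (ι → k)) : Ideal (MvPolynomial ι k) :=
  ⨅ x ∈ C, RingHom.ker (MvPolynomial.eval x)

/-- The degree-`m` graded piece of an ideal of the polynomial ring. -/
def idealPiece (I : Ideal (MvPolynomial ι k)) (m : ℕ) : Submodule k (MvPolynomial ι k) :=
  Submodule.restrictScalars k I ⊓ homogeneousSubmodule ι k m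

/-- The space of quadrics vanishing on `C`, i.e. `H⁰(ℙ^N, I_C(2))`. -/
def quadrics (C : Set (ι → k)) : Submodule k (MvPolynomial ι k) :=
  idealPiece k ι (vanIdeal k ι C) 2

/-- `a₂(C) = h⁰(ℙ^N, I_C(2))`, the number of linearly independent quadrics through `C`. -/
def a2 (C : Set (ι → k)) : ℕ := Module.finrank k (quadrics k ι C)

/-- The Hilbert function of `R/I` in degree `m`. -/
def idealHilb (I : Ideal (MvPolynomial ι k)) (m : ℕ) : ℕ :=
  Module.finrank k (homogeneousSubmodule ι k m) - Module.finrank k (idealPiece k ι I m)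

/-- The Hilbert function of the homogeneous coordinate ring of `C`. -/
def hilb (C : Set (ι → k)) (m : ℕ) : ℕ := idealHilb k ι (vanIdeal k ι C) m

/-- `C ⊆ ι → k` is the affine cone of an irreducible projective variety:
it is a Zariski-closed cone whose vanishing ideal is prime. -/
structure IsProjVariety (C : Set (ι → k)) : Prop where
  zero_mem : (0 : ι → k) ∈ C
  smul_mem : ∀ x ∈ C, ∀ t : k, t • x ∈ C
  closed : C = {x | ∀ f ∈ vanIdeal k ι C, MvPolynomial.eval x f = 0}
  prime : (vanIdeal k ι C).IsPrime

/-- Nondegenerate: no nonzero linear form vanishes identically on `C`. -/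
def Nondeg (C : Set (ι → k)) : Prop :=
  ∀ f ∈ homogeneousSubmodule ι k 1, (∀ x ∈ C, MvPolynomial.eval x f = 0) → f = 0

/-- The projective variety with cone `C` has dimension `n`
(so the affine cone has Krull dimension `n + 1`). -/
def HasDim (C : Set (ι → k)) (n : ℕ) : Prop :=
  ringKrullDim (MvPolynomial ι k ⧸ vanIdeal k ι C) = (n + 1 : ℕ)

/-- `C` (of projective dimension `n`) has degree `d`:
the Hilbert function satisfies `hF(m) · n! / mⁿ → d`. -/
def HasDegree (C : Set (ι → k)) (n d : ℕ) : Prop :=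
  Filter.Tendsto (fun m : ℕ => (hilb k ι C m : ℝ) * (Nat.factorial n : ℝ) / (m : ℝ) ^ n)
    Filter.atTop (nhds (d : ℝ))

/-- `Q(C)`: the common zero set (base locus) of all quadrics through `C`. -/
def quadZero (C : Set (ι → k)) : Set (ι → k) :=
  {x | ∀ f ∈ quadrics k ι C, MvPolynomial.eval x f = 0}

/-- `fs` is a regular sequence on `R/I`. -/
def IsRegSeqOn (I : Ideal (MvPolynomial ι k)) (fs : List (MvPolynomial ι k)) : Prop :=
  (∀ i : Fin fs.length, ∀ g : MvPolynomial ι k,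
      fs.get i * g ∈ I ⊔ Ideal.span {h | ∃ j : Fin fs.length, j < i ∧ fs.get j = h} →
      g ∈ I ⊔ Ideal.span {h | ∃ j : Fin fs.length, j < i ∧ fs.get j = h}) ∧
  I ⊔ Ideal.span {h | ∃ j : Fin fs.length, fs.get j = h} ≠ ⊤

/-- Arithmetic depth of the homogeneous coordinate ring of `C`: the supremum of lengths of
regular sequences of elements of the irrelevant maximal ideal. -/
def arithDepth (C : Set (ι → k)) : ℕ :=
  sSup {l : ℕ | ∃ fs : List (MvPolynomial ι k), fs.length = l ∧
    (∀ f ∈ fs, MvPolynomial.coeff 0 f = 0) ∧ IsRegSeqOn k ι (vanIdeal k ι C) fs}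

/-- `Z` is an irreducible Zariski-closed cone. -/
def IsIrredClosed (Z : Set (ι → k)) : Prop :=
  Z = {x | ∀ f ∈ vanIdeal k ι Z, MvPolynomial.eval x f = 0} ∧ (vanIdeal k ι Z).IsPrime

/-- `Z` is an irreducible component of `Q`: an irreducible closed subset of `Q`, maximal
among the irreducible closed subsets of `Q`. -/
def IsComponentOf (Z Q : Set (ι → k)) : Prop :=
  IsIrredClosed k ι Z ∧ Z ⊆ Q ∧
    ∀ Z' : Set (ι → k), IsIrredClosed k ι Z' → Z ⊆ Z' → Z' ⊆ Q → Z' = Z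

/-- `C` is smooth away from the cone vertex, of codimension `c`: at each nonzero point the
Jacobian of the vanishing ideal has rank `c` (valid criterion in characteristic `0`). -/
def IsSmoothOfCodim (C : Set (ι → k)) (c : ℕ) : Prop :=
  ∀ x ∈ C, x ≠ (0 : ι → k) →
    Module.finrank k (Submodule.span k
      {v : ι → k | ∃ f ∈ vanIdeal k ι C,
        v = fun i => MvPolynomial.eval x (MvPolynomial.pderiv i f)}) = c

/-- The projective variety with affine cone `C` is a cone (in the projective sense):
there is a vertex point `[v]` such that `C` is stable under the join with `[v]`. -/
def IsConeVariety (C : Set (ι → k)) : Prop :=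
  ∃ v ∈ C, v ≠ 0 ∧ ∀ x ∈ C, ∀ s t : k, s • x + t • v ∈ C

/-- `C` (an `n`-dimensional variety of degree `d`) has sectional genus `g`: a general linear
curve section (cut by `n - 1` general hyperplanes) has Hilbert polynomial `d·m + 1 - g`. -/
def SectionalGenus (n : ℕ) (C : Set (ι → k)) (d g : ℕ) : Prop :=
  ∃ P : MvPolynomial (Fin (n - 1) × ι) k, P ≠ 0 ∧
    ∀ w : Fin (n - 1) → ι → k, MvPolynomial.eval (fun q => w q.1 q.2) P ≠ 0 →
      ∀ᶠ m in Filter.atTop,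
        (hilb k ι (C ∩ {x | ∀ j, ∑ i, w j i * x i = 0}) m : ℤ) = d * m + 1 - g

/-- `C` (an `n`-dimensional variety of degree `c + 3`) is a variety of maximal sectional
regularity: there is an `n`-dimensional linear subspace `F(X) = ℙ(L)` such that
`X ∩ F(X)` is (scheme-theoretically) a hypersurface of degree `4` in `F(X) ≅ ℙⁿ`,
detected by the Hilbert function of the ideal sum. -/
def IsVMSR (n : ℕ) (C : Set (ι → k)) : Prop :=
  ∃ L : Submodule k (ι → k), Module.finrank k L = n + 1 ∧
    ∀ᶠ m in Filter.atTop,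
      idealHilb k ι (vanIdeal k ι C ⊔ vanIdeal k ι (L : Set (ι → k))) m =
        Nat.choose (m + n) n - Nat.choose (m - 4 + n) n

end PaperQuadrics

namespace PaperQuadrics

variable {k : Type} [Field k]

/-- The parametrization of the rational normal scroll `S(a₀, …, aₙ)` (so the scroll has
dimension `n + 1`): homogeneous coordinates are indexed by `(i, j)`, `0 ≤ j ≤ aᵢ`,
and the point of parameters `(s : t) ∈ ℙ¹`, `λ` has coordinates `λᵢ sʲ t^{aᵢ - j}`. -/
def scrollParam (n : ℕ) (a : Fin (n + 1) → ℕ) (s t : k) (lam : Fin (n + 1) → k) :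
    ((i : Fin (n + 1)) × Fin (a i + 1)) → k :=
  fun x => lam x.1 * s ^ (x.2 : ℕ) * t ^ (a x.1 - (x.2 : ℕ))

/-- The affine cone of the scroll `S(a₀, …, aₙ) ⊆ ℙ^{n+1+c-1}`, `c = Σ aᵢ`. -/
def scrollCone (n : ℕ) (a : Fin (n + 1) → ℕ) :
    Set (((i : Fin (n + 1)) × Fin (a i + 1)) → k) :=
  {v | ∃ s t lam, v = scrollParam n a s t lam}

/-- Global sections of `O_Y(A·H + b·F)` on the scroll `Y = S(a₀, …, aₙ)`, realized as
bihomogeneous polynomials in `s, t` (the `ℙ¹`-coordinates) and `T₀, …, Tₙ` (the fiber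
coordinates): each monomial has total `T`-degree `A` and `(s,t)`-degree `b + Σ mᵢ aᵢ`. -/
def sectionSpace (k : Type) [Field k] (n : ℕ) (a : Fin (n + 1) → ℕ) (A b : ℤ) :
    Submodule k (MvPolynomial (Fin 2 ⊕ Fin (n + 1)) k) where
  carrier := {F | ∀ m ∈ F.support,
    ((∑ i, m (Sum.inr i) : ℕ) : ℤ) = A ∧
    ((m (Sum.inl 0) + m (Sum.inl 1) : ℕ) : ℤ)
      = b + ∑ i, (m (Sum.inr i) : ℤ) * (a i : ℤ)}
  add_mem' := by
    intro p q hp hq m hm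
    rcases Finset.mem_union.mp (MvPolynomial.support_add hm) with h | h
    · exact hp m h
    · exact hq m h
  zero_mem' := by
    intro m hm
    simp at hm
  smul_mem' := by
    intro c p hp m hm
    exact hp m (MvPolynomial.support_smul hm)

/-- The affine cone of the effective divisor `X ≡ A·H + b·F` on the scroll cut out by a
section `F`: the points of the scroll whose parameters are zeros of `F`. -/
def divisorCone (n : ℕ) (a : Fin (n + 1) → ℕ)
    (F : MvPolynomial (Fin 2 ⊕ Fin (n + 1)) k) :
    Set (((i : Fin (n + 1)) × Fin (a i + 1)) → k) :=
  {v | ∃ s t lam, v = scrollParam n a s t lam ∧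
     MvPolynomial.eval (Sum.elim (fun j : Fin 2 => if j = 0 then s else t) lam) F = 0}

end PaperQuadrics

open PaperQuadrics

section RelativeClosure

variable {Ω : Type} [Field Ω] [CharZero Ω]

/-- The relative algebraic closure in `Ω` of the subfield generated by a set. -/
def acl (S : Set Ω) : Subfield Ω := (algebraicClosure (IntermediateField.adjoin ℚ S) Ω).toSubfield

lemma mem_acl {S : Set Ω} {x : Ω} : x ∈ acl S ↔ IsAlgebraic (IntermediateField.adjoin ℚ S) x :=
  mem_algebraicClosure_iff

lemma coe_acl (S : Set Ω) : (acl S : Set Ω) = (AlgebraicIndependent.matroid ℚ Ω).closure S := by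
  rw [AlgebraicIndependent.matroid_closure_eq]
  ext x
  simp only [SetLike.mem_coe, mem_acl, IntermediateField.isAlgebraic_adjoin_iff]
  exact Iff.rfl

lemma subset_acl (S : Set Ω) : S ⊆ acl S := by
  rw [coe_acl]; exact Matroid.subset_closure _ _ (by simp)

lemma acl_mono {S T : Set Ω} (h : S ⊆ T) : acl S ≤ acl T := by
  rw [← SetLike.coe_subset_coe, coe_acl, coe_acl]; exact Matroid.closure_subset_closure _ h

lemma acl_acl (S : Set Ω) : acl (acl S : Set Ω) = acl S := by
  rw [← SetLike.coe_set_eq, coe_acl, coe_acl]; exact Matroid.closure_closure _ _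

lemma acl_exchange {S : Set Ω} {x y : Ω} (hy : y ∉ acl S) (hyx : y ∈ acl (insert x S)) :
    x ∈ acl (insert y S) := by
  rw [← SetLike.mem_coe, coe_acl] at *
  exact Matroid.mem_closure_insert hy hyx

lemma acl_insert_acl (S : Set Ω) (x : Ω) : acl (insert x (acl S : Set Ω)) = acl (insert x S) := by
  rw [← SetLike.coe_set_eq, coe_acl, coe_acl, coe_acl]
  exact Matroid.closure_insert_closure_eq_closure_insert _ _ _

lemma mem_acl_coe {K : Subfield Ω} {x : Ω} : x ∈ acl (K : Set Ω) ↔ IsAlgebraic K x := by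
  rw [mem_acl]
  have h : ((IntermediateField.adjoin ℚ (K : Set Ω) : IntermediateField ℚ Ω) : Set Ω) = K := by
    apply Set.Subset.antisymm
    · rw [← IntermediateField.coe_toSubfield, IntermediateField.adjoin_toSubfield]
      refine Subfield.closure_le.2 (Set.union_subset ?_ le_rfl)
      rintro _ ⟨q, rfl⟩
      simp
    · exact IntermediateField.subset_adjoin _ _
  have h1 : ∀ y, y ∈ IntermediateField.adjoin ℚ (K : Set Ω) ↔ y ∈ K := fun y => by
    rw [← SetLike.mem_coe, h, SetLike.mem_coe]
  have h2 : (IntermediateField.adjoin ℚ (K : Set Ω)).toSubfield = K := by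
    ext y; exact h1 y
  have h3 : IsAlgebraic (IntermediateField.adjoin ℚ (K : Set Ω)).toSubfield x ↔
    IsAlgebraic K x := by rw [h2]
  exact h3

/-- A subfield of `Ω` is algebraically closed in `Ω`. -/
def AclClosed (K : Subfield Ω) : Prop := acl (K : Set Ω) = K

lemma aclClosed_acl (S : Set Ω) : AclClosed (acl S) := acl_acl S

lemma AclClosed.mem {K : Subfield Ω} (hK : AclClosed K) {x : Ω} (hx : IsAlgebraic K x) : x ∈ K := by
  rw [← hK]; exact mem_acl_coe.2 hx

lemma AclClosed.acl_le {K : Subfield Ω} (hK : AclClosed K) {S : Set Ω} (h : S ⊆ K) : acl S ≤ K := by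
  rw [← hK]; exact acl_mono h

lemma isAlgebraic_of_mem_acl {S : Set Ω} {K : Subfield Ω} (h : S ⊆ K) {x : Ω} (hx : x ∈ acl S) :
    IsAlgebraic K x := mem_acl_coe.1 (acl_mono h hx)

/-- The algebraic closure of `K(x)`. -/
def aadj (K : Subfield Ω) (x : Ω) : Subfield Ω := acl (insert x (K : Set Ω))

lemma aclClosed_aadj (K : Subfield Ω) (x : Ω) : AclClosed (aadj K x) := aclClosed_acl _

lemma le_aadj (K : Subfield Ω) (x : Ω) : K ≤ aadj K x :=
  fun _ hy => subset_acl _ (Set.mem_insert_of_mem _ hy)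

lemma self_mem_aadj (K : Subfield Ω) (x : Ω) : x ∈ aadj K x := subset_acl _ (Set.mem_insert _ _)

lemma aadj_le {K M : Subfield Ω} (hM : AclClosed M) (h : K ≤ M) {x : Ω} (hx : x ∈ M) :
    aadj K x ≤ M := hM.acl_le (Set.insert_subset hx h)

lemma aadj_exchange {K : Subfield Ω} (hK : AclClosed K) {x y : Ω} (hy : y ∉ K)
    (hyx : y ∈ aadj K x) : x ∈ aadj K y := by
  have h : y ∉ acl (K : Set Ω) := by
    rw [show acl (K : Set Ω) = K from hK]; exact hy
  exact acl_exchange h hyx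

lemma aadj_comm (K : Subfield Ω) (x y : Ω) : aadj (aadj K x) y = aadj (aadj K y) x := by
  rw [aadj, aadj, aadj, aadj, acl_insert_acl, acl_insert_acl, Set.insert_comm]

/-- The closure obtained by adjoining a list of elements. -/
def aadjList : Subfield Ω → List Ω → Subfield Ω
  | K, [] => K
  | K, x :: l => aadjList (aadj K x) l

lemma le_aadjList (K : Subfield Ω) (l : List Ω) : K ≤ aadjList K l := by
  induction l generalizing K with
  | nil => exact le_rfl
  | cons x l ih => exact (le_aadj K x).trans (ih _)

lemma mem_aadjList (K : Subfield Ω) {l : List Ω} {x : Ω} (hx : x ∈ l) : x ∈ aadjList K l := by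
  induction l generalizing K with
  | nil => simp at hx
  | cons y l ih =>
    rcases List.mem_cons.1 hx with rfl | h
    · exact le_aadjList (aadj K x) l (self_mem_aadj K x)
    · exact ih _ h

lemma aclClosed_aadjList {K : Subfield Ω} (hK : AclClosed K) (l : List Ω) :
    AclClosed (aadjList K l) := by
  induction l generalizing K with
  | nil => exact hK
  | cons y l ih => exact ih (aclClosed_aadj K y)

lemma aadjList_le {K M : Subfield Ω} (hM : AclClosed M) (h : K ≤ M) {l : List Ω}
    (hl : ∀ x ∈ l, x ∈ M) : aadjList K l ≤ M := by
  induction l generalizing K with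
  | nil => exact h
  | cons y l ih => exact ih (aadj_le hM h (hl y (by simp))) fun x hx => hl x (by simp [hx])

/-- Iterated algebraic independence of a list of elements. -/
def AInd : Subfield Ω → List Ω → Prop
  | _, [] => True
  | K, x :: l => x ∉ K ∧ AInd (aadj K x) l

lemma AInd.swap {K : Subfield Ω} (hK : AclClosed K) {x y : Ω} {l : List Ω}
    (h : AInd K (x :: y :: l)) : AInd K (y :: x :: l) := by
  obtain ⟨hx, hy, hl⟩ := h
  refine ⟨fun h => hy (le_aadj K x h), fun h => hy (aadj_exchange hK hx h), ?_⟩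
  rwa [aadj_comm]

lemma AInd.notMem {K : Subfield Ω} (hK : AclClosed K) {x : Ω} {l : List Ω}
    (h : AInd K (x :: l)) : x ∉ aadjList K l := by
  induction l generalizing K with
  | nil => exact h.1
  | cons y l ih => exact ih (aclClosed_aadj K y) (h.swap hK).2

lemma aadj_add_mul {K : Subfield Ω} {x y a : Ω} (hx : x ∈ K) (ha : a ∈ K) :
    aadj K (y + a * x) = aadj K y := by
  have key : ∀ y a, a ∈ K → aadj K (y + a * x) ≤ aadj K y := fun y a ha =>
    aadj_le (aclClosed_aadj K y) (le_aadj K y) (add_mem (self_mem_aadj K y)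
      (le_aadj K y (mul_mem ha hx)))
  refine le_antisymm (key y a ha) ?_
  have := key (y + a * x) (-a) (neg_mem ha)
  rwa [add_assoc, neg_mul, add_neg_cancel, add_zero] at this

/-- Shear of the second variable. -/
lemma AInd.shear {K : Subfield Ω} {x y a : Ω} {l : List Ω} (ha : a ∈ K)
    (h : AInd K (x :: y :: l)) : AInd K (x :: (y + a * x) :: l) := by
  obtain ⟨hx, hy, hl⟩ := h
  have hxm : x ∈ aadj K x := self_mem_aadj K x
  have ham : a ∈ aadj K x := le_aadj K x ha
  refine ⟨hx, fun hh => hy ?_, ?_⟩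
  · have := sub_mem hh (mul_mem ham hxm)
    rwa [add_sub_cancel_right] at this
  · rwa [aadj_add_mul hxm ham]

end RelativeClosure

section Domination

variable {Ω : Type} [Field Ω]

/-- `t` is dominated, at every valuation trivial on `K`, by `1` and the elements of `l`. -/
def Dom (K : Subfield Ω) (l : List Ω) (t : Ω) : Prop :=
  ∀ A : ValuationSubring Ω, (K : Set Ω) ⊆ A → ∀ γ : A.ValueGroup, 1 ≤ γ →
    (∀ z ∈ l, A.valuation z ≤ γ) → A.valuation t ≤ γ

/-- `t` belongs to every valuation ring containing `K` and the elements of `l`. -/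
def Reg (K : Subfield Ω) (l : List Ω) (t : Ω) : Prop :=
  ∀ A : ValuationSubring Ω, (K : Set Ω) ⊆ A → (∀ z ∈ l, z ∈ A) → t ∈ A

lemma Dom.reg {K : Subfield Ω} {l : List Ω} {t : Ω} (h : Dom K l t) : Reg K l t := by
  intro A hA hl
  rw [← A.valuation_le_one_iff]
  exact h A hA 1 le_rfl fun z hz => (A.valuation_le_one_iff z).2 (hl z hz)

lemma Dom.of_mem_list {K : Subfield Ω} {l : List Ω} {t : Ω} (h : t ∈ l) : Dom K l t :=
  fun _ _ _ _ hl => hl t h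

lemma Dom.of_mem {K : Subfield Ω} {l : List Ω} {t : Ω} (h : t ∈ K) : Dom K l t :=
  fun A hA _ h1 _ => ((A.valuation_le_one_iff t).2 (hA h)).trans h1

lemma Dom.add {K : Subfield Ω} {l : List Ω} {t s : Ω} (ht : Dom K l t) (hs : Dom K l s) :
    Dom K l (t + s) :=
  fun A hA γ h1 hl => A.valuation.map_add_le (ht A hA γ h1 hl) (hs A hA γ h1 hl)

lemma Dom.smul {K : Subfield Ω} {l : List Ω} {t a : Ω} (ha : a ∈ K) (ht : Dom K l t) :
    Dom K l (a * t) := by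
  intro A hA γ h1 hl
  rw [map_mul]
  exact mul_le_of_le_one_of_le ((A.valuation_le_one_iff a).2 (hA ha)) (ht A hA γ h1 hl)

lemma Dom.sum {K : Subfield Ω} {l : List Ω} {ι : Type*} (s : Finset ι) {t : ι → Ω}
    (ht : ∀ i ∈ s, Dom K l (t i)) : Dom K l (∑ i ∈ s, t i) :=
  fun A hA γ h1 hl => A.valuation.map_sum_le fun i hi => ht i hi A hA γ h1 hl

/-- Change of the base field and of the dominating elements. -/
lemma Dom.trans {K K' : Subfield Ω} {l l' : List Ω} {t : Ω} (ht : Dom K l t) (hK : K ≤ K')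
    (hl : ∀ z ∈ l, Dom K' l' z) : Dom K' l' t :=
  fun A hA γ h1 hl' => ht A (fun _ hx => hA (hK hx)) γ h1 fun z hz => hl z hz A hA γ h1 hl'

lemma Reg.trans {K K' : Subfield Ω} {l l' : List Ω} {t : Ω} (ht : Reg K l t) (hK : K ≤ K')
    (hl : ∀ z ∈ l, Reg K' l' z) : Reg K' l' t :=
  fun A hA hl' => ht A (fun _ hx => hA (hK hx)) fun z hz => hl z hz A hA hl'

lemma Reg.of_mem_list {K : Subfield Ω} {l : List Ω} {t : Ω} (h : t ∈ l) : Reg K l t :=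
  (Dom.of_mem_list h).reg

lemma Reg.of_mem {K : Subfield Ω} {l : List Ω} {t : Ω} (h : t ∈ K) : Reg K l t :=
  (Dom.of_mem h).reg

lemma Reg.add {K : Subfield Ω} {l : List Ω} {t s : Ω} (ht : Reg K l t) (hs : Reg K l s) :
    Reg K l (t + s) := fun A hA hl => add_mem (ht A hA hl) (hs A hA hl)

lemma Reg.mul {K : Subfield Ω} {l : List Ω} {t s : Ω} (ht : Reg K l t) (hs : Reg K l s) :
    Reg K l (t * s) := fun A hA hl => mul_mem (ht A hA hl) (hs A hA hl)

lemma Reg.sum {K : Subfield Ω} {l : List Ω} {ι : Type*} (s : Finset ι) {t : ι → Ω}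
    (ht : ∀ i ∈ s, Reg K l (t i)) : Reg K l (∑ i ∈ s, t i) :=
  fun A hA hl => sum_mem fun i hi => ht i hi A hA hl

variable [CharZero Ω]

lemma exists_valuationSubring_notMem {K : Subfield Ω} (hK : AclClosed K) {t : Ω} (ht : t ∉ K) :
    ∃ A : ValuationSubring Ω, (K : Set Ω) ⊆ A ∧ t ∉ A := by
  by_contra hcon
  push Not at hcon
  have h : t ∈ (⨅ V : {V : ValuationSubring Ω // (K : Set Ω) ⊆ V.toSubring}, V.1.toSubring) := by
    rw [Subring.mem_iInf]
    exact fun V => hcon V.1 V.2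
  rw [iInf_valuationSubring_superset] at h
  refine ht (hK.mem ?_)
  have h1 : IsIntegral (Subring.closure (K : Set Ω)) t := h
  obtain ⟨p, hp, hpt⟩ := h1
  have hle : Subring.closure (K : Set Ω) ≤ K.toSubring := Subring.closure_le.2 le_rfl
  refine IsIntegral.isAlgebraic ⟨p.map (Subring.inclusion hle), hp.map _, ?_⟩
  rw [Polynomial.eval₂_map]
  exact hpt

lemma Reg.mem_aadjList {K : Subfield Ω} (hK : AclClosed K) {l : List Ω} {t : Ω}
    (ht : Reg K l t) : t ∈ aadjList K l := by
  by_contra hcon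
  obtain ⟨A, hA, hA'⟩ := exists_valuationSubring_notMem (aclClosed_aadjList hK l) hcon
  exact hA' (ht A (fun _ hx => hA (le_aadjList K l hx)) fun z hz => hA (_root_.mem_aadjList K hz))

/-- A regular function on affine space whose product with a nonzero affine linear form has at
most a simple pole at infinity is a constant. -/
theorem mem_of_dom_mul_of_reg {K : Subfield Ω} (hK : AclClosed K) {z : Ω} {l : List Ω}
    (hz : AInd K (z :: l)) {a t : Ω} (ha : a ∈ K) (hdom : Dom K (z :: l) (t * (z - a)))
    (hreg : Reg K (z :: l) t) : t ∈ K := by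
  induction l generalizing K with
  | nil =>
    by_contra ht
    obtain ⟨A, hA, htA⟩ := exists_valuationSubring_notMem hK ht
    have hzA : z ∉ A := fun h => htA (hreg A hA (by simpa using h))
    have hz1 : 1 < A.valuation z := by
      rw [← not_le, A.valuation_le_one_iff]; exact hzA
    have ha1 : A.valuation a ≤ 1 := (A.valuation_le_one_iff a).2 (hA ha)
    have hza : A.valuation (z - a) = A.valuation z :=
      Valuation.map_sub_eq_of_lt_left _ (ha1.trans_lt hz1)
    have h := hdom A hA (A.valuation z) hz1.le (by simp)
    rw [map_mul, hza] at h
    apply htA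
    rw [← A.valuation_le_one_iff]
    by_contra h2
    rw [not_le] at h2
    have h0 : 0 < A.valuation z := lt_trans zero_lt_one hz1
    have := mul_lt_mul_of_pos_right h2 h0
    rw [one_mul] at this
    exact absurd h (not_le.2 this)
  | cons y l ih =>
    have h1 := hz.swap hK
    have ht1 : t ∈ aadj K y := by
      refine ih (aclClosed_aadj K y) h1.2 (le_aadj K y ha)
        (hdom.trans (le_aadj K y) ?_) (hreg.trans (le_aadj K y) ?_)
      · intro x hx
        rcases List.mem_cons.1 hx with rfl | hx
        · exact .of_mem_list (by simp)
        rcases List.mem_cons.1 hx with rfl | hx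
        · exact .of_mem (self_mem_aadj K x)
        · exact .of_mem_list (by simp [hx])
      · intro x hx
        rcases List.mem_cons.1 hx with rfl | hx
        · exact .of_mem_list (by simp)
        rcases List.mem_cons.1 hx with rfl | hx
        · exact .of_mem (self_mem_aadj K x)
        · exact .of_mem_list (by simp [hx])
    have h2 : AInd K ((y + (-1) * z) :: z :: l) :=
      (hz.shear (neg_mem (one_mem K))).swap hK
    set w := y + (-1) * z with hw
    have hyw : y = w + z := by rw [hw]; ring
    have ht2 : t ∈ aadj K w := by
      refine ih (aclClosed_aadj K w) h2.2 (le_aadj K w ha)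
        (hdom.trans (le_aadj K w) ?_) (hreg.trans (le_aadj K w) ?_)
      · intro x hx
        rcases List.mem_cons.1 hx with rfl | hx
        · exact .of_mem_list (by simp)
        rcases List.mem_cons.1 hx with rfl | hx
        · rw [hyw]; exact (Dom.of_mem (self_mem_aadj K w)).add (.of_mem_list (by simp))
        · exact .of_mem_list (by simp [hx])
      · intro x hx
        rcases List.mem_cons.1 hx with rfl | hx
        · exact .of_mem_list (by simp)
        rcases List.mem_cons.1 hx with rfl | hx
        · rw [hyw]; exact (Reg.of_mem (self_mem_aadj K w)).add (.of_mem_list (by simp))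
        · exact .of_mem_list (by simp [hx])
    by_contra ht
    have h3 := aadj_exchange hK ht ht1
    have h4 := aadj_exchange hK ht ht2
    have h5 : z ∈ aadj K t := by
      have : z = y - w := by rw [hyw]; ring
      rw [this]; exact sub_mem h3 h4
    exact h1.2.1 (aadj_le (aclClosed_aadj K y) (le_aadj K y) ht1 h5)

end Domination

section Specialization

namespace Polynomial

/-- A rational function taking values in the subfield `K` at almost all points of `K` has
coefficients in `K`. -/
lemma exists_mul_map_eq_of_eval_mem {K E : Type*} [Field K] [Infinite K] [Field E]
    [Algebra K E] (f g : E[X]) (hg : g ≠ 0) (s : Set K) (hs : s.Finite)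
    (h : ∀ x ∉ s, ∃ y : K,
      f.eval (algebraMap K E x) = algebraMap K E y * g.eval (algebraMap K E x)) :
    ∃ f' g' : K[X], g' ≠ 0 ∧ f'.map (algebraMap K E) * g = g'.map (algebraMap K E) * f := by
  obtain ⟨φ, hφ⟩ : ∃ φ : Module.Dual K E, φ g.leadingCoeff ≠ 0 := by
    by_contra hcon
    push Not at hcon
    exact hg (leadingCoeff_eq_zero.1 ((Module.forall_dual_apply_eq_zero_iff K _).1 hcon))
  let T : E[X] → K[X] := fun p => ∑ i ∈ p.support, C (φ (p.coeff i)) * X ^ i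
  have hT : ∀ (p : E[X]) (x : K), (T p).eval x = φ (p.eval (algebraMap K E x)) := by
    intro p x
    have : p.eval (algebraMap K E x) = ∑ i ∈ p.support, p.coeff i * algebraMap K E x ^ i := by
      rw [eval_eq_sum, Polynomial.sum]
    simp only [T, eval_finsetSum, eval_mul, eval_C, eval_pow, eval_X, this, map_sum]
    refine Finset.sum_congr rfl fun i _ => ?_
    rw [← map_pow, mul_comm (p.coeff i), ← Algebra.smul_def, map_smul, smul_eq_mul, mul_comm]
  refine ⟨T f, T g, ?_, ?_⟩
  · intro h0
    apply hφ
    have : (T g).coeff g.natDegree = φ g.leadingCoeff := by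
      simp only [T, finsetSum_coeff, coeff_C_mul, coeff_X_pow]
      rw [Finset.sum_eq_single g.natDegree]
      · simp
      · intro b _ hb; simp [hb.symm]
      · intro hb; simp [notMem_support_iff.1 hb]
    rw [← this, h0, coeff_zero]
  · refine eq_of_infinite_eval_eq _ _ (Set.Infinite.mono (s := (algebraMap K E) '' sᶜ) ?_ ?_)
    · rintro _ ⟨x, hx, rfl⟩
      obtain ⟨y, hy⟩ := h x hx
      simp only [Set.mem_ofPred_eq, eval_mul, eval_map_algebraMap, aeval_algebraMap_apply,
        coe_aeval_eq_eval, hT, hy]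
      rw [← Algebra.smul_def y, map_smul, smul_eq_mul, map_mul, Algebra.smul_def]
      ring
    · exact (hs.infinite_compl).image (FaithfulSMul.algebraMap_injective K E).injOn

lemma mem_adjoin_of_isAlgebraic_adjoin {K E Ω : Type*} [Field K] [Infinite K] [Field E] [Field Ω]
    [Algebra K E] [Algebra E Ω] [Algebra K Ω] [IsScalarTower K E Ω]
    (hE : ∀ x : E, IsAlgebraic K x → x ∈ (algebraMap K E).range) {r : Ω} (hr : Transcendental E r)
    {e : Ω} (he : e ∈ IntermediateField.adjoin E {r})
    (halg : IsAlgebraic (IntermediateField.adjoin K {r}) e) :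
    e ∈ IntermediateField.adjoin K {r} := by
  obtain ⟨f, g, rfl⟩ := (IntermediateField.mem_adjoin_simple_iff _ _).1 he
  have inj : ∀ p : E[X], aeval r p = 0 → p = 0 := fun p hp =>
    (transcendental_iff.1 hr) p hp
  by_cases hg : g = 0
  · simp [hg]
  have hgr : aeval r g ≠ 0 := fun h => hg (inj g h)
  rw [IntermediateField.isAlgebraic_adjoin_iff] at halg
  obtain ⟨P, hP, hPe⟩ := halg
  have hcoef : ∀ i, ∃ a : K[X], aeval r a = ((P.coeff i : Algebra.adjoin K {r}) : Ω) := by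
    intro i
    have h := fun y => (SetLike.ext_iff.1 (Algebra.adjoin_singleton_eq_range_aeval K r) y).1
    exact h _ (P.coeff i).2
  choose a ha using hcoef
  set m := P.natDegree with hm
  have ham : a m ≠ 0 := by
    intro h
    have := ha m
    rw [h, map_zero] at this
    exact hP (leadingCoeff_eq_zero.1 (Subtype.ext this.symm))
  have hH : ∑ i ∈ Finset.range (m + 1), (a i).map (algebraMap K E) * f ^ i * g ^ (m - i) = 0 := by
    apply inj
    rw [aeval_eq_sum_range, ← hm] at hPe
    have : aeval r g ^ m *
        ∑ i ∈ Finset.range (m + 1), P.coeff i • (aeval r f / aeval r g) ^ i = 0 := by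
      rw [hPe, mul_zero]
    rw [← this, map_sum, Finset.mul_sum]
    refine Finset.sum_congr rfl fun i hi => ?_
    have hi' : i ≤ m := Nat.lt_succ_iff.1 (Finset.mem_range.1 hi)
    rw [map_mul, map_mul, map_pow, map_pow, aeval_map_algebraMap, ha, Algebra.smul_def, div_pow,
      ← Nat.sub_add_cancel hi', pow_add, Nat.add_sub_cancel]
    change _ = _ * (((P.coeff i : Algebra.adjoin K {r}) : Ω) * _)
    field_simp
  have hval : ∀ x ∉ {x : K | (a m).eval x = 0 ∨ g.eval (algebraMap K E x) = 0}, ∃ y : K,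
      f.eval (algebraMap K E x) = algebraMap K E y * g.eval (algebraMap K E x) := by
    intro x hx
    simp only [Set.mem_ofPred_eq, not_or] at hx
    obtain ⟨hx1, hx2⟩ := hx
    have hmem := hE (f.eval (algebraMap K E x) / g.eval (algebraMap K E x)) (by
      refine ⟨∑ i ∈ Finset.range (m + 1), C ((a i).eval x) * X ^ i, ?_, ?_⟩
      · intro h0
        apply hx1
        have := congrArg (fun p => p.coeff m) h0
        simpa [finsetSum_coeff, coeff_X_pow] using this
      · have h2 := congrArg (eval (algebraMap K E x)) hH
        simp only [eval_finsetSum, eval_mul, eval_pow, eval_map_algebraMap, eval_zero,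
          aeval_algebraMap_apply, coe_aeval_eq_eval] at h2
        have h3 : g.eval (algebraMap K E x) ^ m * ∑ i ∈ Finset.range (m + 1),
            algebraMap K E ((a i).eval x) *
              (f.eval (algebraMap K E x) / g.eval (algebraMap K E x)) ^ i = 0 := by
          rw [← h2, Finset.mul_sum]
          refine Finset.sum_congr rfl fun i hi => ?_
          have hi' : i ≤ m := Nat.lt_succ_iff.1 (Finset.mem_range.1 hi)
          rw [div_pow, ← Nat.sub_add_cancel hi', pow_add, Nat.add_sub_cancel]
          field_simp
        have h4 := (mul_eq_zero.1 h3).resolve_left (pow_ne_zero _ hx2)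
        simpa [map_sum] using h4)
    obtain ⟨y, hy⟩ := hmem
    exact ⟨y, by rw [hy, div_mul_cancel₀ _ hx2]⟩
  have hfin : {x : K | (a m).eval x = 0 ∨ g.eval (algebraMap K E x) = 0}.Finite := by
    classical
    refine Set.Finite.union (s := {x : K | (a m).eval x = 0})
      (t := {x : K | g.eval (algebraMap K E x) = 0}) ?_ ?_
    · exact ((a m).roots.toFinset.finite_toSet).subset fun x hx => by simpa [ham] using hx
    · refine Set.Finite.of_finite_image (f := algebraMap K E) ?_
        (FaithfulSMul.algebraMap_injective K E).injOn
      exact (g.roots.toFinset.finite_toSet).subset fun y hy => by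
        obtain ⟨x, hx, rfl⟩ := hy
        simpa [hg] using hx
  obtain ⟨f', g', hg', hfg⟩ := exists_mul_map_eq_of_eval_mem f g hg _ hfin hval
  have hg'r : aeval r g' ≠ 0 := by
    intro h
    rw [← aeval_map_algebraMap E] at h
    exact hg' ((Polynomial.map_eq_zero _).1 (inj _ h))
  refine (IntermediateField.mem_adjoin_simple_iff _ _).2 ⟨f', g', ?_⟩
  have := congrArg (aeval r) hfg
  rw [map_mul, map_mul, aeval_map_algebraMap, aeval_map_algebraMap] at this
  rw [div_eq_div_iff hgr hg'r, this]
  ring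

end Polynomial

end Specialization

namespace Polynomial

/-- Linear relations with algebraic coefficients, between elements of an extension in which the
base field is algebraically closed, come from relations with coefficients in the base field. -/
lemma exists_relations_of_isAlgebraic {K F Ω J : Type*} [Field K] [CharZero K] [Field F] [Field Ω]
    [Algebra K F] [Algebra F Ω] [Algebra K Ω] [IsScalarTower K F Ω] [Fintype J]
    (hF : ∀ x : F, IsAlgebraic K x → x ∈ (algebraMap K F).range)
    (c : J → Ω) (hc : ∀ j, IsAlgebraic K (c j)) (w : J → F)
    (h : ∑ j, c j * algebraMap F Ω (w j) = 0) :
    ∃ (θ : Ω) (p : J → K[X]), (∀ j, c j = aeval θ (p j)) ∧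
      ∀ k, ∑ j, algebraMap K F ((p j).coeff k) * w j = 0 := by
  have : FiniteDimensional K (IntermediateField.adjoin K (Set.range c)) :=
    IntermediateField.finiteDimensional_adjoin fun x hx => by
      obtain ⟨j, rfl⟩ := hx
      exact (hc j).isIntegral
  obtain ⟨θ', hθ'⟩ := Field.exists_primitive_element K (IntermediateField.adjoin K (Set.range c))
  set θ : Ω := θ'.1 with hθ
  have hθint : IsIntegral K θ :=
    (Algebra.IsIntegral.isIntegral θ').map (IntermediateField.val _)
  have hp : ∀ j, ∃ p : K[X], c j = aeval θ p ∧ p.degree < (minpoly K θ).degree := by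
    intro j
    have hmem : (⟨c j, IntermediateField.subset_adjoin _ _ ⟨j, rfl⟩⟩ :
        IntermediateField.adjoin K (Set.range c)) ∈ IntermediateField.adjoin K {θ'} := by
      rw [hθ']; trivial
    have hmem' := hmem
    rw [← IntermediateField.mem_toSubalgebra,
      IntermediateField.adjoin_simple_toSubalgebra_of_isAlgebraic
        (Algebra.IsAlgebraic.isAlgebraic θ'), Algebra.adjoin_singleton_eq_range_aeval] at hmem'
    obtain ⟨q, hq⟩ := hmem'
    refine ⟨q %ₘ minpoly K θ, ?_, degree_modByMonic_lt _ (minpoly.monic hθint)⟩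
    have h1 := congrArg (IntermediateField.val _) hq
    have h2 : c j = aeval θ q := by
      rw [hθ]
      have h3 : (IntermediateField.val _) (aeval θ' q) = aeval θ'.1 q :=
        (aeval_algHom_apply (IntermediateField.val _) θ' q).symm
      rw [← h3]
      exact h1.symm
    rw [h2, aeval_modByMonic_eq_self_of_root (minpoly.aeval K θ)]
  choose p hp hdeg using hp
  refine ⟨θ, p, hp, ?_⟩
  -- the minimal polynomial does not change
  have hmin : (minpoly K θ).degree ≤ (minpoly F θ).degree := by
    have h1 := integralClosure.mem_lifts_of_monic_of_dvd_map F (minpoly.monic hθint)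
      (minpoly.monic (hθint.tower_top (A := F))) (minpoly.dvd_map_of_isScalarTower K F θ)
    have h2 : ∃ q : K[X], q.map (algebraMap K F) = minpoly F θ := by
      rw [← mem_lifts, lifts_iff_coeff_lifts]
      rw [lifts_iff_coeff_lifts] at h1
      intro n
      obtain ⟨y, hy⟩ := h1 n
      exact hF _ (by rw [← hy]; exact y.2.isAlgebraic)
    obtain ⟨q, hq⟩ := h2
    have hq0 : q ≠ 0 := by
      rintro rfl
      rw [Polynomial.map_zero] at hq
      exact (minpoly.ne_zero (hθint.tower_top (A := F))) hq.symm
    rw [← hq, degree_map]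
    apply minpoly.degree_le_of_ne_zero K θ hq0
    rw [← aeval_map_algebraMap F, hq, minpoly.aeval]
  let P : F[X] := ∑ j, C (w j) * (p j).map (algebraMap K F)
  have hP : P = 0 := by
    by_contra hP0
    have h1 : (minpoly F θ).degree ≤ P.degree := minpoly.degree_le_of_ne_zero F θ hP0 (by
      rw [← h, map_sum]
      refine Finset.sum_congr rfl fun j _ => ?_
      rw [map_mul, aeval_C, aeval_map_algebraMap, ← hp, mul_comm])
    have h2 : P.degree < (minpoly K θ).degree := by
      refine (degree_sum_le _ _).trans_lt ?_
      rw [Finset.sup_lt_iff (bot_lt_iff_ne_bot.2 (by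
        rw [Ne, degree_eq_bot]; exact minpoly.ne_zero hθint))]
      intro j _
      refine lt_of_le_of_lt ?_ (hdeg j)
      rw [← smul_eq_C_mul]
      exact (degree_smul_le _ _).trans (by rw [degree_map])
    exact absurd (hmin.trans h1) (not_le.2 h2)
  intro k
  have := congrArg (fun q => q.coeff k) hP
  simp only [P, finsetSum_coeff, coeff_C_mul, coeff_map, coeff_zero] at this
  rw [← this]
  exact Finset.sum_congr rfl fun j _ => mul_comm _ _

end Polynomial

section Nondegeneracy

variable {Ω : Type} [Field Ω]

/-- The subfield generated by `K` and `S`. -/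
def fadj (K : Subfield Ω) (S : Set Ω) : Subfield Ω := Subfield.closure (K ∪ S)

lemma le_fadj (K : Subfield Ω) (S : Set Ω) : K ≤ fadj K S :=
  fun _ hx => Subfield.subset_closure (Or.inl hx)

lemma subset_fadj (K : Subfield Ω) (S : Set Ω) : S ⊆ fadj K S :=
  fun _ hx => Subfield.subset_closure (Or.inr hx)

lemma fadj_le {K M : Subfield Ω} {S : Set Ω} (h : K ≤ M) (hS : S ⊆ M) : fadj K S ≤ M :=
  Subfield.closure_le.2 (Set.union_subset h hS)

lemma mem_fadj_iff {K : Subfield Ω} {S : Set Ω} {x : Ω} :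
    x ∈ fadj K S ↔ x ∈ IntermediateField.adjoin K S := by
  rw [← IntermediateField.mem_toSubfield, IntermediateField.adjoin_toSubfield, fadj]
  have : Set.range (algebraMap K Ω) = (K : Set Ω) := Subtype.range_coe
  rw [this]

/-- Linear independence over `K` modulo the span of `S`. -/
def IndepMod {ι : Type*} [Fintype ι] (K : Subfield Ω) (S : Set Ω) (u : ι → Ω) : Prop :=
  ∀ a : ι → K, ∑ i, a i • u i ∈ Submodule.span K S → a = 0

lemma IndepMod.of_le {ι : Type*} [Fintype ι] {K K' : Subfield Ω} (hK : K ≤ K') {S : Set Ω}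
    {u : ι → Ω} (h : IndepMod K' S u) : IndepMod K S u := by
  intro a ha
  have h1 := h (fun i => ⟨a i, hK (a i).2⟩) (by
    have hle : ∀ x ∈ Submodule.span K S, x ∈ Submodule.span K' S := by
      intro x hx
      induction hx using Submodule.span_induction with
      | mem x hx => exact Submodule.subset_span hx
      | zero => exact zero_mem _
      | add x y _ _ hx hy => exact add_mem hx hy
      | smul a x _ hx => exact Submodule.smul_mem _ (⟨a, hK a.2⟩ : K') hx
    exact hle _ ha)
  funext i
  have := congrFun h1 i
  exact Subtype.ext (congrArg (fun y : K' => (y : Ω)) this)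

open Polynomial in
/-- Common denominators in a simple extension. -/
lemma exists_common_denominator {K : Subfield Ω} {s : Ω} {J : Type*} [Finite J] (c : J → Ω)
    (hc : ∀ j, c j ∈ fadj K {s}) : ∃ (q : K[X]) (p : J → K[X]), Polynomial.aeval s q ≠ 0 ∧
      ∀ j, c j * Polynomial.aeval s q = Polynomial.aeval s (p j) := by
  have := Fintype.ofFinite J
  classical
  have h : ∀ j, ∃ r q : K[X], Polynomial.aeval s q ≠ 0 ∧
      c j * Polynomial.aeval s q = Polynomial.aeval s r := by
    intro j
    obtain ⟨r, q, h⟩ := (IntermediateField.mem_adjoin_simple_iff _ _).1 (mem_fadj_iff.1 (hc j))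
    by_cases hq : Polynomial.aeval s q = 0
    · exact ⟨0, 1, by simp, by simp [h, hq]⟩
    · exact ⟨r, q, hq, by rw [h, div_mul_cancel₀ _ hq]⟩
  choose r q hq hrq using h
  refine ⟨∏ j, q j, fun j => r j * ∏ i ∈ Finset.univ.erase j, q i, ?_, fun j => ?_⟩
  · rw [map_prod]; exact Finset.prod_ne_zero_iff.2 fun j _ => hq j
  · rw [← Finset.mul_prod_erase _ _ (Finset.mem_univ j), map_mul, map_mul, ← mul_assoc, hrq]

lemma Reg.aeval {K : Subfield Ω} {l : List Ω} {s : Ω} (hs : Reg K l s) (q : Polynomial K) :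
    Reg K l (Polynomial.aeval s q) := by
  intro A hA hl
  rw [Polynomial.aeval_eq_sum_range]
  refine sum_mem fun i _ => ?_
  rw [Algebra.smul_def]
  exact mul_mem (hA (q.coeff i).2) (pow_mem (hs A hA hl) i)

variable [CharZero Ω]

lemma IndepMod.fadj_singleton {ι : Type*} [Fintype ι] {K : Subfield Ω} (hK : AclClosed K)
    {s : Ω} {l : List Ω} (hs : AInd K (s :: l)) {u : ι → Ω} (hu : ∀ i, Dom K (s :: l) (u i))
    (h : IndepMod K ({1} ∪ {x | x ∈ s :: l}) u) :
    IndepMod (fadj K {s}) ({1} ∪ {x | x ∈ l}) u := by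
  intro a ha
  by_contra hne
  obtain ⟨i₀, hi₀⟩ : ∃ i, a i ≠ 0 := by
    by_contra hcon; push Not at hcon; exact hne (funext hcon)
  obtain ⟨n, f, g, hfg⟩ := Submodule.mem_span_set'.1 ha
  obtain ⟨q, p, hq, hp⟩ := exists_common_denominator (K := K) (s := s)
    (Sum.elim (fun i => ((a i : fadj K {s}) : Ω)) (fun j => ((f j : fadj K {s}) : Ω)))
    (by rintro (i | j) <;> exact SetLike.coe_mem _)
  have hrel : ∑ i, Polynomial.aeval s (p (Sum.inl i)) * u i =
      ∑ j, Polynomial.aeval s (p (Sum.inr j)) * (g j : Ω) := by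
    have h1 : ∑ j, (f j : Ω) * (g j : Ω) = ∑ i, (a i : Ω) * u i := hfg
    simp_rw [← hp, Sum.elim_inl, Sum.elim_inr, mul_right_comm, ← Finset.sum_mul]
    rw [h1]
  have hp0 : p (Sum.inl i₀) ≠ 0 := by
    intro h0
    have h1 := hp (Sum.inl i₀)
    rw [h0, map_zero, Sum.elim_inl] at h1
    rcases mul_eq_zero.1 h1 with h2 | h2
    · exact hi₀ (Subtype.ext h2)
    · exact hq h2
  have : Infinite K := inferInstance
  obtain ⟨b, hb⟩ : ∃ b : K, (p (Sum.inl i₀)).eval b ≠ 0 := by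
    by_contra hcon
    push Not at hcon
    exact hp0 (Polynomial.funext fun x => by rw [hcon x, Polynomial.eval_zero])
  have hdvd : ∀ j, ∃ r : Polynomial K, p j - Polynomial.C ((p j).eval b) =
      r * (Polynomial.X - Polynomial.C b) := by
    intro j
    obtain ⟨r, hr⟩ := Polynomial.X_sub_C_dvd_sub_C_eval (a := b) (p := p j)
    exact ⟨r, by rw [hr, mul_comm]⟩
  choose r hr using hdvd
  have hr' : ∀ j, Polynomial.aeval s (p j) = ((p j).eval b : K) +
      Polynomial.aeval s (r j) * (s - b) := by
    intro j
    have := congrArg (Polynomial.aeval s) (hr j)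
    simp only [map_sub, map_mul, Polynomial.aeval_C, Polynomial.aeval_X] at this
    rw [sub_eq_iff_eq_add'] at this
    exact this
  set t : Ω := ∑ j, Polynomial.aeval s (r (Sum.inr j)) * (g j : Ω) -
    ∑ i, Polynomial.aeval s (r (Sum.inl i)) * u i with ht
  set m : Ω := ∑ i, (((p (Sum.inl i)).eval b : K) : Ω) * u i -
    ∑ j, (((p (Sum.inr j)).eval b : K) : Ω) * (g j : Ω) with hm
  have htm : t * (s - b) = m := by
    simp only [hr', add_mul, Finset.sum_add_distrib] at hrel
    rw [ht, hm, sub_mul, Finset.sum_mul, Finset.sum_mul]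
    simp only [mul_right_comm _ _ (s - (b : Ω))]
    linear_combination (-1 : Ω) * hrel
  have hg : ∀ j, Dom K (s :: l) (g j : Ω) := by
    intro j
    rcases (g j).2 with h1 | h1
    · rw [Set.mem_singleton_iff] at h1
      rw [h1]; exact Dom.of_mem (one_mem K)
    · exact Dom.of_mem_list (List.mem_cons_of_mem _ h1)
  have hneg : ∀ {x : Ω}, Dom K (s :: l) x → Dom K (s :: l) (-x) := fun {x} hx => by
    have := hx.smul (neg_mem (one_mem K)); rwa [neg_one_mul] at this
  have hmdom : Dom K (s :: l) m := by
    rw [hm, sub_eq_add_neg]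
    exact (Dom.sum _ fun i _ => (hu i).smul (SetLike.coe_mem _)).add
      (hneg (Dom.sum _ fun j _ => (hg j).smul (SetLike.coe_mem _)))
  have hsreg : Reg K (s :: l) s := Reg.of_mem_list (by simp)
  have htreg : Reg K (s :: l) t := by
    have e : t = ∑ j, Polynomial.aeval s (r (Sum.inr j)) * (g j : Ω) +
        ∑ i, Polynomial.aeval s (-r (Sum.inl i)) * u i := by
      rw [ht]; simp [sub_eq_add_neg]
    rw [e]
    exact (Reg.sum _ fun j _ => (hsreg.aeval _).mul (hg j).reg).add
      (Reg.sum _ fun i _ => (hsreg.aeval _).mul (hu i).reg)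
  have htK : t ∈ K := mem_of_dom_mul_of_reg hK hs b.2 (by rwa [htm]) htreg
  have hspan : ∑ i, (p (Sum.inl i)).eval b • u i ∈
      Submodule.span K ({1} ∪ {x | x ∈ s :: l} : Set Ω) := by
    have e : ∑ i, (p (Sum.inl i)).eval b • u i =
        ∑ j, (p (Sum.inr j)).eval b • (g j : Ω) +
          ((⟨t, htK⟩ : K) • s - (⟨t, htK⟩ * b : K) • (1 : Ω)) := by
      simp only [Subfield.smul_def, smul_eq_mul, Subfield.coe_mul]
      linear_combination hm - htm
    rw [e]
    refine add_mem (sum_mem fun j _ => Submodule.smul_mem _ _ (Submodule.subset_span ?_))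
      (sub_mem (Submodule.smul_mem _ _ (Submodule.subset_span (Or.inr (by simp))))
      (Submodule.smul_mem _ _ (Submodule.subset_span (Or.inl rfl))))
    rcases (g j).2 with h1 | h1
    · exact Or.inl h1
    · exact Or.inr (List.mem_cons_of_mem _ h1)
  have h0 := h (fun i => (p (Sum.inl i)).eval b) hspan
  exact hb (congrFun h0 i₀)

/-- Extension of the base field to an algebraic extension, for elements of a field in which the
base field is algebraically closed. -/
lemma IndepMod.extend {ι : Type*} [Fintype ι] {K F K' : Subfield Ω} (hKF : K ≤ F)
    (hF : ∀ x ∈ F, IsAlgebraic K x → x ∈ K) (hK' : ∀ x ∈ K', IsAlgebraic K x) {S : Set Ω}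
    (hS : S ⊆ F) {u : ι → Ω} (hu : ∀ i, u i ∈ F) (h : IndepMod K S u) : IndepMod K' S u := by
  intro a ha
  obtain ⟨n, f, g, hfg⟩ := Submodule.mem_span_set'.1 ha
  let _ : Algebra K F := (Subfield.inclusion hKF).toAlgebra
  have : IsScalarTower K F Ω := .of_algebraMap_eq fun _ => rfl
  obtain ⟨θ, p, hp, hrel⟩ := Polynomial.exists_relations_of_isAlgebraic (K := K) (F := F) (Ω := Ω)
    (J := ι ⊕ Fin n) (fun x hx => ⟨⟨x, hF x x.2 (hx.algebraMap (A := Ω))⟩, rfl⟩)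
    (Sum.elim (fun i => (a i : Ω)) (fun j => -(f j : Ω)))
    (by rintro (i | j)
        · exact hK' _ (a i).2
        · exact (hK' _ (f j).2).neg)
    (Sum.elim (fun i => (⟨u i, hu i⟩ : F)) (fun j => ⟨g j, hS (g j).2⟩))
    (by
      have h1 : ∑ j, (f j : Ω) * (g j : Ω) = ∑ i, (a i : Ω) * u i := hfg
      simp only [Fintype.sum_sum_type, Sum.elim_inl, Sum.elim_inr, neg_mul, Finset.sum_neg_distrib]
      have h3 : (∑ i, (a i : Ω) * u i) + -∑ j, (f j : Ω) * (g j : Ω) = 0 := by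
        rw [h1, add_neg_cancel]
      exact h3)
  have hz : ∀ k i, (p (Sum.inl i)).coeff k = 0 := by
    intro k
    have h1 : ∑ i, (p (Sum.inl i)).coeff k • u i ∈ Submodule.span K S := by
      have h2 := congrArg (fun x : F => (x : Ω)) (hrel k)
      simp only [Fintype.sum_sum_type, Sum.elim_inl, Sum.elim_inr] at h2
      have h3 : ∑ i, (p (Sum.inl i)).coeff k • u i =
          -∑ j, (p (Sum.inr j)).coeff k • (g j : Ω) := by
        rw [eq_neg_iff_add_eq_zero]
        push_cast at h2
        exact h2
      rw [h3]
      exact neg_mem (sum_mem fun j _ => Submodule.smul_mem _ _ (Submodule.subset_span (g j).2))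
    exact congrFun (h _ h1)
  funext i
  apply Subtype.ext
  have h1 := hp (Sum.inl i)
  have h2 : p (Sum.inl i) = 0 := Polynomial.ext fun k => hz k i
  rw [h2, map_zero] at h1
  exact h1

end Nondegeneracy

section Bertini

variable {Ω : Type} [Field Ω] [CharZero Ω]

lemma AInd.scale {K : Subfield Ω} {x y a : Ω} {l : List Ω} (ha : a ∈ K) (ha0 : a ≠ 0)
    (h : AInd K (x :: y :: l)) : AInd K (x :: (a * y) :: l) := by
  obtain ⟨hx, hy, hl⟩ := h
  have ham : a ∈ aadj K x := le_aadj K x ha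
  have hinv : a⁻¹ * (a * y) = y := inv_mul_cancel_left₀ ha0 y
  refine ⟨hx, fun hh => hy ?_, ?_⟩
  · have := mul_mem (inv_mem ham) hh
    rwa [hinv] at this
  · have e : aadj (aadj K x) (a * y) = aadj (aadj K x) y := by
      refine le_antisymm (aadj_le (aclClosed_aadj _ _) (le_aadj _ _)
        (mul_mem (le_aadj _ _ ham) (self_mem_aadj _ _)))
        (aadj_le (aclClosed_aadj _ _) (le_aadj _ _) ?_)
      have := mul_mem (inv_mem (le_aadj _ (a * y) ham)) (self_mem_aadj (aadj K x) (a * y))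
      rwa [hinv] at this
    rwa [e]

lemma AInd.pencil {K : Subfield Ω} (hK : AclClosed K) {x y : Ω} {l : List Ω}
    (h : AInd K (x :: y :: l)) (a : K) : AInd K ((x + a * y) :: y :: l) :=
  ((h.swap hK).shear a.2).swap hK

lemma AInd.pencil_pair {K : Subfield Ω} (hK : AclClosed K) {x y : Ω} {l : List Ω}
    (h : AInd K (x :: y :: l)) {a b : K} (hab : a ≠ b) :
    AInd K ((x + a * y) :: (x + b * y) :: l) := by
  have h1 := ((h.pencil hK a).scale (a := ((b - a : K) : Ω)) (SetLike.coe_mem _)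
    (by exact fun hh => hab.symm (sub_eq_zero.1 (Subtype.ext hh)))).shear (one_mem K)
  have e : ((b - a : K) : Ω) * y + 1 * (x + a * y) = x + b * y := by
    push_cast; ring
  rwa [e] at h1

/-- A general member of a pencil of coordinates generates a field that is algebraically closed in
a given finite extension. -/
theorem exists_pencil_mem_fadj {K : Subfield Ω} (hK : AclClosed K) {x y : Ω} {l : List Ω}
    (h : AInd K (x :: y :: l))
    {L : Subfield Ω} (hL : L = fadj K {z | z ∈ x :: y :: l})
    (E : IntermediateField L Ω) [FiniteDimensional L E] :
    ∃ a : K, ∀ e ∈ E, e ∈ aadj K (x + a * y) → e ∈ fadj K {x + a * y} := by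
  have : Finite (IntermediateField L E) :=
    Field.finite_intermediateField_of_exists_primitive_element L E
      (Field.exists_primitive_element L E)
  let M : K → IntermediateField L Ω := fun a =>
    IntermediateField.adjoin L {e | e ∈ E ∧ e ∈ aadj K (x + a * y)}
  have hM : ∀ a, M a ≤ E := fun a => IntermediateField.adjoin_le_iff.2 fun e he => he.1
  have : Infinite K := inferInstance
  obtain ⟨a, b, hab, hab'⟩ := Finite.exists_ne_map_eq_of_infinite
    (fun a => IntermediateField.restrict (hM a))
  have hMM : M a = M b := by
    have := congrArg IntermediateField.lift hab'
    simpa only [IntermediateField.lift_restrict] using this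
  refine ⟨a, fun e heE hea => ?_⟩
  set Kh := aadjList (aadj K (x + b * y)) l with hKh
  have hKhc : AclClosed Kh := aclClosed_aadjList (aclClosed_aadj _ _) l
  have hKKh : K ≤ Kh := (le_aadj K _).trans (le_aadjList _ l)
  have hnot : x + a * y ∉ Kh := (h.pencil_pair hK hab).notMem hK
  have heb : e ∈ M b := by rw [← hMM]; exact IntermediateField.subset_adjoin _ _ ⟨heE, hea⟩
  have hfK : Kh ≤ fadj Kh {x + a * y} := le_fadj _ _
  have hxa : x + a * y ∈ fadj Kh {x + a * y} := subset_fadj _ _ rfl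
  have hxb : x + b * y ∈ fadj Kh {x + a * y} :=
    hfK (le_aadjList (aadj K (x + b * y)) l (self_mem_aadj K _))
  have ham : ∀ a : K, (a : Ω) ∈ fadj Kh {x + a * y} := fun a => le_fadj _ _ (hKKh a.2)
  have ham' : ∀ c : K, (c : Ω) ∈ fadj Kh {x + a * y} := fun c => hfK (hKKh c.2)
  have hy : y ∈ fadj Kh {x + a * y} := by
    have h0 : (a : Ω) - b ≠ 0 := by
      rw [Ne, sub_eq_zero]; exact fun hh => hab (Subtype.ext hh)
    have e1 : y = ((a : Ω) - b)⁻¹ * ((x + a * y) - (x + b * y)) := by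
      field_simp; ring
    refine (congrArg (· ∈ fadj Kh {x + a * y}) e1).mpr ?_
    exact mul_mem (inv_mem (sub_mem (ham' a) (ham' b))) (sub_mem hxa hxb)
  have hx : x ∈ fadj Kh {x + a * y} := by
    have := sub_mem hxa (mul_mem (ham' a) hy)
    rwa [add_sub_cancel_right] at this
  have hLK : L ≤ fadj Kh {x + a * y} := by
    rw [hL]
    refine fadj_le (hKKh.trans hfK) ?_
    intro z hz
    rcases List.mem_cons.1 hz with rfl | hz
    · exact hx
    rcases List.mem_cons.1 hz with rfl | hz
    · exact hy
    · exact hfK (mem_aadjList _ hz)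
  have heF : e ∈ fadj Kh {x + a * y} := by
    rw [← IntermediateField.mem_toSubfield, IntermediateField.adjoin_toSubfield] at heb
    refine (Subfield.closure_le.2 (Set.union_subset ?_ ?_) : _ ≤ fadj Kh {x + a * y}) heb
    · rintro _ ⟨t, rfl⟩
      exact hLK t.2
    · exact fun t ht => hfK (le_aadjList _ l ht.2)
  let _ : Algebra K Kh := (Subfield.inclusion hKKh).toAlgebra
  have : IsScalarTower K Kh Ω := .of_algebraMap_eq fun _ => rfl
  rw [mem_fadj_iff] at heF ⊢
  refine Polynomial.mem_adjoin_of_isAlgebraic_adjoin (K := K) (E := Kh) ?_ ?_ heF ?_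
  · intro t ht
    exact ⟨⟨t, hK.mem (ht.algebraMap (A := Ω))⟩, rfl⟩
  · exact fun hh => hnot (hKhc.mem hh)
  · exact isAlgebraic_of_mem_acl (K := (IntermediateField.adjoin K {x + (a : Ω) * y}).toSubfield)
      (Set.insert_subset (IntermediateField.subset_adjoin _ _ rfl)
        (fun t ht => (IntermediateField.adjoin K {x + (a : Ω) * y}).algebraMap_mem ⟨t, ht⟩)) hea

lemma isAlgebraic_fadj_of_mem_aadj {K : Subfield Ω} {s x : Ω} (hx : x ∈ aadj K s) :
    IsAlgebraic (fadj K {s}) x := by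
  have h : insert s (K : Set Ω) ⊆ fadj K {s} :=
    Set.insert_subset (subset_fadj K {s} rfl) (le_fadj K {s})
  exact isAlgebraic_of_mem_acl h hx

lemma mem_aadj_of_isAlgebraic_fadj {K : Subfield Ω} {s x : Ω} (hx : IsAlgebraic (fadj K {s}) x) :
    x ∈ aadj K s := by
  have hle : (fadj K {s} : Set Ω) ⊆ aadj K s :=
    fadj_le (le_aadj _ _) (by rintro _ rfl; exact self_mem_aadj _ _)
  exact (aclClosed_aadj K s).acl_le hle (mem_acl_coe.2 hx)

lemma aadjList_le_acl (K : Subfield Ω) (l : List Ω) :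
    aadjList K l ≤ acl (fadj K {x | x ∈ l} : Set Ω) :=
  aadjList_le (aclClosed_acl _) (fun _ hx => subset_acl _ (le_fadj _ _ hx))
    fun _ hx => subset_acl _ (subset_fadj _ _ hx)

lemma Reg.isAlgebraic {K : Subfield Ω} (hK : AclClosed K) {l : List Ω} {t : Ω}
    (ht : Reg K l t) : IsAlgebraic (fadj K {x | x ∈ l}) t :=
  mem_acl_coe.1 (aadjList_le_acl K l (ht.mem_aadjList hK))

/-- Elements dominated by algebraically independent coordinates that are linearly independent
modulo the affine linear forms are linearly independent over the function field modulo
constants. -/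
theorem IndepMod.over_fadj {ι : Type*} [Fintype ι] {K : Subfield Ω} (hK : AclClosed K) {l : List Ω}
    (hl : AInd K l) {u : ι → Ω} (hu : ∀ i, Dom K l (u i))
    (h : IndepMod K ({1} ∪ {x | x ∈ l}) u) : IndepMod (fadj K {x | x ∈ l}) {1} u := by
  match l, hl, hu, h with
  | [], _, _, h =>
    have e : ({1} ∪ {x | x ∈ ([] : List Ω)} : Set Ω) = {1} := by simp
    rw [e] at h
    refine h.of_le (fadj_le le_rfl ?_)
    simp
  | [z], hl, hu, h =>
    have e : ({1} ∪ {x | x ∈ ([] : List Ω)} : Set Ω) = {1} := by simp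
    have e' : {x | x ∈ [z]} = ({z} : Set Ω) := by ext; simp
    have := h.fadj_singleton hK hl hu
    rwa [e, ← e'] at this
  | z₀ :: z₁ :: l, hl, hu, h =>
    set L := fadj K {x | x ∈ z₀ :: z₁ :: l} with hL
    let E : IntermediateField L Ω := IntermediateField.adjoin L (Set.range u)
    have : FiniteDimensional L E := IntermediateField.finiteDimensional_adjoin fun x hx => by
      obtain ⟨i, rfl⟩ := hx
      exact ((hu i).reg.isAlgebraic hK).isIntegral
    obtain ⟨a, ha⟩ := exists_pencil_mem_fadj hK hl hL E
    set s := z₀ + a * z₁ with hs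
    have hz0 : z₀ = s + ((-a : K) : Ω) * z₁ := by rw [hs]; push_cast; ring
    have hsl : AInd K (s :: z₁ :: l) := hl.pencil hK a
    have hdz : ∀ z ∈ z₀ :: z₁ :: l, Dom K (s :: z₁ :: l) z := by
      intro z hz
      rcases List.mem_cons.1 hz with rfl | hz
      · rw [hz0]
        exact (Dom.of_mem_list (by simp)).add ((Dom.of_mem_list (by simp)).smul (SetLike.coe_mem _))
      · exact Dom.of_mem_list (List.mem_cons_of_mem _ hz)
    have hu' : ∀ i, Dom K (s :: z₁ :: l) (u i) := fun i => (hu i).trans le_rfl hdz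
    have hspan : Submodule.span K ({1} ∪ {x | x ∈ s :: z₁ :: l} : Set Ω) ≤
        Submodule.span K ({1} ∪ {x | x ∈ z₀ :: z₁ :: l} : Set Ω) := by
      refine Submodule.span_le.2 ?_
      rintro x (hx | hx)
      · exact Submodule.subset_span (Or.inl hx)
      rcases List.mem_cons.1 hx with rfl | hx
      · exact add_mem (Submodule.subset_span (Or.inr (by simp)))
          (Submodule.smul_mem _ a (Submodule.subset_span (Or.inr (by simp))))
      · exact Submodule.subset_span (Or.inr (List.mem_cons_of_mem _ hx))
    have h1 : IndepMod K ({1} ∪ {x | x ∈ s :: z₁ :: l}) u := fun b hb => h b (hspan hb)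
    have h2 := h1.fadj_singleton hK hsl hu'
    have hLE : ∀ x ∈ L, x ∈ E.toSubfield := fun x hx => E.algebraMap_mem ⟨x, hx⟩
    have hsL : s ∈ L := add_mem (subset_fadj _ _ (by simp))
      (mul_mem (le_fadj _ _ a.2) (subset_fadj _ _ (by simp)))
    have h3 : IndepMod (aadj K s) ({1} ∪ {x | x ∈ z₁ :: l}) u := by
      refine IndepMod.extend (K := fadj K {s}) (F := E.toSubfield) (K' := aadj K s)
        ?_ ?_ ?_ ?_ ?_ h2
      · refine fadj_le (fun x hx => hLE x (le_fadj _ _ hx)) ?_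
        rintro _ rfl
        exact hLE _ hsL
      · intro x hx hx'
        refine ha x hx ?_
        exact mem_aadj_of_isAlgebraic_fadj hx'
      · exact fun x hx => isAlgebraic_fadj_of_mem_aadj hx
      · rintro x (hx | hx)
        · rw [Set.mem_singleton_iff.1 hx]; exact one_mem _
        · exact hLE _ (subset_fadj _ _ (List.mem_cons_of_mem _ hx))
      · exact fun i => IntermediateField.subset_adjoin _ _ ⟨i, rfl⟩
    have h4 := IndepMod.over_fadj (aclClosed_aadj K s) hsl.2
      (fun i => (hu' i).trans (le_aadj K s) (by
      intro z hz
      rcases List.mem_cons.1 hz with rfl | hz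
      · exact Dom.of_mem (self_mem_aadj _ _)
      · exact Dom.of_mem_list hz)) h3
    refine h4.of_le (fadj_le ((le_aadj K s).trans (le_fadj _ _)) ?_)
    intro x hx
    rcases List.mem_cons.1 hx with rfl | hx
    · rw [hz0]
      exact add_mem (le_fadj _ _ (self_mem_aadj _ _)) (mul_mem
        (le_fadj _ _ (le_aadj _ _ (SetLike.coe_mem _))) (subset_fadj _ _ (by simp)))
    · exact subset_fadj _ _ hx
  termination_by l.length

end Bertini

section SpaceOfProducts

variable {L F : Type*} [Field L] [Field F] [Algebra L F]

/-- A subspace that contains `1` and a generating set, and is stable under multiplication by the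
generators, is everything. -/
lemma Submodule.eq_top_of_mul_le {U W : Submodule L F} (h1 : (1 : F) ∈ W)
    (hU : Algebra.adjoin L (U : Set F) = ⊤) (hW : ∀ x ∈ U, ∀ y ∈ W, x * y ∈ W) : W = ⊤ := by
  rw [eq_top_iff]
  have key : ∀ x ∈ Algebra.adjoin L (U : Set F), ∀ y ∈ W, x * y ∈ W := by
    intro x hx
    induction hx using Algebra.adjoin_induction with
    | mem x hx => exact hW x hx
    | algebraMap r => intro y hy; rw [← Algebra.smul_def]; exact W.smul_mem _ hy
    | add x y _ _ hx hy => intro z hz; rw [add_mul]; exact W.add_mem (hx z hz) (hy z hz)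
    | mul x y _ _ hx hy => intro z hz; rw [mul_assoc]; exact hx _ (hy z hz)
  intro x _
  simpa using key x (hU ▸ Algebra.mem_top) 1 h1

/-- A codimension at most one bound for the kernel of multiplication modulo `U`. -/
lemma Submodule.exists_smul_add_of_finrank_le [FiniteDimensional L F] {U V : Submodule L F}
    (hUV : U ≤ V) (h : Module.finrank L V ≤ Module.finrank L U + 1) {s : F} (hs : s ∈ V)
    (hsU : s ∉ U) {x : F} (hx : x ∈ V) : ∃ a : L, x - a • s ∈ U := by
  have hlt : U < U ⊔ Submodule.span L {s} := by
    refine lt_of_le_of_ne le_sup_left fun hh => hsU ?_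
    rw [hh]
    exact Submodule.mem_sup_right (Submodule.mem_span_singleton_self s)
  have hle : U ⊔ Submodule.span L {s} ≤ V :=
    sup_le hUV ((Submodule.span_singleton_le_iff_mem _ _).2 hs)
  have h1 := Submodule.finrank_lt_finrank_of_lt hlt
  have heq : U ⊔ Submodule.span L {s} = V :=
    Submodule.eq_of_le_of_finrank_le hle (by omega)
  rw [← heq] at hx
  obtain ⟨y, hy, z, hz, rfl⟩ := Submodule.mem_sup.1 hx
  obtain ⟨a, rfl⟩ := Submodule.mem_span_singleton.1 hz
  exact ⟨a, by simpa using hy⟩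

theorem finrank_mul_self_ge [FiniteDimensional L F] {U : Submodule L F} {c : ℕ} (hc : 2 ≤ c)
    (h1 : (1 : F) ∈ U) (hdim : Module.finrank L U = c + 1)
    (hU : Algebra.adjoin L (U : Set F) = ⊤) (hF : c + 3 ≤ Module.finrank L F) :
    c + 3 ≤ Module.finrank L (U * U : Submodule L F) := by
  by_contra hlt
  have hUU : U ≤ U * U := fun x hx => by simpa using Submodule.mul_mem_mul hx h1
  have hdim2 : Module.finrank L (U * U : Submodule L F) ≤ Module.finrank L U + 1 := by omega
  -- there is a product outside `U`
  have hne : ∃ u ∈ U, ∃ v ∈ U, u * v ∉ U := by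
    by_contra hcon
    push Not at hcon
    have := Submodule.eq_top_of_mul_le h1 hU hcon
    rw [this, finrank_top] at hdim
    omega
  have hmul : ∀ {x y : F}, x ∈ U → y ∈ U → x * y ∈ U * U :=
    fun hx hy => Submodule.mul_mem_mul hx hy
  -- any two products outside `U` have the same annihilator
  have hsame : ∀ u ∈ U, ∀ v ∈ U, u * v ∉ U → ∀ x ∈ U, u * x ∈ U → v * x ∈ U := by
    intro u hu v hv huv x hx hux
    by_contra hvx
    have hs := hmul hu hv
    have hcod : ∀ y ∈ U, u * v * y ∈ U * U := by
      intro y hy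
      obtain ⟨a, ha⟩ := Submodule.exists_smul_add_of_finrank_le hUU hdim2 (hmul hv hx) hvx
        (hmul hv hy)
      have e : u * v * y = u * (v * y - a • (v * x)) + a • (v * (u * x)) := by
        simp only [Algebra.smul_def]; ring
      rw [e]
      exact add_mem (hmul hu ha) (Submodule.smul_mem _ _ (hmul hv hux))
    have htop : U * U = ⊤ := by
      refine Submodule.eq_top_of_mul_le (hUU h1) hU fun x hx y hy => ?_
      obtain ⟨a, ha⟩ := Submodule.exists_smul_add_of_finrank_le hUU hdim2 hs huv hy
      have e : x * y = x * (y - a • (u * v)) + a • (u * v * x) := by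
        simp only [Algebra.smul_def]; ring
      rw [e]
      exact add_mem (hmul hx ha) (Submodule.smul_mem _ _ (hcod x hx))
    rw [htop, finrank_top] at hlt
    omega
  obtain ⟨u, hu, v, hv, huv⟩ := hne
  -- the annihilator is a subfield
  have hann : ∀ x ∈ U, u * x ∈ U → ∀ y ∈ U, x * y ∈ U := by
    intro x hx hux y hy
    have hvx := hsame u hu v hv huv x hx hux
    by_contra hxy
    have hout : ∀ z ∈ U, u * z ∉ U → ∀ t ∈ U, u * t ∈ U → z * t ∈ U :=
      fun z hz huz t ht hut => hsame u hu z hz huz t ht hut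
    by_cases huy : u * y ∈ U
    · have h2 : u * (x + v) ∉ U := fun hh => huv (by
        have := sub_mem hh hux; rwa [mul_add, add_sub_cancel_left] at this)
      have h3 := hout _ (add_mem hx hv) h2 y hy huy
      have h4 := hout v hv huv y hy huy
      exact hxy (by have := sub_mem h3 h4; rwa [add_mul, add_sub_cancel_right] at this)
    · exact hxy (by rw [mul_comm]; exact hout y hy huy x hx hux)
  let K : Subalgebra L F :=
    { carrier := {x | x ∈ U ∧ ∀ y ∈ U, x * y ∈ U}
      mul_mem' := fun {a b} ha hb => ⟨ha.2 _ hb.1, fun y hy => by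
        rw [mul_assoc]; exact ha.2 _ (hb.2 _ hy)⟩
      add_mem' := fun {a b} ha hb => ⟨add_mem ha.1 hb.1, fun y hy => by
        rw [add_mul]; exact add_mem (ha.2 _ hy) (hb.2 _ hy)⟩
      algebraMap_mem' := fun r => ⟨by
        rw [Algebra.algebraMap_eq_smul_one]; exact U.smul_mem _ h1, fun y hy => by
        rw [← Algebra.smul_def]; exact U.smul_mem _ hy⟩ }
  have hKU : Subalgebra.toSubmodule K ≤ U := fun x hx => hx.1
  have huK : u ∉ K := fun h => huv (h.2 v hv)
  have hKfield : IsField K := Algebra.IsIntegral.isField_iff_isField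
    (R := L) (S := K) (FaithfulSMul.algebraMap_injective L K) |>.1 (Field.toIsField L)
  have hinv : ∀ x ∈ K, x ≠ 0 → x⁻¹ ∈ K := by
    intro x hx hx0
    obtain ⟨b, hb⟩ := hKfield.mul_inv_cancel (a := ⟨x, hx⟩) (by simpa [Subtype.ext_iff] using hx0)
    have : x * (b : F) = 1 := by simpa [Subtype.ext_iff] using hb
    rw [inv_eq_of_mul_eq_one_right this]
    exact b.2
  -- the annihilator has codimension one
  have hKdim : c ≤ Module.finrank L (Subalgebra.toSubmodule K) := by
    have hle : U ≤ Subalgebra.toSubmodule K ⊔ Submodule.span L {v} := by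
      intro y hy
      obtain ⟨a, ha⟩ := Submodule.exists_smul_add_of_finrank_le hUU hdim2 (hmul hu hv) huv
        (hmul hu hy)
      have hmem : y - a • v ∈ U := sub_mem hy (U.smul_mem _ hv)
      have hK : y - a • v ∈ K := ⟨hmem, hann _ hmem (by
        convert ha using 1; simp only [Algebra.smul_def]; ring)⟩
      exact Submodule.mem_sup.2 ⟨_, hK, _, Submodule.smul_mem _ a
        (Submodule.mem_span_singleton_self v), by simp⟩
    have h2 := Submodule.finrank_mono hle
    have h3 := Submodule.finrank_add_le_finrank_add_finrank (Subalgebra.toSubmodule K)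
      (Submodule.span L {v})
    have h4 := finrank_span_le_card (R := L) ({v} : Set F)
    simp at h4
    omega
  let m : F →ₗ[L] F := LinearMap.mulRight L u
  have hu0 : u ≠ 0 := fun h => huv (by simp [h])
  have hm : Function.Injective m := mul_left_injective₀ hu0
  have hdisj : Disjoint (Subalgebra.toSubmodule K) ((Subalgebra.toSubmodule K).map m) := by
    rw [Submodule.disjoint_def]
    rintro x hx ⟨y, hy, rfl⟩
    by_contra hne
    have hy0 : y ≠ 0 := fun h => hne (by simp [h])
    exact huK (by
      have := K.mul_mem (hinv y hy hy0) hx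
      simpa [m, hy0] using this)
  have hsup : Subalgebra.toSubmodule K ⊔ (Subalgebra.toSubmodule K).map m ≤ U := by
    refine sup_le hKU ?_
    rintro _ ⟨y, hy, rfl⟩
    exact hy.2 u hu
  have h5 := Submodule.finrank_mono hsup
  have h6 := Submodule.finrank_sup_add_finrank_inf_eq (Subalgebra.toSubmodule K)
    ((Subalgebra.toSubmodule K).map m)
  rw [hdisj.eq_bot, finrank_bot] at h6
  have h7 := (Submodule.equivMapOfInjective m hm (Subalgebra.toSubmodule K)).finrank_eq
  omega

end SpaceOfProducts

section Complements

variable {Ω : Type} [Field Ω]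

lemma IndepMod.mono {ι : Type*} [Fintype ι] {K : Subfield Ω} {S T : Set Ω}
    (hST : S ⊆ Submodule.span K T) {u : ι → Ω} (h : IndepMod K T u) : IndepMod K S u :=
  fun a ha => h a (Submodule.span_le.2 hST ha)

lemma indepMod_coe {ι : Type*} [Fintype ι] {K : Subfield Ω} {Z : Submodule K Ω} {u : ι → Ω} :
    IndepMod K (Z : Set Ω) u ↔ ∀ a : ι → K, ∑ i, a i • u i ∈ Z → a = 0 := by
  rw [IndepMod, Submodule.span_eq]

/-- A basis of a complement. -/
lemma exists_indepMod_sup_span_eq {K : Subfield Ω} {Z W : Submodule K Ω} (hZW : Z ≤ W)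
    [FiniteDimensional K (W ⧸ Z.submoduleOf W)] :
    ∃ (m : ℕ) (u : Fin m → Ω), (∀ i, u i ∈ W) ∧ W = Z ⊔ Submodule.span K (Set.range u) ∧
      IndepMod K (Z : Set Ω) u := by
  let b := Module.finBasis K (W ⧸ Z.submoduleOf W)
  choose u hu using fun i => Submodule.Quotient.mk_surjective _ (b i)
  refine ⟨_, fun i => (u i : Ω), fun i => (u i).2, le_antisymm ?_ ?_, indepMod_coe.2 ?_⟩
  · intro x hx
    have h1 : (Z.submoduleOf W).mkQ (⟨x, hx⟩ -
        ∑ i, b.repr (Submodule.Quotient.mk ⟨x, hx⟩) i • u i) = 0 := by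
      rw [map_sub, map_sum, sub_eq_zero]
      simp_rw [map_smul, Submodule.mkQ_apply, hu]
      exact (b.sum_repr _).symm
    rw [Submodule.mkQ_apply, Submodule.Quotient.mk_eq_zero] at h1
    have h2 : x - ∑ i, b.repr (Submodule.Quotient.mk ⟨x, hx⟩) i • (u i : Ω) ∈ Z := by
      have h4 : ((⟨x, hx⟩ - ∑ i, b.repr (Submodule.Quotient.mk ⟨x, hx⟩) i • u i : W) : Ω) ∈ Z := h1
      rw [Submodule.coe_sub, Submodule.coe_sum] at h4
      exact h4
    have h3 : ∑ i, b.repr (Submodule.Quotient.mk ⟨x, hx⟩) i • (u i : Ω) ∈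
        Submodule.span K (Set.range fun i => (u i : Ω)) :=
      sum_mem fun i _ => Submodule.smul_mem _ _ (Submodule.subset_span ⟨i, rfl⟩)
    have := Submodule.add_mem_sup h2 h3
    rwa [sub_add_cancel] at this
  · refine sup_le hZW (Submodule.span_le.2 ?_)
    rintro _ ⟨i, rfl⟩
    exact (u i).2
  · intro a ha
    have h1 : ∑ i, a i • b i = 0 := by
      simp_rw [← hu, ← Submodule.mkQ_apply, ← map_smul]
      rw [← map_sum, Submodule.mkQ_apply, Submodule.Quotient.mk_eq_zero]
      have h4 : ((∑ i, a i • u i : W) : Ω) = ∑ i, a i • (u i : Ω) := by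
        rw [Submodule.coe_sum]; rfl
      exact (congrArg (· ∈ Z) h4).mpr ha
    exact funext (Fintype.linearIndependent_iff.1 b.linearIndependent a h1)

/-- Dimension count for independent vectors modulo a subspace. -/
lemma IndepMod.finrank_sup {K : Subfield Ω} {Z : Submodule K Ω} [FiniteDimensional K Z]
    {ι : Type*} [Fintype ι] {u : ι → Ω} (h : IndepMod K (Z : Set Ω) u) :
    Module.finrank K ↥(Z ⊔ Submodule.span K (Set.range u)) =
      Module.finrank K Z + Fintype.card ι := by
  rw [indepMod_coe] at h
  have hli : LinearIndependent K u := Fintype.linearIndependent_iff.2 fun a ha i =>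
    congrFun (h a (by rw [ha]; exact zero_mem _)) i
  have hdis : Z ⊓ Submodule.span K (Set.range u) = ⊥ := by
    rw [eq_bot_iff]
    rintro x ⟨hx, hx'⟩
    obtain ⟨a, rfl⟩ := (Submodule.mem_span_range_iff_exists_fun K).1 hx'
    rw [h a hx]; simp
  have : FiniteDimensional K (Submodule.span K (Set.range u)) :=
    FiniteDimensional.span_of_finite K (Set.finite_range u)
  have := Submodule.finrank_sup_add_finrank_inf_eq Z (Submodule.span K (Set.range u))
  rwa [hdis, finrank_bot, add_zero, finrank_span_eq_card hli] at this

lemma IndepMod.finrank_add_le {K : Subfield Ω} {Z W : Submodule K Ω} [FiniteDimensional K W]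
    (hZW : Z ≤ W) {ι : Type*} [Fintype ι] {u : ι → Ω} (h : IndepMod K (Z : Set Ω) u)
    (hu : ∀ i, u i ∈ W) : Module.finrank K Z + Fintype.card ι ≤ Module.finrank K W := by
  have : FiniteDimensional K Z := Submodule.finiteDimensional_of_le hZW
  rw [← h.finrank_sup]
  refine Submodule.finrank_mono (sup_le hZW (Submodule.span_le.2 ?_))
  rintro _ ⟨i, rfl⟩; exact hu i

lemma IndepMod.eq_sup {K : Subfield Ω} {Z W : Submodule K Ω} [FiniteDimensional K W]
    (hZW : Z ≤ W) {ι : Type*} [Fintype ι] {u : ι → Ω} (h : IndepMod K (Z : Set Ω) u)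
    (hu : ∀ i, u i ∈ W) (hle : Module.finrank K W ≤ Module.finrank K Z + Fintype.card ι) :
    Z ⊔ Submodule.span K (Set.range u) = W := by
  have : FiniteDimensional K Z := Submodule.finiteDimensional_of_le hZW
  refine Submodule.eq_of_le_of_finrank_le (sup_le hZW (Submodule.span_le.2 ?_)) ?_
  · rintro _ ⟨i, rfl⟩; exact hu i
  · rwa [h.finrank_sup]

lemma IndepMod.sumElim {K : Subfield Ω} {S : Set Ω} {ι κ : Type*} [Fintype ι] [Fintype κ]
    {u : ι → Ω} {e : κ → Ω} (hu : IndepMod K S u)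
    (he : IndepMod K (Submodule.span K (S ∪ Set.range u) : Set Ω) e) :
    IndepMod K S (Sum.elim u e) := by
  rw [indepMod_coe] at he
  intro a ha
  rw [Fintype.sum_sum_type] at ha
  simp only [Sum.elim_inl, Sum.elim_inr] at ha
  have h1 : ∑ i, a (Sum.inr i) • e i ∈ Submodule.span K (S ∪ Set.range u) := by
    have h2 : ∑ i, a (Sum.inl i) • u i ∈ Submodule.span K (S ∪ Set.range u) :=
      sum_mem fun i _ => Submodule.smul_mem _ _ (Submodule.subset_span (Or.inr ⟨i, rfl⟩))
    have := sub_mem (Submodule.span_mono Set.subset_union_left ha) h2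
    rwa [add_sub_cancel_left] at this
  have h3 := he (fun i => a (Sum.inr i)) h1
  have h4 : ∀ i, a (Sum.inr i) = 0 := fun i => congrFun h3 i
  simp only [h4, zero_smul, Finset.sum_const_zero, add_zero] at ha
  have h5 := hu (fun i => a (Sum.inl i)) ha
  funext i
  rcases i with i | i
  · exact congrFun h5 i
  · exact h4 i

lemma IndepMod.of_sumElim {K : Subfield Ω} {S : Set Ω} {ι κ : Type*} [Fintype ι] [Fintype κ]
    {u : ι → Ω} {e : κ → Ω} (h : IndepMod K S (Sum.elim u e)) :
    IndepMod K (Submodule.span K (S ∪ Set.range u) : Set Ω) e := by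
  rw [indepMod_coe]
  intro a ha
  rw [Submodule.span_union, Submodule.mem_sup] at ha
  obtain ⟨y, hy, z, hz, hyz⟩ := ha
  obtain ⟨b, rfl⟩ := (Submodule.mem_span_range_iff_exists_fun K).1 hz
  have h1 := h (Sum.elim (-b) a) (by
    rw [Fintype.sum_sum_type]
    simp only [Sum.elim_inl, Sum.elim_inr, Pi.neg_apply, neg_smul, Finset.sum_neg_distrib]
    rw [← hyz]
    convert hy using 1
    ring)
  funext i
  exact congrFun h1 (Sum.inr i)

end Complements

section Dominated

variable {Ω : Type} [Field Ω] {K : Subfield Ω} {l : List Ω} {V : Submodule K Ω}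

lemma span_coords_le (h1 : 1 ∈ V) (hlV : ∀ x ∈ l, x ∈ V) :
    Submodule.span K ({1} ∪ {x | x ∈ l} : Set Ω) ≤ V := by
  refine Submodule.span_le.2 ?_
  rintro x (hx | hx)
  · rw [Set.mem_singleton_iff.1 hx]; exact h1
  · exact hlV x hx

lemma mem_fadj_of_mem_span_coords {x : Ω}
    (hx : x ∈ Submodule.span K ({1} ∪ {x | x ∈ l} : Set Ω)) : x ∈ fadj K {x | x ∈ l} := by
  induction hx using Submodule.span_induction with
  | mem x hx =>
    rcases hx with hx | hx
    · rw [Set.mem_singleton_iff.1 hx]; exact one_mem _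
    · exact subset_fadj _ _ hx
  | zero => exact zero_mem _
  | add x y _ _ hx hy => exact add_mem hx hy
  | smul a x _ hx => exact mul_mem (le_fadj _ _ a.2) hx

variable [CharZero Ω]

lemma exists_complement_coords (hK : AclClosed K) (hl : AInd K l) [FiniteDimensional K V]
    (h1 : 1 ∈ V) (hlV : ∀ x ∈ l, x ∈ V) (hdom : ∀ v ∈ V, Dom K l v) :
    ∃ (m : ℕ) (u : Fin m → Ω), (∀ i, u i ∈ V) ∧
      V = Submodule.span K ({1} ∪ {x | x ∈ l} : Set Ω) ⊔ Submodule.span K (Set.range u) ∧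
      IndepMod K (Submodule.span K ({1} ∪ {x | x ∈ l} : Set Ω) : Set Ω) u ∧
      IndepMod (fadj K {x | x ∈ l}) {1} u ∧
      Submodule.span (fadj K {x | x ∈ l}) (V : Set Ω) =
        Submodule.span (fadj K {x | x ∈ l}) ({1} ∪ Set.range u) := by
  obtain ⟨m, u, hu, hV, hind⟩ := exists_indepMod_sup_span_eq (span_coords_le (V := V) h1 hlV)
  refine ⟨m, u, hu, hV, hind, ?_, le_antisymm ?_ ?_⟩
  · exact (hind.mono (Submodule.subset_span.trans Submodule.subset_span)).over_fadj hK hl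
      fun i => hdom _ (hu i)
  · refine Submodule.span_le.2 fun x hx => ?_
    rw [SetLike.mem_coe, hV, Submodule.mem_sup] at hx
    obtain ⟨y, hy, w, hw, rfl⟩ := hx
    refine add_mem ?_ ?_
    · have := Submodule.smul_mem (Submodule.span (fadj K {x | x ∈ l}) ({1} ∪ Set.range u : Set Ω))
        (⟨y, mem_fadj_of_mem_span_coords hy⟩ : fadj K {x | x ∈ l})
        (Submodule.subset_span (Or.inl rfl) : (1 : Ω) ∈ _)
      rwa [Subfield.smul_def, smul_eq_mul, mul_one] at this
    · obtain ⟨a, rfl⟩ := (Submodule.mem_span_range_iff_exists_fun K).1 hw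
      refine sum_mem fun i _ => ?_
      exact Submodule.smul_mem _ (⟨a i, le_fadj _ _ (a i).2⟩ : fadj K {x | x ∈ l})
        (Submodule.subset_span (Or.inr ⟨i, rfl⟩))
  · refine Submodule.span_mono ?_
    rintro x (hx | ⟨i, rfl⟩)
    · rw [Set.mem_singleton_iff.1 hx]; exact h1
    · exact hu i

/-- Dominated elements that are linearly independent modulo `V` remain so over the function field
of the coordinates. -/
lemma indepMod_span_fadj (hK : AclClosed K) (hl : AInd K l) [FiniteDimensional K V]
    (h1 : 1 ∈ V) (hlV : ∀ x ∈ l, x ∈ V) (hdom : ∀ v ∈ V, Dom K l v) {ι : Type*} [Fintype ι]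
    {e : ι → Ω} (he : ∀ i, Dom K l (e i)) (hind : IndepMod K (V : Set Ω) e) :
    IndepMod (fadj K {x | x ∈ l})
      (Submodule.span (fadj K {x | x ∈ l}) (V : Set Ω) : Set Ω) e := by
  obtain ⟨m, u, hu, hV, huind, -, hU⟩ := exists_complement_coords hK hl h1 hlV hdom
  rw [hU]
  refine IndepMod.of_sumElim (IndepMod.over_fadj hK hl ?_ ?_)
  · rintro (i | i)
    · exact hdom _ (hu i)
    · exact he i
  · refine (huind.mono (Submodule.subset_span.trans Submodule.subset_span)).sumElim ?_
    rw [Submodule.span_union, ← hV]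
    exact hind

lemma mem_of_sum_mul_mem_span (hK : AclClosed K) (hl : AInd K l) [FiniteDimensional K V]
    (h1 : 1 ∈ V) (hlV : ∀ x ∈ l, x ∈ V) (hdom : ∀ v ∈ V, Dom K l v) {ι : Type*} [Fintype ι]
    {z t : ι → Ω} (hz : ∀ i, z i ∈ fadj K {x | x ∈ l}) (hzind : LinearIndependent K z)
    (ht : ∀ i, Dom K l (t i))
    (hzt : ∑ i, z i * t i ∈ Submodule.span (fadj K {x | x ∈ l}) (V : Set Ω)) (i : ι) :
    t i ∈ V := by
  have : FiniteDimensional K (Submodule.span K (Set.range t)) :=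
    FiniteDimensional.span_of_finite K (Set.finite_range t)
  obtain ⟨m, e, he, hW, hind⟩ := exists_indepMod_sup_span_eq
    (le_sup_left : V ≤ V ⊔ Submodule.span K (Set.range t))
  have hdome : ∀ j, Dom K l (e j) := by
    intro j
    obtain ⟨v, hv, w, hw, hvw⟩ := Submodule.mem_sup.1 (he j)
    rw [← hvw]
    refine (hdom v hv).add ?_
    obtain ⟨a, rfl⟩ := (Submodule.mem_span_range_iff_exists_fun K).1 hw
    exact Dom.sum _ fun i _ => (ht i).smul (SetLike.coe_mem _)
  have hcoord : ∀ i, ∃ v ∈ V, ∃ a : Fin m → K, t i = v + ∑ j, a j • e j := by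
    intro i
    have h2 : t i ∈ V ⊔ Submodule.span K (Set.range t) :=
      Submodule.mem_sup_right (Submodule.subset_span ⟨i, rfl⟩)
    rw [hW, Submodule.mem_sup] at h2
    obtain ⟨v, hv, w, hw, hvw⟩ := h2
    obtain ⟨a, rfl⟩ := (Submodule.mem_span_range_iff_exists_fun K).1 hw
    exact ⟨v, hv, a, hvw.symm⟩
  choose v hv a ha using hcoord
  have hindL := indepMod_coe.1 (indepMod_span_fadj hK hl h1 hlV hdom hdome hind)
  have hsmul : ∀ (i : ι) (y : Ω), y ∈ Submodule.span (fadj K {x | x ∈ l}) (V : Set Ω) →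
      z i * y ∈ Submodule.span (fadj K {x | x ∈ l}) (V : Set Ω) := fun i y hy =>
    Submodule.smul_mem _ (⟨z i, hz i⟩ : fadj K {x | x ∈ l}) hy
  have h3 : ∑ j, (⟨∑ i, z i * a i j, sum_mem fun i _ => mul_mem (hz i) (le_fadj _ _ (a i j).2)⟩ :
      fadj K {x | x ∈ l}) • e j ∈ Submodule.span (fadj K {x | x ∈ l}) (V : Set Ω) := by
    have h4 := sub_mem hzt (sum_mem fun i (_ : i ∈ Finset.univ) =>
      hsmul i _ (Submodule.subset_span (hv i)))
    convert h4 using 1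
    simp only [Subfield.smul_def, smul_eq_mul, ← Finset.sum_sub_distrib, ← mul_sub, Finset.sum_mul]
    rw [Finset.sum_comm]
    refine Finset.sum_congr rfl fun i _ => ?_
    rw [ha i, add_sub_cancel_left, Finset.mul_sum]
    simp only [Subfield.smul_def, smul_eq_mul, mul_assoc]
  have h5 := hindL _ h3
  have h6 : ∀ j, ∑ i, a i j • z i = 0 := by
    intro j
    have := congrArg (fun y : fadj K {x | x ∈ l} => (y : Ω)) (congrFun h5 j)
    simp only [Pi.zero_apply, ZeroMemClass.coe_zero] at this
    rw [← this]
    exact Finset.sum_congr rfl fun i _ => by rw [Subfield.smul_def, smul_eq_mul, mul_comm]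
  have h7 : ∀ j, a i j = 0 := fun j => Fintype.linearIndependent_iff.1 hzind _ (h6 j) i
  rw [ha i]
  simp only [h7, zero_smul, Finset.sum_const_zero, add_zero]
  exact hv i


/-- If the function field has degree at least `c + 3` over the coordinates and `V * V` is small,
then multiplication by some element of `V` is injective on dominated elements modulo `V`. -/
theorem exists_mem_of_mul_mem (hK : AclClosed K) (hl : AInd K l) [FiniteDimensional K V]
    (h1 : 1 ∈ V) (hlV : ∀ x ∈ l, x ∈ V) (hdom : ∀ v ∈ V, Dom K l v) {n c : ℕ} (hn : 2 ≤ n)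
    (hc : 2 ≤ c) (hV : Module.finrank K V = n + c + 1)
    (hZ : Module.finrank K (Submodule.span K ({1} ∪ {x | x ∈ l} : Set Ω)) = n + 1)
    (hZZ : (n + 2).choose 2 ≤ Module.finrank K ↥(Submodule.span K ({1} ∪ {x | x ∈ l} : Set Ω) *
      Submodule.span K ({1} ∪ {x | x ∈ l} : Set Ω)))
    (hVV : Module.finrank K ↥(V * V) ≤ (n + 2).choose 2 + c * (n + 1) + 3)
    (hd : c + 3 ≤ Module.finrank (fadj K {x | x ∈ l})
      (IntermediateField.adjoin (fadj K {x | x ∈ l}) (V : Set Ω))) :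
    ∃ h ∈ V, ∀ t, Dom K l t → h * t ∈ V * V → t ∈ V := by
  by_contra hcon
  push Not at hcon
  set L := fadj K {x | x ∈ l} with hL
  set Z := Submodule.span K ({1} ∪ {x | x ∈ l} : Set Ω) with hZdef
  set U := Submodule.span L (V : Set Ω) with hU
  obtain ⟨m, u, hu, hVu, huind, huL, hUu⟩ := exists_complement_coords hK hl h1 hlV hdom
  rw [← hL, ← hU] at hUu
  rw [← hL] at huL
  rw [← hZdef] at hVu huind
  have hZV : Z ≤ V := span_coords_le h1 hlV
  have : FiniteDimensional K Z := Submodule.finiteDimensional_of_le hZV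
  have hm : m = c := by
    have h2 := huind.finrank_sup
    rw [← hVu, hV, hZ, Fintype.card_fin] at h2
    omega
  subst hm
  have hZL : ∀ x ∈ Z, x ∈ L := fun x hx => mem_fadj_of_mem_span_coords hx
  have hVU : ∀ x ∈ V, x ∈ U := fun x hx => Submodule.subset_span hx
  have hLU : ∀ x ∈ L, ∀ y ∈ U, x * y ∈ U := fun x hx y hy => Submodule.smul_mem U (⟨x, hx⟩ : L) hy
  let zb := Module.finBasisOfFinrankEq K Z hZ
  let z : Fin (n + 1) → Ω := fun i => zb i
  have hzZ : ∀ i, z i ∈ Z := fun i => (zb i).2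
  have hzind : LinearIndependent K z :=
    zb.linearIndependent.map' Z.subtype (Submodule.ker_subtype Z)
  have hZVU : ∀ x ∈ Z * V, x ∈ U := fun x hx => by
    induction hx using Submodule.mul_induction_on' with
    | mem_mul_mem x hx y hy => exact hLU x (hZL x hx) y (hVU y hy)
    | add x _ y _ hx hy => exact add_mem hx hy
  have hZVVV : Z * V ≤ V * V := mul_le_mul' hZV le_rfl
  have : FiniteDimensional K ↥(V * V) := Module.Finite.iff_fg.2
    (Submodule.FG.mul (Module.Finite.iff_fg.1 ‹_›) (Module.Finite.iff_fg.1 ‹_›))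
  have hB : (n + 2).choose 2 + m * (n + 1) ≤ Module.finrank K ↥(Z * V) := by
    have : FiniteDimensional K ↥(Z * V) := Submodule.finiteDimensional_of_le hZVVV
    have hi : IndepMod K (↑(Z * Z) : Set Ω) (fun p : Fin m × Fin (n + 1) => z p.2 * u p.1) := by
      rw [indepMod_coe]
      intro a ha
      rw [Fintype.sum_prod_type] at ha
      have hLZ : ∀ x ∈ Z * Z, x ∈ L := fun x hx => by
        induction hx using Submodule.mul_induction_on' with
        | mem_mul_mem x hx y hy => exact mul_mem (hZL x hx) (hZL y hy)
        | add x _ y _ hx hy => exact add_mem hx hy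
      have h2 := huL (fun j => ⟨∑ i, a (j, i) * z i, sum_mem fun i _ =>
        mul_mem (le_fadj _ _ (a (j, i)).2) (hZL _ (hzZ i))⟩) (by
          have h3 := Submodule.smul_mem (Submodule.span L {(1 : Ω)}) (⟨_, hLZ _ ha⟩ : L)
            (Submodule.subset_span rfl)
          convert h3 using 1
          simp only [Subfield.smul_def, smul_eq_mul, mul_one, Finset.sum_mul, mul_assoc])
      funext ⟨j, i⟩
      have h4 := congrArg (fun y : L => (y : Ω)) (congrFun h2 j)
      exact Fintype.linearIndependent_iff.1 hzind (fun i => a (j, i)) h4 i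
    have := hi.finrank_add_le (mul_le_mul' le_rfl hZV) fun p =>
      Submodule.mul_mem_mul (hzZ p.2) (hu p.1)
    rw [Fintype.card_prod, Fintype.card_fin, Fintype.card_fin] at this
    omega
  choose t htdom htVV htV using fun i => hcon (z i) (hZV (hzZ i))
  obtain ⟨s, hsdom, hsVV, hsV⟩ := hcon (∑ i, z i) (sum_mem fun i _ => hZV (hzZ i))
  have hwind : IndepMod K (↑(Z * V) : Set Ω) (fun i => z i * t i) := by
    rw [indepMod_coe]
    intro a ha
    funext i
    by_contra hai
    have h2 := mem_of_sum_mul_mem_span hK hl h1 hlV hdom (t := fun i => (a i : Ω) * t i)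
      (fun i => hZL _ (hzZ i)) hzind (fun i => (htdom i).smul (a i).2) (by
        convert hZVU _ ha using 1
        exact Finset.sum_congr rfl fun i _ => by rw [Subfield.smul_def, smul_eq_mul]; ring) i
    exact htV i ((Submodule.smul_mem_iff V hai).1 h2)
  have hcard := hwind.finrank_add_le hZVVV htVV
  rw [Fintype.card_fin] at hcard
  have hVVeq := hwind.eq_sup hZVVV htVV (by rw [Fintype.card_fin]; omega)
  obtain ⟨b, hb, w, hw, hbw⟩ := Submodule.mem_sup.1 (hVVeq.symm ▸ hsVV)
  obtain ⟨a, rfl⟩ := (Submodule.mem_span_range_iff_exists_fun K).1 hw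
  have hsa : ∀ i, s - a i * t i ∈ V := by
    refine mem_of_sum_mul_mem_span hK hl h1 hlV hdom (fun i => hZL _ (hzZ i)) hzind
      (fun i => ?_) ?_
    · rw [sub_eq_add_neg, ← neg_mul]
      exact hsdom.add ((htdom i).smul (neg_mem (a i).2))
    · convert hZVU _ hb using 1
      rw [← eq_sub_iff_add_eq] at hbw
      rw [hbw, Finset.sum_mul, ← Finset.sum_sub_distrib]
      exact Finset.sum_congr rfl fun i _ => by rw [Subfield.smul_def, smul_eq_mul]; ring
  have ha0 : ∀ i, a i ≠ 0 := by
    intro i hi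
    have := hsa i
    rw [hi, ZeroMemClass.coe_zero, zero_mul, sub_zero] at this
    exact hsV this
  have hts : ∀ i, z i * t i ∈ U ⊔ Submodule.span L {s} := by
    intro i
    have e : z i * t i = -((z i * (a i : Ω)⁻¹) * (s - a i * t i)) + (z i * (a i : Ω)⁻¹) * s := by
      have : (a i : Ω) ≠ 0 := fun h => ha0 i (Subtype.ext h)
      field_simp
      ring
    have hza : z i * (a i : Ω)⁻¹ ∈ L := mul_mem (hZL _ (hzZ i)) (inv_mem (le_fadj _ _ (a i).2))
    rw [e]
    exact Submodule.add_mem_sup (neg_mem (hLU _ hza _ (hVU _ (hsa i))))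
      (Submodule.smul_mem _ (⟨_, hza⟩ : L) (Submodule.subset_span rfl))
  have hVVU : ∀ x ∈ V * V, x ∈ U ⊔ Submodule.span L {s} := by
    intro x hx
    rw [← hVVeq] at hx
    obtain ⟨b, hb, w, hw, rfl⟩ := Submodule.mem_sup.1 hx
    obtain ⟨a, rfl⟩ := (Submodule.mem_span_range_iff_exists_fun K).1 hw
    refine add_mem (Submodule.mem_sup_left (hZVU b hb)) (sum_mem fun i _ => ?_)
    exact Submodule.smul_mem _ (⟨a i, le_fadj _ _ (a i).2⟩ : L) (hts i)
  set F := IntermediateField.adjoin L (V : Set Ω) with hF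
  have hUfin : FiniteDimensional L U := by
    rw [hUu]; exact FiniteDimensional.span_of_finite L ((Set.finite_singleton _).union
      (Set.finite_range u))
  have hUrank : Module.finrank L U = m + 1 := by
    have h2 := (IndepMod.mono (S := (Submodule.span L {(1 : Ω)} : Set Ω)) le_rfl huL).finrank_sup
    rw [Fintype.card_fin, finrank_span_singleton one_ne_zero, ← Submodule.span_union, ← hUu] at h2
    omega
  have hUF : ∀ x ∈ U, x ∈ F := by
    intro x hx
    have : U ≤ Subalgebra.toSubmodule F.toSubalgebra :=
      Submodule.span_le.2 (IntermediateField.subset_adjoin L _)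
    exact this hx
  let UF : Submodule L F := U.comap F.val.toLinearMap
  have hUFmap : UF.map F.val.toLinearMap = U := by
    refine le_antisymm (Submodule.map_comap_le _ _) fun x hx => ⟨⟨x, hUF x hx⟩, hx, rfl⟩
  have hinj : Function.Injective F.val.toLinearMap := F.val.injective
  have hrk : ∀ M : Submodule L F, Module.finrank L (M.map F.val.toLinearMap) = Module.finrank L M :=
    fun M => (Submodule.equivMapOfInjective _ hinj M).finrank_eq.symm
  have hFfin : FiniteDimensional L F := by
    refine FiniteDimensional.of_finrank_pos ?_
    omega
  have hq := finrank_mul_self_ge (L := L) (F := F) (U := UF) (c := m) hc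
    (Submodule.mem_comap.2 (hVU 1 h1)) (by rw [← hrk, hUFmap, hUrank]) ?_ hd
  · rw [← hrk, Submodule.map_mul, hUFmap] at hq
    have hle : U * U ≤ U ⊔ Submodule.span L {s} := by
      rw [hU, Submodule.span_mul_span, ← hU]
      refine Submodule.span_le.2 ?_
      rintro _ ⟨x, hx, y, hy, rfl⟩
      exact hVVU _ (Submodule.mul_mem_mul hx hy)
    have h2 := Submodule.finrank_mono hle
    have h3 := Submodule.finrank_add_le_finrank_add_finrank U (Submodule.span L {s})
    have h4 : Module.finrank L (Submodule.span L {s}) ≤ 1 := by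
      simpa using finrank_span_le_card (R := L) ({s} : Set Ω)
    omega
  · rw [eq_top_iff]
    rintro x -
    have h2 : F.toSubalgebra = Algebra.adjoin L (V : Set Ω) :=
      IntermediateField.adjoin_toSubalgebra_of_isAlgebraic
        fun v hv => (hdom v hv).reg.isAlgebraic hK
    have h3 : (x : Ω) ∈ Algebra.adjoin L (V : Set Ω) := by rw [← h2]; exact x.2
    have h4 : Algebra.adjoin L (V : Set Ω) ≤ (Algebra.adjoin L (UF : Set F)).map F.val := by
      rw [AlgHom.map_adjoin]
      exact Algebra.adjoin_mono fun v hv => ⟨⟨v, hUF v (hVU v hv)⟩, hVU v hv, rfl⟩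
    obtain ⟨y, hy, hyx⟩ := h4 h3
    rwa [show x = y from Subtype.ext hyx.symm]

end Dominated

section Openness

/-- Linear independence is an open condition on the parameters of a linear family. -/
lemma exists_ne_zero_linearIndependent {K X ι κ : Type*} [Field K] [AddCommGroup X] [Module K X]
    [Fintype ι] [DecidableEq ι] [Fintype κ] (b : κ → ι → X) (w₀ : κ → K)
    (h : LinearIndependent K fun i => ∑ j, w₀ j • b j i) :
    ∃ P : MvPolynomial κ K, P ≠ 0 ∧ ∀ w, eval w P ≠ 0 →
      LinearIndependent K fun i => ∑ j, w j • b j i := by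
  obtain ⟨φ, hφ⟩ := LinearMap.exists_leftInverse_of_injective
    (Fintype.linearCombination K fun i => ∑ j, w₀ j • b j i)
    (LinearMap.ker_eq_bot.2 (linearIndependent_iff_injective_fintypeLinearCombination.1 h))
  let A : Matrix ι ι (MvPolynomial κ K) :=
    Matrix.of fun i i' => ∑ j, MvPolynomial.X j * C (φ (b j i) i')
  have hA : ∀ w, eval w A.det = (Matrix.of fun i => φ (∑ j, w j • b j i)).det := by
    intro w
    rw [RingHom.map_det]
    congr 1
    ext i i'
    simp [A]
  refine ⟨A.det, fun h0 => ?_, fun w hw => ?_⟩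
  · have h1 := hA w₀
    have h2 : (Matrix.of fun i => φ (∑ j, w₀ j • b j i)) = 1 := by
      ext i i'
      have h3 := LinearMap.congr_fun hφ (Pi.single i 1)
      simp only [LinearMap.comp_apply, Fintype.linearCombination_apply_single, one_smul,
        LinearMap.id_apply] at h3
      rw [Matrix.of_apply, h3, Matrix.one_apply, Pi.single_apply]
      simp only [eq_comm]
    rw [h0, map_zero, h2, Matrix.det_one] at h1
    exact zero_ne_one h1
  · rw [hA w] at hw
    have h1 := Matrix.linearIndependent_rows_of_det_ne_zero hw
    exact LinearIndependent.of_comp φ h1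

lemma finiteDimensional_of_card_le {K X : Type*} [Field K] [AddCommGroup X] [Module K X] (n : ℕ)
    (H : ∀ s : Finset X, (LinearIndependent K fun i : s => (i : X)) → s.card ≤ n) :
    FiniteDimensional K X :=
  Module.rank_lt_aleph0_iff.1 (lt_of_le_of_lt (rank_le H) Cardinal.natCast_lt_aleph0)

variable {Ω : Type} [Field Ω] [CharZero Ω] {K : Subfield Ω} {l : List Ω} {V : Submodule K Ω}

/-- Dominated elements of an intermediate field. -/
def domSubmodule (K : Subfield Ω) (l : List Ω)
    (F : IntermediateField (fadj K {x | x ∈ l}) Ω) : Submodule K Ω where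
  carrier := {t | t ∈ F ∧ Dom K l t}
  add_mem' h h' := ⟨add_mem h.1 h'.1, h.2.add h'.2⟩
  zero_mem' := ⟨zero_mem _, Dom.of_mem (zero_mem _)⟩
  smul_mem' a _ h := ⟨mul_mem (F.algebraMap_mem ⟨a, le_fadj _ _ a.2⟩) h.1, h.2.smul a.2⟩

lemma finiteDimensional_domSubmodule_quotient (hK : AclClosed K) (hl : AInd K l)
    [FiniteDimensional K V] (h1 : 1 ∈ V) (hlV : ∀ x ∈ l, x ∈ V) (hdom : ∀ v ∈ V, Dom K l v)
    (F : IntermediateField (fadj K {x | x ∈ l}) Ω) [FiniteDimensional (fadj K {x | x ∈ l}) F] :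
    FiniteDimensional K (domSubmodule K l F ⧸ V.submoduleOf (domSubmodule K l F)) := by
  refine finiteDimensional_of_card_le (Module.finrank (fadj K {x | x ∈ l}) F) fun s hs => ?_
  choose e he using fun i : s => Submodule.Quotient.mk_surjective _
    (i : domSubmodule K l F ⧸ V.submoduleOf (domSubmodule K l F))
  have hind : IndepMod K (V : Set Ω) fun i => (e i : Ω) := by
    refine indepMod_coe.2 fun a ha => ?_
    have h3 : ∑ i, a i • (i : domSubmodule K l F ⧸ V.submoduleOf (domSubmodule K l F)) = 0 := by
      simp_rw [← he, ← Submodule.mkQ_apply, ← map_smul]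
      rw [← map_sum, Submodule.mkQ_apply, Submodule.Quotient.mk_eq_zero]
      have h4 : ((∑ i, a i • e i : domSubmodule K l F) : Ω) = ∑ i, a i • (e i : Ω) := by
        rw [Submodule.coe_sum]; rfl
      exact (congrArg (· ∈ V) h4).mpr ha
    exact funext (Fintype.linearIndependent_iff.1 hs a h3)
  have hindL := indepMod_coe.1 (indepMod_span_fadj hK hl h1 hlV hdom (fun i => (e i).2.2) hind)
  have hli : LinearIndependent (fadj K {x | x ∈ l}) fun i => (⟨e i, (e i).2.1⟩ : F) := by
    refine Fintype.linearIndependent_iff.2 fun a ha i => ?_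
    have h5 : ∑ i, a i • (e i : Ω) = 0 := by
      have := congrArg (fun x : F => (x : Ω)) ha
      simpa using this
    exact congrFun (hindL a (by rw [h5]; exact zero_mem _)) i
  simpa using hli.fintype_card_le_finrank

/-- If multiplication by one element of `V` is injective on dominated elements modulo `V`, then
the same holds for a general element. -/
theorem exists_ne_zero_mem_of_mul_mem (hK : AclClosed K) (hl : AInd K l) [FiniteDimensional K V]
    (h1 : 1 ∈ V) (hlV : ∀ x ∈ l, x ∈ V) (hdom : ∀ v ∈ V, Dom K l v)
    (F : IntermediateField (fadj K {x | x ∈ l}) Ω) [FiniteDimensional (fadj K {x | x ∈ l}) F]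
    (hVF : ∀ v ∈ V, v ∈ F) {κ : Type*} [Fintype κ] {v : κ → Ω}
    (hv : V = Submodule.span K (Set.range v))
    {h : Ω} (hhV : h ∈ V) (hh : ∀ t ∈ F, Dom K l t → h * t ∈ V * V → t ∈ V) :
    ∃ P : MvPolynomial κ K, P ≠ 0 ∧ ∀ w, eval w P ≠ 0 →
      ∀ t ∈ F, Dom K l t → (∑ j, w j • v j) * t ∈ V * V → t ∈ V := by
  have hVM : V ≤ domSubmodule K l F := fun x hx => ⟨hVF x hx, hdom x hx⟩
  have := finiteDimensional_domSubmodule_quotient hK hl h1 hlV hdom F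
  obtain ⟨m, e, he, hM, hind⟩ := exists_indepMod_sup_span_eq hVM
  rw [indepMod_coe] at hind
  rw [hv, Submodule.mem_span_range_iff_exists_fun] at hhV
  obtain ⟨w₀, rfl⟩ := hhV
  have hmk : ∀ w : κ → K, ∀ i, ∑ j, w j • (V * V).mkQ (v j * e i) =
      (V * V).mkQ ((∑ j, w j • v j) * e i) := by
    intro w i
    rw [Finset.sum_mul, map_sum]
    simp_rw [smul_mul_assoc, map_smul]
  obtain ⟨P, hP, hPw⟩ := exists_ne_zero_linearIndependent
    (fun j i => (V * V).mkQ (v j * e i)) w₀ (by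
      simp_rw [hmk]
      refine Fintype.linearIndependent_iff.2 fun a ha i => ?_
      simp_rw [← map_smul] at ha
      rw [← map_sum, Submodule.mkQ_apply, Submodule.Quotient.mk_eq_zero] at ha
      simp_rw [← mul_smul_comm] at ha
      rw [← Finset.mul_sum] at ha
      have hmem : ∑ i, a i • e i ∈ domSubmodule K l F :=
        sum_mem fun i _ => Submodule.smul_mem _ _ (he i)
      exact congrFun (hind a (hh _ hmem.1 hmem.2 ha)) i)
  refine ⟨P, hP, fun w hw t htF htd htVV => ?_⟩
  have hw' := hPw w hw
  simp_rw [hmk] at hw'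
  have ht : t ∈ domSubmodule K l F := ⟨htF, htd⟩
  rw [hM, Submodule.mem_sup] at ht
  obtain ⟨y, hy, z, hz, rfl⟩ := ht
  obtain ⟨a, rfl⟩ := (Submodule.mem_span_range_iff_exists_fun K).1 hz
  have hgV : ∑ j, w j • v j ∈ V := by
    rw [hv]
    exact sum_mem fun j _ => Submodule.smul_mem _ _ (Submodule.subset_span ⟨j, rfl⟩)
  have h3 : (∑ j, w j • v j) * ∑ i, a i • e i ∈ V * V := by
    have := sub_mem htVV (Submodule.mul_mem_mul hgV hy)
    rwa [← mul_sub, add_sub_cancel_left] at this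
  have h4 : ∑ i, a i • (V * V).mkQ ((∑ j, w j • v j) * e i) = 0 := by
    simp_rw [← map_smul]
    rw [← map_sum, Submodule.mkQ_apply, Submodule.Quotient.mk_eq_zero]
    simp_rw [← mul_smul_comm]
    rwa [← Finset.mul_sum]
  have h5 := Fintype.linearIndependent_iff.1 hw' a h4
  simp only [h5, zero_smul, Finset.sum_const_zero, add_zero]
  exact hy

end Openness

namespace Polynomial

/-- Elimination of the variable between an irreducible polynomial and one it does not divide. -/
lemma exists_C_eq_mul_add_mul {R : Type*} [CommRing R] [IsDomain R] [UniqueFactorizationMonoid R]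
    {f g : Polynomial R} (hf : Irreducible f) (hfg : ¬ f ∣ g) :
    ∃ r : R, r ≠ 0 ∧ ∃ a b, C r = a * f + b * g := by
  rcases eq_or_ne f.natDegree 0 with h0 | h0
  · obtain ⟨r, rfl⟩ := natDegree_eq_zero.1 h0
    exact ⟨r, fun h => hf.ne_zero (by rw [h, C_0]), 1, 0, by ring⟩
  let φ := algebraMap R (FractionRing R)
  have := Classical.arbitrary (NormalizedGCDMonoid R)
  have hp := hf.isPrimitive h0
  have hirr := (hp.irreducible_iff_irreducible_map_fraction_map (K := FractionRing R)).1 hf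
  have hnd : ¬ f.map φ ∣ g.map φ := fun h =>
    hfg (hp.dvd_of_fraction_map_dvd_fraction_map (K := FractionRing R) h)
  obtain ⟨a, b, hab⟩ := (hirr.coprime_iff_not_dvd.2 hnd)
  obtain ⟨c, c0, hc⟩ := IsLocalization.integerNormalization_spec (nonZeroDivisors R) a
  obtain ⟨d, d0, hd⟩ := IsLocalization.integerNormalization_spec (nonZeroDivisors R) b
  rw [Algebra.smul_def, algebraMap_apply] at hc hd
  change map φ _ = C (φ c) * a at hc
  change map φ _ = C (φ d) * b at hd
  rw [mem_nonZeroDivisors_iff_ne_zero] at c0 d0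
  refine ⟨c * d, mul_ne_zero c0 d0, C d * IsLocalization.integerNormalization (nonZeroDivisors R) a,
    C c * IsLocalization.integerNormalization (nonZeroDivisors R) b, ?_⟩
  apply map_injective φ (IsFractionRing.injective _ _)
  simp only [Polynomial.map_add, Polynomial.map_mul, hc, hd, map_C, map_mul]
  linear_combination -(C (φ c) * C (φ d)) * hab

end Polynomial

namespace MvPolynomial

lemma exists_degreeOf_eq_zero_of_irreducible {R σ : Type*} [CommRing R] [IsDomain R]
    [UniqueFactorizationMonoid R] (i : σ) {f g : MvPolynomial σ R} (hf : Irreducible f)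
    (hfg : ¬ f ∣ g) : ∃ r : MvPolynomial σ R, r ≠ 0 ∧ degreeOf i r = 0 ∧
      ∃ a b, r = a * f + b * g := by
  classical
  let e : MvPolynomial σ R ≃ₐ[R] Polynomial (MvPolynomial {b // b ≠ i} R) :=
    (renameEquiv R (Equiv.optionSubtypeNe i).symm).trans (optionEquivLeft R {b // b ≠ i})
  have hdeg : ∀ p, degreeOf i p = (e p).natDegree := fun p => degreeOf_eq_natDegree i p
  obtain ⟨r, hr, a, b, hab⟩ := Polynomial.exists_C_eq_mul_add_mul
    (f := e f) (g := e g) ((MulEquiv.irreducible_iff e).2 hf) (by rwa [map_dvd_iff])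
  refine ⟨e.symm (Polynomial.C r), ?_, ?_, e.symm a, e.symm b, ?_⟩
  · rwa [Ne, EmbeddingLike.map_eq_zero_iff, Polynomial.C_eq_zero]
  · rw [hdeg, AlgEquiv.apply_symm_apply, Polynomial.natDegree_C]
  · rw [hab, map_add, map_mul, map_mul, AlgEquiv.symm_apply_apply, AlgEquiv.symm_apply_apply]

lemma degreeOf_eq_zero_of_dvd {R σ : Type*} [CommRing R] [IsDomain R] {i : σ}
    {p q : MvPolynomial σ R} (hpq : p ∣ q) (hq : q ≠ 0) (h : degreeOf i q = 0) :
    degreeOf i p = 0 := by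
  obtain ⟨s, rfl⟩ := hpq
  rw [degreeOf_mul_eq (left_ne_zero_of_mul hq) (right_ne_zero_of_mul hq)] at h
  omega

lemma degreeOf_map_le {R S σ : Type*} [CommSemiring R] [CommSemiring S] (φ : R →+* S) (i : σ)
    (p : MvPolynomial σ R) : degreeOf i (map φ p) ≤ degreeOf i p := by
  classical
  rw [degreeOf_eq_sup, degreeOf_eq_sup]
  exact Finset.sup_mono (support_map_subset φ p)

lemma isUnit_of_degreeOf_eq_zero {K σ : Type*} [Field K] {p : MvPolynomial σ K} (hp : p ≠ 0)
    (h : ∀ i, degreeOf i p = 0) : IsUnit p := by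
  have hv : p.vars = ∅ := by
    refine Finset.eq_empty_of_forall_notMem fun i hi => ?_
    classical
    rw [vars_def, Multiset.mem_toFinset] at hi
    have h0 := h i
    rw [degreeOf_def] at h0
    exact Multiset.count_ne_zero.2 hi h0
  rw [vars_eq_empty_iff_eq_C] at hv
  rw [hv] at hp ⊢
  exact (IsUnit.mk0 _ fun h0 => hp (by rw [h0, C_0])).map C

/-- A general specialization of an irreducible polynomial has no common factor with the
specializations of polynomials it does not divide. -/
theorem exists_forall_isUnit_of_dvd_map {R σ : Type*} [CommRing R] [IsDomain R]
    [UniqueFactorizationMonoid R] [Finite σ] {f : MvPolynomial σ R} (hf : Irreducible f)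
    (g : σ → MvPolynomial σ R) (hg : ∀ i, degreeOf i f = 0 ∨ ¬ f ∣ g i) :
    ∃ Q : R, Q ≠ 0 ∧ ∀ {K : Type*} [Field K] (ε : R →+* K), ε Q ≠ 0 → map ε f ≠ 0 ∧
      ∀ p, p ∣ map ε f → (∀ i, p ∣ map ε (g i)) → IsUnit p := by
  classical
  have := Fintype.ofFinite σ
  have key : ∀ i, ∃ r : MvPolynomial σ R, r ≠ 0 ∧ degreeOf i r = 0 ∧
      ∃ a b, r = a * f + b * g i := by
    intro i
    rcases hg i with h | h
    · exact ⟨f, hf.ne_zero, h, 1, 0, by ring⟩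
    · exact exists_degreeOf_eq_zero_of_irreducible i hf h
  choose r hr hdr a b hab using key
  choose m hm using fun i => exists_coeff_ne_zero (hr i)
  obtain ⟨m₀, hm₀⟩ := exists_coeff_ne_zero hf.ne_zero
  refine ⟨coeff m₀ f * ∏ i, coeff (m i) (r i),
    mul_ne_zero hm₀ (Finset.prod_ne_zero_iff.2 fun i _ => hm i), fun ε hε => ?_⟩
  rw [map_mul, map_prod] at hε
  have h0 : map ε f ≠ 0 := fun h => left_ne_zero_of_mul hε (by rw [← coeff_map, h, coeff_zero])
  refine ⟨h0, fun p hpf hpg =>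
    isUnit_of_degreeOf_eq_zero (ne_zero_of_dvd_ne_zero h0 hpf) fun i => ?_⟩
  refine degreeOf_eq_zero_of_dvd (q := map ε (r i)) ?_ (fun h => ?_)
    (Nat.le_zero.1 ((degreeOf_map_le ε i _).trans (hdr i).le))
  · rw [hab, map_add, map_mul, map_mul]
    exact dvd_add (hpf.mul_left _) ((hpg i).mul_left _)
  · exact Finset.prod_ne_zero_iff.1 (right_ne_zero_of_mul hε) i (Finset.mem_univ _)
      (by rw [← coeff_map, h, coeff_zero])

end MvPolynomial

/-- The integral closure has bounded denominators in its trace dual. -/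
lemma exists_smul_isIntegral_of_trace (P L F : Type*) [CommRing P] [IsDomain P] [Field L]
    [Algebra P L] [IsFractionRing P L] [Field F] [Algebra P F] [Algebra L F]
    [IsScalarTower P L F] [FiniteDimensional L F] [CharZero L] :
    ∃ δ : P, δ ≠ 0 ∧ ∀ τ : F, (∀ a, IsIntegral P a →
      Algebra.trace L F (τ * a) ∈ (algebraMap P L).range) → IsIntegral P (δ • τ) := by
  classical
  obtain ⟨s, b, hb⟩ := FiniteDimensional.exists_is_basis_integral P L F
  let b' := (Algebra.traceForm L F).dualBasis (traceForm_nondegenerate L F) b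
  obtain ⟨δ, hδ, hδb⟩ := exists_integral_multiples P L (Finset.univ.image b')
  refine ⟨δ, hδ, fun τ hτ => ?_⟩
  rw [← b'.sum_repr τ, Finset.smul_sum]
  refine IsIntegral.sum _ fun i _ => ?_
  obtain ⟨t, ht⟩ := hτ (b i) (hb i)
  rw [LinearMap.BilinForm.dualBasis_repr_apply, Algebra.traceForm_apply, ← ht, algebraMap_smul,
    smul_comm]
  exact (hδb _ (Finset.mem_image_of_mem _ (Finset.mem_univ i))).smul t

section Trace

variable {P L F : Type*} [CommRing P] [IsDomain P] [UniqueFactorizationMonoid P] [Field L]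
  [Algebra P L] [IsFractionRing P L] [Field F] [Algebra P F] [Algebra L F] [IsScalarTower P L F]

lemma mem_range_algebraMap_of_isRelPrime {a b : P} (hab : IsRelPrime a b) {α : L}
    (ha : algebraMap P L a * α ∈ (algebraMap P L).range)
    (hb : algebraMap P L b * α ∈ (algebraMap P L).range) : α ∈ (algebraMap P L).range := by
  obtain ⟨x, y, hxy, rfl⟩ := IsFractionRing.exists_reduced_fraction (A := P) α
  have hdvd : ∀ c, algebraMap P L c * IsLocalization.mk' L x y ∈ (algebraMap P L).range →
      (y : P) ∣ c := by
    rintro c ⟨z, hz⟩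
    refine hxy.symm.dvd_of_dvd_mul_right ⟨z, ?_⟩
    apply IsFractionRing.injective P L
    have h1 := IsLocalization.mk'_spec L x y
    rw [map_mul, map_mul, hz, ← h1]
    ring
  obtain ⟨u, hu⟩ := hab (hdvd a ha) (hdvd b hb)
  refine ⟨x * ↑u⁻¹, ?_⟩
  have h1 := IsLocalization.mk'_spec L x y
  rw [map_mul, ← h1, mul_assoc, ← map_mul, ← hu, Units.mul_inv, map_one, mul_one]

lemma isIntegral_of_isRelPrime [FiniteDimensional L F] {a b : P} (ha0 : a ≠ 0) (hb0 : b ≠ 0)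
    (hab : IsRelPrime a b) {τ : F} (ha : IsIntegral P (a • τ)) (hb : IsIntegral P (b • τ)) :
    IsIntegral P τ := by
  have hτ : IsIntegral L τ := Algebra.IsIntegral.isIntegral τ
  have key : ∀ c : P, c ≠ 0 → IsIntegral P (c • τ) → ∀ i,
      algebraMap P L (c ^ ((minpoly L τ).natDegree - i)) * (minpoly L τ).coeff i ∈
        (algebraMap P L).range := by
    intro c hc hcτ i
    have h1 : minpoly L (algebraMap P L c • τ) = (minpoly L τ).scaleRoots (algebraMap P L c) :=
      IsIntegrallyClosed.minpoly_smul ((map_ne_zero_iff _ (IsFractionRing.injective P L)).2 hc) hτ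
    rw [algebraMap_smul, minpoly.isIntegrallyClosed_eq_field_fractions' L hcτ] at h1
    refine ⟨(minpoly P (c • τ)).coeff i, ?_⟩
    rw [← Polynomial.coeff_map, h1, Polynomial.coeff_scaleRoots, map_pow, mul_comm]
  have hlift : minpoly L τ ∈ Polynomial.lifts (algebraMap P L) := by
    rw [Polynomial.lifts_iff_coeff_lifts]
    intro i
    exact mem_range_algebraMap_of_isRelPrime (hab.pow) (key a ha0 ha i) (key b hb0 hb i)
  obtain ⟨q, hq, -, hqm⟩ := Polynomial.lifts_and_natDegree_eq_and_monic hlift (minpoly.monic hτ)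
  refine ⟨q, hqm, ?_⟩
  rw [← Polynomial.aeval_def, ← Polynomial.aeval_map_algebraMap L, hq, minpoly.aeval]

/-- The trace of an integral element with a power divisible by a squarefree element `N` of the
base is divisible by `N`. -/
lemma exists_trace_eq_mul [FiniteDimensional L F] [CharZero L] {N : P} (hN : Squarefree N)
    {x y : F} (hx : IsIntegral P x) (hy : IsIntegral P y) {m : ℕ} (hxy : x ^ m = N • y) :
    ∃ t : P, Algebra.trace L F x = algebraMap P L (N * t) := by
  let E := AlgebraicClosure L
  have hN0 : N ≠ 0 := hN.ne_zero
  obtain ⟨s, hs⟩ := (IsIntegrallyClosed.isIntegral_iff (R := P)).1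
    (Algebra.isIntegral_trace (L := L) hx)
  let f : (F →ₐ[L] E) → integralClosure P E := fun σ =>
    ⟨σ x, hx.map (σ.restrictScalars P)⟩
  have hf : ∀ σ, f σ ∈ (Ideal.span {algebraMap P (integralClosure P E) N}).radical := by
    intro σ
    refine ⟨m, Ideal.mem_span_singleton'.2 ⟨⟨σ y, hy.map (σ.restrictScalars P)⟩, ?_⟩⟩
    apply Subtype.ext
    change σ y * algebraMap P E N = σ x ^ m
    rw [← map_pow, hxy, ← AlgHom.coe_restrictScalars' P σ, map_smul, Algebra.smul_def, mul_comm]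
  obtain ⟨e, he⟩ := Ideal.mem_radical_iff.1 (Ideal.sum_mem _ fun σ (_ : σ ∈ Finset.univ) => hf σ)
  obtain ⟨b, hb⟩ := Ideal.mem_span_singleton'.1 he
  have hsum : ((∑ σ, f σ : integralClosure P E) : E) = algebraMap P E s := by
    rw [IsScalarTower.algebraMap_apply P L E, hs, trace_eq_sum_embeddings E]
    rw [AddSubmonoidClass.coe_finsetSum]
  have hb' : (b : E) * algebraMap P E N = algebraMap P E s ^ e := by
    rw [← hsum]
    exact congrArg Subtype.val hb
  have hinj : Function.Injective (algebraMap P E) := by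
    rw [IsScalarTower.algebraMap_eq P L E]
    exact (algebraMap L E).injective.comp (IsFractionRing.injective P L)
  have hbL : (b : E) = algebraMap L E (algebraMap P L s ^ e / algebraMap P L N) := by
    rw [map_div₀, map_pow, ← IsScalarTower.algebraMap_apply, ← IsScalarTower.algebraMap_apply,
      eq_div_iff ((map_ne_zero_iff _ hinj).2 hN0), hb']
  have hbi : IsIntegral P (algebraMap P L s ^ e / algebraMap P L N) := by
    have := b.2
    rw [hbL] at this
    exact (isIntegral_algHom_iff (IsScalarTower.toAlgHom P L E) (algebraMap L E).injective).1 this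
  obtain ⟨c, hc⟩ := (IsIntegrallyClosed.isIntegral_iff (R := P)).1 hbi
  have hNs : N ∣ s ^ e := by
    refine ⟨c, IsFractionRing.injective P L ?_⟩
    rw [map_mul, hc, map_pow, mul_div_cancel₀]
    exact (map_ne_zero_iff _ (IsFractionRing.injective P L)).2 hN0
  have hNs' : N ∣ s := by
    rcases eq_or_ne e 0 with rfl | h0
    · rw [pow_zero] at hNs
      exact hNs.trans (one_dvd s)
    · exact (hN.dvd_pow_iff_dvd h0).1 hNs
  obtain ⟨t, rfl⟩ := hNs'
  exact ⟨t, hs.symm⟩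

/-- If `N = g * g'` is squarefree and prime to the discriminant, elements of the radical of
`g` are divisible by `g`. -/
theorem isIntegral_of_pow_eq_mul [FiniteDimensional L F] [CharZero L] {δ : P} (hδ0 : δ ≠ 0)
    (hδ : ∀ τ : F, (∀ a, IsIntegral P a →
      Algebra.trace L F (τ * a) ∈ (algebraMap P L).range) → IsIntegral P (δ • τ))
    {N : P} (hN : Squarefree N) (hNδ : IsRelPrime N δ) {g g' q y τ : F} (hg' : IsIntegral P g')
    (hNg : algebraMap P F N = g * g') (hq : IsIntegral P q) (hy : IsIntegral P y) {m : ℕ}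
    (hm : m ≠ 0) (hqy : q ^ m = g * y) (hτ : g * τ = q) : IsIntegral P τ := by
  have h1 : N • τ = g' * q := by
    rw [Algebra.smul_def, hNg, ← hτ]; ring
  refine isIntegral_of_isRelPrime (L := L) hN.ne_zero hδ0 hNδ (by rw [h1]; exact hg'.mul hq)
    (hδ τ fun a ha => ?_)
  obtain ⟨j, rfl⟩ := Nat.exists_eq_succ_of_ne_zero hm
  obtain ⟨t, ht⟩ := exists_trace_eq_mul (L := L) hN (x := N • (τ * a))
    (y := g' ^ j * y * a ^ (j + 1)) (m := j + 1)
    (by rw [← smul_mul_assoc, h1]; exact (hg'.mul hq).mul ha)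
    (((hg'.pow j).mul hy).mul (ha.pow _)) (by
      rw [← smul_mul_assoc, h1, mul_pow, mul_pow, hqy, Algebra.smul_def, hNg]; ring)
  refine ⟨t, ?_⟩
  have h2 : algebraMap P L N ≠ 0 :=
    (map_ne_zero_iff _ (IsFractionRing.injective P L)).2 hN.ne_zero
  rw [← algebraMap_smul L N, map_smul, smul_eq_mul, RingHom.map_mul] at ht
  exact (mul_left_cancel₀ h2 ht).symm

end Trace

namespace MvPolynomial

lemma not_dvd_pderiv {R σ : Type*} [CommRing R] [IsDomain R] [CharZero R] {i : σ}
    {f : MvPolynomial σ R} (hf : degreeOf i f ≠ 0) : ¬ f ∣ pderiv i f := by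
  classical
  have hf0 : f ≠ 0 := by rintro rfl; exact hf (degreeOf_zero i)
  obtain ⟨m, hm, hmd⟩ := Finset.exists_mem_eq_sup f.support (support_nonempty.2 hf0) fun m => m i
  rw [← degreeOf_eq_sup] at hmd
  have hp0 : pderiv i f ≠ 0 := by
    intro h0
    have h1 := coeff_pderiv (i := i) f (m - Finsupp.single i 1)
    have h2 : m - Finsupp.single i 1 + Finsupp.single i 1 = m := by
      refine tsub_add_cancel_of_le ?_
      rw [Finsupp.single_le_iff]
      omega
    rw [h0, coeff_zero, h2] at h1
    rcases mul_eq_zero.1 h1.symm with h | h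
    · exact (mem_support_iff.1 hm) h
    · exact Nat.cast_add_one_ne_zero _ h
  rintro ⟨s, hs⟩
  have hs0 : s ≠ 0 := by rintro rfl; exact hp0 (by rw [hs, mul_zero])
  have h1 : degreeOf i (pderiv i f) < degreeOf i f := by
    rw [degreeOf_lt_iff (Nat.pos_of_ne_zero hf)]
    intro m hm
    rw [mem_support_iff, coeff_pderiv] at hm
    have := monomial_le_degreeOf i (mem_support_iff.2 (left_ne_zero_of_mul hm))
    rw [Finsupp.add_apply, Finsupp.single_eq_same] at this
    omega
  rw [hs, degreeOf_mul_eq hf0 hs0] at h1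
  omega

end MvPolynomial

section Chart

variable {K σ ι R : Type*} [Field K] [CommRing R]
  [Algebra (MvPolynomial σ K) R]

/-- The evaluation of polynomials in the parameters and an unknown at the generic linear
combination of the `v j`. -/
def genericEval [Fintype ι] (v : ι → R) :
    MvPolynomial σ (MvPolynomial (Option ι) K) →+* MvPolynomial ι R :=
  eval₂Hom (eval₂Hom (C.comp ((algebraMap (MvPolynomial σ K) R).comp C)) fun o =>
      o.elim (∑ j, MvPolynomial.X j * C (v j)) MvPolynomial.X)
    fun s => C (algebraMap (MvPolynomial σ K) R (MvPolynomial.X s))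

lemma exists_genericEval_eq_zero [Fintype ι] {v : ι → R}
    (hv : ∀ j, IsIntegral (MvPolynomial σ K) (v j)) :
    ∃ f : MvPolynomial σ (MvPolynomial (Option ι) K), f ≠ 0 ∧ genericEval v f = 0 := by
  let φ : MvPolynomial ι (MvPolynomial σ K) →+* MvPolynomial ι R :=
    map (algebraMap (MvPolynomial σ K) R)
  have hint : φ.IsIntegralElem (∑ j, MvPolynomial.X j * C (v j)) := by
    have hX : ∀ j, φ.IsIntegralElem (MvPolynomial.X j) := fun j => by
      have := φ.isIntegralElem_map (x := MvPolynomial.X j)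
      rwa [map_X] at this
    have hC : ∀ j, φ.IsIntegralElem (C (v j)) := fun j => by
      obtain ⟨p, hp, hpv⟩ := hv j
      refine ⟨p.map C, hp.map C, ?_⟩
      have h1 : φ.comp C = C.comp (algebraMap (MvPolynomial σ K) R) := by
        ext <;> simp [φ]
      rw [Polynomial.eval₂_map, h1, ← Polynomial.hom_eval₂, hpv, map_zero]
    let := φ.toAlgebra
    exact IsIntegral.sum (R := MvPolynomial ι (MvPolynomial σ K)) _ fun j _ =>
      IsIntegral.mul (hX j) (hC j)
  obtain ⟨p, hp, hpu⟩ := hint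
  let θ : Polynomial (MvPolynomial ι (MvPolynomial σ K)) →+*
      MvPolynomial σ (MvPolynomial (Option ι) K) :=
    Polynomial.eval₂RingHom (eval₂Hom (map C) fun j => C (MvPolynomial.X (some j)))
      (C (MvPolynomial.X none))
  let θ' : MvPolynomial σ (MvPolynomial (Option ι) K) →+*
      Polynomial (MvPolynomial ι (MvPolynomial σ K)) :=
    eval₂Hom (eval₂Hom (Polynomial.C.comp (C.comp C)) fun o =>
        o.elim Polynomial.X fun j => Polynomial.C (MvPolynomial.X j))
      fun s => Polynomial.C (C (MvPolynomial.X s))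
  have h1 : θ'.comp θ = RingHom.id _ := by
    ext <;> simp [θ, θ']
  have h2 : (genericEval v).comp θ =
      Polynomial.eval₂RingHom φ (∑ j, MvPolynomial.X j * C (v j)) := by
    ext <;> simp [θ, genericEval, φ]
  refine ⟨θ p, fun h0 => hp.ne_zero ?_, ?_⟩
  · have := RingHom.congr_fun h1 p
    rw [RingHom.comp_apply, h0, map_zero] at this
    exact this.symm
  · exact (RingHom.congr_fun h2 p).trans hpu

lemma sub_dvd_algebraMap_map_eval [Fintype ι] {v : ι → R}
    {f : MvPolynomial σ (MvPolynomial (Option ι) K)} (hf : genericEval v f = 0) (w : ι → K)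
    (c : K) : (∑ j, algebraMap (MvPolynomial σ K) R (C (w j)) * v j -
      algebraMap (MvPolynomial σ K) R (C c)) ∣
      algebraMap (MvPolynomial σ K) R (map (eval fun o : Option ι => o.elim c w) f) := by
  let α : MvPolynomial σ K →+* R := algebraMap _ R
  let ξ : MvPolynomial σ (MvPolynomial (Option ι) K) →+* Polynomial R :=
    eval₂Hom (eval₂Hom (Polynomial.C.comp (α.comp C)) fun o =>
        o.elim Polynomial.X fun j => Polynomial.C (α (C (w j))))
      fun s => Polynomial.C (α (MvPolynomial.X s))
  have h1 : (Polynomial.evalRingHom (α (C c))).comp ξ =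
      α.comp (map (eval fun o : Option ι => o.elim c w)) := by
    ext o
    · simp [ξ]
    · cases o <;> simp [ξ]
    · simp [ξ]
  have h2 : (Polynomial.evalRingHom (∑ j, α (C (w j)) * v j)).comp ξ =
      (eval fun j => α (C (w j))).comp (genericEval v) := by
    ext o
    · simp [ξ, genericEval, α]
    · cases o <;> simp [ξ, genericEval, α]
    · simp [ξ, genericEval, α]
  have h3 := RingHom.congr_fun h1 f
  have h4 := RingHom.congr_fun h2 f
  simp only [RingHom.comp_apply, Polynomial.coe_evalRingHom, hf, map_zero] at h3 h4
  have h5 := Polynomial.sub_dvd_eval_sub (∑ j, α (C (w j)) * v j) (α (C c)) (ξ f)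
  rw [h3, h4, zero_sub, dvd_neg] at h5
  exact h5

/-- A general linear combination of integral elements divides a squarefree element of the base
prime to a given one. -/
theorem exists_squarefree_dvd [IsDomain R] [CharZero K] [Finite σ] [Fintype ι]
    [FaithfulSMul (MvPolynomial σ K) R] {v : ι → R}
    (hv : ∀ j, IsIntegral (MvPolynomial σ K) (v j)) {δ : MvPolynomial σ K} (hδ : δ ≠ 0) :
    ∃ Q : MvPolynomial (Option ι) K, Q ≠ 0 ∧ ∀ (w : ι → K) (c : K),
      eval (fun o : Option ι => o.elim c w) Q ≠ 0 → ∃ N : MvPolynomial σ K, Squarefree N ∧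
        IsRelPrime N δ ∧ (∑ j, algebraMap (MvPolynomial σ K) R (C (w j)) * v j -
          algebraMap (MvPolynomial σ K) R (C c)) ∣ algebraMap (MvPolynomial σ K) R N := by
  obtain ⟨f₀, hf₀, hf₀v⟩ := exists_genericEval_eq_zero hv
  obtain ⟨f, hfk, hf⟩ := Ideal.IsPrime.exists_mem_prime_of_ne_bot
    (RingHom.ker_isPrime (genericEval (K := K) (σ := σ) v))
    (fun h => hf₀ (by rwa [← Ideal.mem_bot, ← h, RingHom.mem_ker]))
  rw [RingHom.mem_ker] at hfk
  have hfδ : ¬ f ∣ map C δ := by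
    rintro ⟨s, hs⟩
    have h1 : genericEval v (map C δ) = C (algebraMap _ R δ) := by
      have : (genericEval v).comp (map C) = C.comp (algebraMap (MvPolynomial σ K) R) := by
        ext <;> simp [genericEval]
      exact RingHom.congr_fun this δ
    rw [hs, map_mul, hfk, zero_mul] at h1
    have h2 := (C_eq_zero.1 h1.symm)
    rw [← map_zero (algebraMap (MvPolynomial σ K) R)] at h2
    exact hδ (FaithfulSMul.algebraMap_injective _ _ h2)
  obtain ⟨Q₁, hQ₁, h₁⟩ := exists_forall_isUnit_of_dvd_map hf.irreducible (fun i => pderiv i f)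
    fun i => or_iff_not_imp_left.2 fun h => not_dvd_pderiv h
  obtain ⟨Q₂, hQ₂, h₂⟩ := exists_forall_isUnit_of_dvd_map hf.irreducible (fun _ => map C δ)
    fun i => Or.inr hfδ
  refine ⟨Q₁ * Q₂, mul_ne_zero hQ₁ hQ₂, fun w c hwc => ?_⟩
  rw [map_mul] at hwc
  obtain ⟨-, h₁⟩ := h₁ _ (left_ne_zero_of_mul hwc)
  obtain ⟨h0, h₂⟩ := h₂ _ (right_ne_zero_of_mul hwc)
  refine ⟨_, fun p hp => h₁ p (dvd_of_mul_left_dvd hp) fun i => ?_, fun p hpN hpδ => ?_,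
    sub_dvd_algebraMap_map_eval hfk w c⟩
  · obtain ⟨s, hs⟩ := hp
    rw [← pderiv_map, hs, pderiv_mul, pderiv_mul]
    exact dvd_add (dvd_mul_of_dvd_left (dvd_add (dvd_mul_left _ _) (dvd_mul_right _ _)) _)
      (dvd_mul_of_dvd_left (dvd_mul_right _ _) _)
  · rcases isEmpty_or_nonempty σ with hσ | hσ
    · exact isUnit_of_degreeOf_eq_zero (ne_zero_of_dvd_ne_zero h0 hpN) fun i => hσ.elim i
    · refine h₂ p hpN fun i => ?_
      rw [map_map]
      have : (eval fun o : Option ι => o.elim c w).comp C = RingHom.id K := by ext; simp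
      rwa [this, map_id]

end Chart

namespace MvPolynomial

section Chart

variable {K σ ι : Type*} [Field K] [CharZero K] [Finite σ] [Fintype ι]

/-- Quotients by a general linear combination of integral elements are integral as soon as some
power of the numerator is divisible by it. -/
theorem exists_forall_isIntegral_of_pow_eq_mul {L F : Type*} [Field L] [Field F]
    [Algebra (MvPolynomial σ K) L] [IsFractionRing (MvPolynomial σ K) L]
    [Algebra (MvPolynomial σ K) F] [Algebra L F] [IsScalarTower (MvPolynomial σ K) L F]
    [FiniteDimensional L F] {v : ι → F} (hv : ∀ j, IsIntegral (MvPolynomial σ K) (v j))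
    {w₁ : ι → K} (hw₁ : ∑ j, algebraMap (MvPolynomial σ K) F (C (w₁ j)) * v j = 1) :
    ∃ Q : MvPolynomial ι K, Q ≠ 0 ∧ ∀ w : ι → K, eval w Q ≠ 0 → ∀ (m : ℕ) (q y τ : F),
      m ≠ 0 → IsIntegral (MvPolynomial σ K) q → IsIntegral (MvPolynomial σ K) y →
      q ^ m = (∑ j, algebraMap (MvPolynomial σ K) F (C (w j)) * v j) * y →
      (∑ j, algebraMap (MvPolynomial σ K) F (C (w j)) * v j) * τ = q →
      IsIntegral (MvPolynomial σ K) τ := by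
  have : FaithfulSMul (MvPolynomial σ K) L :=
    (faithfulSMul_iff_algebraMap_injective _ _).2 (IsFractionRing.injective _ _)
  have : CharZero (MvPolynomial σ K) := charZero_of_injective_algebraMap (C_injective σ K)
  have : CharZero L := charZero_of_injective_algebraMap
    (FaithfulSMul.algebraMap_injective (MvPolynomial σ K) L)
  have hinj : Function.Injective (algebraMap (MvPolynomial σ K) F) := by
    rw [IsScalarTower.algebraMap_eq (MvPolynomial σ K) L F]
    exact (algebraMap L F).injective.comp (FaithfulSMul.algebraMap_injective _ _)
  have : FaithfulSMul (MvPolynomial σ K) F :=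
    (faithfulSMul_iff_algebraMap_injective _ _).2 hinj
  obtain ⟨δ, hδ0, hδ⟩ := exists_smul_isIntegral_of_trace (MvPolynomial σ K) L F
  let R := integralClosure (MvPolynomial σ K) F
  have hvR : ∀ j, IsIntegral (MvPolynomial σ K) (⟨v j, hv j⟩ : R) := fun j =>
    (isIntegral_algHom_iff R.val Subtype.val_injective).1 (hv j)
  obtain ⟨Q, hQ0, hQ⟩ := exists_squarefree_dvd hvR hδ0
  obtain ⟨ω, hω⟩ : ∃ ω : Option ι → K, eval ω Q ≠ 0 := by
    by_contra hcon
    push Not at hcon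
    exact hQ0 (MvPolynomial.funext fun x => by rw [hcon x, map_zero])
  let s : Option ι → MvPolynomial ι K := fun o =>
    o.elim (C (ω none)) fun j => X j + C (ω none * w₁ j)
  have hs : ∀ w, eval w (aeval s Q) =
      eval (fun o : Option ι => o.elim (ω none) fun j => w j + ω none * w₁ j) Q := by
    intro w
    rw [← coe_aeval_eq_eval, ← coe_aeval_eq_eval, RingHom.coe_coe, RingHom.coe_coe,
      ← AlgHom.comp_apply, comp_aeval]
    congr 2
    ext o
    cases o <;> simp [s]
  refine ⟨aeval s Q, fun h0 => hω ?_, fun w hw m q y τ hm hq hy hqy hτ => ?_⟩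
  · have := hs fun j => ω (some j) - ω none * w₁ j
    rw [h0, map_zero] at this
    rw [this]
    congr 2
    ext o
    cases o <;> simp
  · rw [hs] at hw
    obtain ⟨N, hN, hNδ, g', hg'⟩ := hQ _ _ hw
    have h1 := congrArg R.val hg'
    have h2 : R.val (∑ j, algebraMap (MvPolynomial σ K) R (C (w j + ω none * w₁ j)) *
        (⟨v j, hv j⟩ : R) - algebraMap (MvPolynomial σ K) R (C (ω none))) =
        ∑ j, algebraMap (MvPolynomial σ K) F (C (w j)) * v j := by
      rw [map_sub, map_sum]
      simp only [map_mul, AlgHom.commutes, map_add, add_mul, Finset.sum_add_distrib]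
      have : ∑ j, algebraMap (MvPolynomial σ K) F (C (ω none)) *
          algebraMap (MvPolynomial σ K) F (C (w₁ j)) * v j =
          algebraMap (MvPolynomial σ K) F (C (ω none)) := by
        simp only [mul_assoc]
        rw [← Finset.mul_sum, hw₁, mul_one]
      simp only [Subalgebra.coe_val]
      rw [this, add_sub_cancel_right]
    rw [map_mul, h2, AlgHom.commutes] at h1
    exact isIntegral_of_pow_eq_mul hδ0 hδ hN hNδ g'.2 h1 hq hy hm hqy hτ

/-- The version of `exists_forall_isIntegral_of_pow_eq_mul` inside a given field. -/
theorem exists_forall_isIntegral_adjoin {Ω : Type*} [Field Ω] [Algebra K Ω] {z : σ → Ω}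
    (hz : AlgebraicIndependent K z) {v : ι → Ω}
    (hv : ∀ j, IsIntegral (Algebra.adjoin K (Set.range z)) (v j))
    (h1 : 1 ∈ Submodule.span K (Set.range v)) :
    ∃ Q : MvPolynomial ι K, Q ≠ 0 ∧ ∀ w : ι → K, eval w Q ≠ 0 → ∀ (m : ℕ) (q y τ : Ω),
      m ≠ 0 → ∑ j, w j • v j ≠ 0 → q ∈ Algebra.adjoin K (Set.range v) →
      y ∈ Algebra.adjoin K (Set.range v) →
      q ^ m = (∑ j, w j • v j) * y → (∑ j, w j • v j) * τ = q →
      IsIntegral (Algebra.adjoin K (Set.range z)) τ := by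
  let _ : Algebra (MvPolynomial σ K) Ω := (aeval z).toAlgebra
  have hmap : ∀ p : MvPolynomial σ K, algebraMap (MvPolynomial σ K) Ω p = aeval z p :=
    fun p => rfl
  have : IsScalarTower K (MvPolynomial σ K) Ω := IsScalarTower.of_algebraMap_eq fun x => by
    rw [hmap, algebraMap_eq, aeval_C]
  have : FaithfulSMul (MvPolynomial σ K) Ω := (faithfulSMul_iff_algebraMap_injective _ _).2 hz
  have hint : ∀ t : Ω, IsIntegral (Algebra.adjoin K (Set.range z)) t ↔
      IsIntegral (MvPolynomial σ K) t := by
    intro t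
    constructor
    · intro ht
      have h := ht.map_of_comp_eq (S := Ω) (hz.aevalEquiv.symm : _ →+* MvPolynomial σ K)
        (RingHom.id Ω) (by
          ext x
          obtain ⟨p, rfl⟩ := hz.aevalEquiv.surjective x
          simp only [RingHom.comp_apply, RingHom.coe_coe, AlgEquiv.symm_apply_apply, hmap,
            RingHom.id_apply]
          exact (hz.algebraMap_aevalEquiv p).symm)
      exact h
    · intro ht
      have h := ht.map_of_comp_eq (S := Ω)
        (hz.aevalEquiv : MvPolynomial σ K →+* Algebra.adjoin K (Set.range z)) (RingHom.id Ω) (by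
          refine RingHom.ext fun p => ?_
          simp only [RingHom.comp_apply, RingHom.coe_coe, hmap, RingHom.id_apply]
          exact hz.algebraMap_aevalEquiv p)
      exact h
  let _ : Algebra (FractionRing (MvPolynomial σ K)) Ω := FractionRing.liftAlgebra _ _
  have : IsScalarTower (MvPolynomial σ K) (FractionRing (MvPolynomial σ K)) Ω :=
    FractionRing.isScalarTower_liftAlgebra _ _
  set L := FractionRing (MvPolynomial σ K)
  set F := IntermediateField.adjoin L (Set.range v) with hF
  have hvP : ∀ j, IsIntegral (MvPolynomial σ K) (v j) := fun j => (hint _).1 (hv j)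
  have : FiniteDimensional L F := by
    refine IntermediateField.finiteDimensional_adjoin ?_
    rintro _ ⟨j, rfl⟩
    exact (hvP j).tower_top
  have hvF : ∀ j, v j ∈ F := fun j => IntermediateField.subset_adjoin _ _ ⟨j, rfl⟩
  have hsub : ∀ t : F, IsIntegral (MvPolynomial σ K) t ↔ IsIntegral (MvPolynomial σ K) (t : Ω) :=
    fun t => (isIntegral_algHom_iff (F.val.restrictScalars (MvPolynomial σ K))
      F.val.injective).symm
  have hcoe : ∀ p : MvPolynomial σ K, (algebraMap (MvPolynomial σ K) F p : Ω) =
      algebraMap (MvPolynomial σ K) Ω p := fun p => rfl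
  have hsum : ∀ w : ι → K, ((∑ j, algebraMap (MvPolynomial σ K) F (C (w j)) * ⟨v j, hvF j⟩ : F) :
      Ω) = ∑ j, w j • v j := by
    intro w
    rw [AddSubmonoidClass.coe_finsetSum]
    refine Finset.sum_congr rfl fun j _ => ?_
    rw [MulMemClass.coe_mul, hcoe, hmap, aeval_C, Algebra.smul_def]
  have hadj : ∀ t ∈ Algebra.adjoin K (Set.range v), t ∈ F ∧ IsIntegral (MvPolynomial σ K) t := by
    intro t ht
    induction ht using Algebra.adjoin_induction with
    | mem x hx => obtain ⟨j, rfl⟩ := hx; exact ⟨hvF j, hvP j⟩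
    | algebraMap x =>
      rw [IsScalarTower.algebraMap_apply K (MvPolynomial σ K) Ω]
      exact ⟨(algebraMap (MvPolynomial σ K) F (algebraMap K _ x)).2, isIntegral_algebraMap⟩
    | add x y _ _ hx hy => exact ⟨add_mem hx.1 hy.1, hx.2.add hy.2⟩
    | mul x y _ _ hx hy => exact ⟨mul_mem hx.1 hy.1, hx.2.mul hy.2⟩
  obtain ⟨w₁, hw₁⟩ := (Submodule.mem_span_range_iff_exists_fun K).1 h1
  obtain ⟨Q, hQ0, hQ⟩ := exists_forall_isIntegral_of_pow_eq_mul (L := L) (F := F)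
    (v := fun j => ⟨v j, hvF j⟩) (fun j => (hsub _).2 (hvP j)) (w₁ := w₁)
    (Subtype.ext (by rw [hsum, hw₁]; rfl))
  refine ⟨Q, hQ0, fun w hw m q y τ hm hg hq hy hqy hτ => ?_⟩
  obtain ⟨hqF, hqP⟩ := hadj q hq
  have hτF : τ ∈ F := by
    rw [eq_div_of_mul_eq hg ((mul_comm _ _).trans hτ), ← hsum]
    exact div_mem hqF (SetLike.coe_mem _)
  obtain ⟨hyF, hyP⟩ := hadj y hy
  rw [hint]
  refine (hsub ⟨τ, hτF⟩).1 (hQ w hw m ⟨q, hqF⟩ ⟨y, hyF⟩ ⟨τ, hτF⟩ hm ((hsub _).2 hqP)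
    ((hsub _).2 hyP) (Subtype.ext ?_) (Subtype.ext ?_))
  · rw [MulMemClass.coe_mul, hsum]; exact hqy
  · rw [MulMemClass.coe_mul, hsum]; exact hτ

end Chart

end MvPolynomial

lemma MvPolynomial.aeval_mul_of_isHomogeneous {σ R A : Type*} [CommSemiring R] [CommSemiring A]
    [Algebra R A] {m : ℕ} {f : MvPolynomial σ R} (hf : f.IsHomogeneous m) (s : A) (z : σ → A) :
    aeval (fun i => s * z i) f = s ^ m * aeval z f := by
  rw [aeval_def, aeval_def, eval₂_eq, eval₂_eq, Finset.mul_sum]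
  refine Finset.sum_congr rfl fun d hd => ?_
  have h1 : ∑ i ∈ d.support, d i = m := by
    have := hf (mem_support_iff.1 hd)
    rwa [Finsupp.weight_apply, Finsupp.sum, Finset.sum_congr rfl fun i _ => by
      rw [Pi.one_apply, smul_eq_mul, mul_one]] at this
  simp only [mul_pow]
  rw [Finset.prod_mul_distrib, Finset.prod_pow_eq_pow_sum, h1]
  ring

section ProjectiveCoordinates

variable {Ω : Type} [Field Ω]

lemma isIntegral_of_forall_mem_valuationSubring {R : Subring Ω} {t : Ω}
    (h : ∀ A : ValuationSubring Ω, (R : Set Ω) ⊆ A → t ∈ A) : IsIntegral R t := by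
  have h1 : t ∈ (⨅ V : {V : ValuationSubring Ω // (R : Set Ω) ⊆ V.toSubring},
      V.1.toSubring) := by
    rw [Subring.mem_iInf]
    exact fun V => h V.1 V.2
  rw [iInf_valuationSubring_superset] at h1
  have h2 : IsIntegral (Subring.closure (R : Set Ω)) t := h1
  rwa [Subring.closure_eq] at h2

lemma ValuationSubring.mem_of_isIntegral {R : Type*} [CommRing R] [Algebra R Ω]
    {A : ValuationSubring Ω} (hA : ∀ x, algebraMap R Ω x ∈ A) {t : Ω} (ht : IsIntegral R t) :
    t ∈ A := by
  have h1 : IsIntegral A t := ht.map_of_comp_eq (S := Ω)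
    ((algebraMap R Ω).codRestrict A.toSubring hA) (RingHom.id Ω) rfl
  obtain ⟨a, ha⟩ := IsIntegrallyClosed.isIntegral_iff.1 h1
  rw [← ha]
  exact a.2

/-- The elements of the family satisfy no homogeneous relation. -/
def HomogIndep {ι : Type*} (K : Subfield Ω) (z : ι → Ω) : Prop :=
  ∀ (m : ℕ) (f : MvPolynomial ι K), f.IsHomogeneous m → aeval z f = 0 → f = 0

variable {K : Subfield Ω} {ι : Type*} {z : ι → Ω}

lemma HomogIndep.ne_zero (hz : HomogIndep K z) (a : ι) : z a ≠ 0 := fun h =>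
  X_ne_zero a (hz 1 (X a) (isHomogeneous_X _ _) (by rw [aeval_X, h]))

lemma aeval_div_mul_pow (z : ι → Ω) {s : Ω} (hs : s ≠ 0) {m : ℕ} {f : MvPolynomial ι K}
    (hf : f.IsHomogeneous m) : aeval (fun i => z i / s) f * s ^ m = aeval z f := by
  rw [mul_comm, ← aeval_mul_of_isHomogeneous hf]
  congr 2
  funext i
  rw [mul_div_cancel₀ _ hs]

lemma HomogIndep.algebraicIndependent (hz : HomogIndep K z) (a : ι) :
    AlgebraicIndependent K fun i : {i // i ≠ a} => z i / z a := by
  rw [algebraicIndependent_iff]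
  intro f hf
  let D := f.totalDegree
  let G : MvPolynomial ι K := ∑ m ∈ Finset.range (D + 1),
    X a ^ (D - m) * rename Subtype.val (homogeneousComponent m f)
  have hG : G.IsHomogeneous D := by
    refine IsHomogeneous.sum _ _ _ fun m hm => ?_
    have h1 := (isHomogeneous_X_pow (R := K) a (D - m)).mul
      ((homogeneousComponent_isHomogeneous m f).rename_isHomogeneous (f := Subtype.val))
    rwa [Nat.sub_add_cancel (Nat.lt_succ_iff.1 (Finset.mem_range.1 hm))] at h1
  have hG0 : aeval z G = 0 := by
    have h1 : aeval z G = z a ^ D * aeval (fun i : {i // i ≠ a} => z i / z a) f := by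
      conv_rhs => rw [← sum_homogeneousComponent f]
      rw [map_sum, map_sum, Finset.mul_sum]
      refine Finset.sum_congr rfl fun m hm => ?_
      rw [map_mul, map_pow, aeval_X, aeval_rename, ← aeval_div_mul_pow (z ∘ Subtype.val)
        (hz.ne_zero a) (homogeneousComponent_isHomogeneous m f), mul_comm (aeval _ _), ← mul_assoc,
        ← pow_add, Nat.sub_add_cancel (Nat.lt_succ_iff.1 (Finset.mem_range.1 hm))]
      rfl
    rw [h1, hf, mul_zero]
  have h0 := hz D G hG hG0
  classical
  let φ : MvPolynomial ι K →ₐ[K] MvPolynomial {i // i ≠ a} K :=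
    aeval fun i => if h : i = a then 1 else X ⟨i, h⟩
  have h1 : φ G = f := by
    conv_rhs => rw [← sum_homogeneousComponent f]
    rw [map_sum]
    refine Finset.sum_congr rfl fun m hm => ?_
    rw [map_mul, map_pow, aeval_X, dif_pos rfl, one_pow, one_mul, aeval_rename]
    have : ((fun i => if h : i = a then 1 else X ⟨i, h⟩ : ι → MvPolynomial {i // i ≠ a} K) ∘
        Subtype.val) = X := by
      funext i
      simp [i.2]
    rw [this, aeval_X_left_apply]
  rw [← h1, h0, map_zero]


lemma div_pow_mem_adjoin {κ : Type*} {v : κ → Ω} {s y : Ω} {m : ℕ}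
    (hy : y ∈ Submodule.span K (Set.range v) ^ m) :
    y / s ^ m ∈ Algebra.adjoin K (Set.range fun j => v j / s) := by
  have h1 : ∀ x ∈ Submodule.span K (Set.range v),
      x / s ∈ Algebra.adjoin K (Set.range fun j => v j / s) := by
    intro x hx
    induction hx using Submodule.span_induction with
    | mem x hx => obtain ⟨j, rfl⟩ := hx; exact Algebra.subset_adjoin ⟨j, rfl⟩
    | zero => rw [zero_div]; exact zero_mem _
    | add x y _ _ hx hy => rw [add_div]; exact add_mem hx hy
    | smul a x _ hx => rw [smul_div_assoc]; exact Subalgebra.smul_mem _ hx a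
  induction m generalizing y with
  | zero =>
    rw [pow_zero, Submodule.mem_one] at hy
    obtain ⟨a, rfl⟩ := hy
    rw [pow_zero, div_one]
    exact Subalgebra.algebraMap_mem _ a
  | succ m ih =>
    rw [pow_succ] at hy
    induction hy using Submodule.mul_induction_on' with
    | mem_mul_mem a ha b hb =>
      rw [pow_succ, mul_div_mul_comm]
      exact mul_mem (ih ha) (h1 b hb)
    | add x _ y _ hx hy => rw [add_div]; exact add_mem hx hy

/-- A ratio `q / g` of a quadric by a general linear form is dominated by the coordinates, provided
some power of `q` is divisible by `g`. -/
theorem exists_forall_dom_of_pow_eq_mul [CharZero Ω] {n : ℕ} {z : Fin (n + 1) → Ω}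
    (hz : HomogIndep K z) (hz0 : z 0 = 1) {κ : Type*} [Fintype κ] {v : κ → Ω}
    (hv : ∀ j, Dom K (List.ofFn fun i : Fin n => z i.succ) (v j))
    (hzv : ∀ i, z i ∈ Submodule.span K (Set.range v)) :
    ∃ P : MvPolynomial κ K, P ≠ 0 ∧ ∀ w, eval w P ≠ 0 → ∑ j, w j • v j ≠ 0 →
      ∀ (m : ℕ) (q y τ : Ω), m ≠ 0 → q ∈ Submodule.span K (Set.range v) ^ 2 →
      y ∈ Submodule.span K (Set.range v) ^ (2 * m - 1) →
      q ^ m = (∑ j, w j • v j) * y → (∑ j, w j • v j) * τ = q →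
      Dom K (List.ofFn fun i : Fin n => z i.succ) τ := by
  have hmem : ∀ a, z a = 1 ∨ z a ∈ List.ofFn fun i : Fin n => z i.succ := by
    intro a
    rcases Fin.eq_zero_or_eq_succ a with rfl | ⟨b, rfl⟩
    · exact Or.inl hz0
    · exact Or.inr ((List.mem_ofFn' _ _).2 ⟨b, rfl⟩)
  have hchart : ∀ a, ∃ P : MvPolynomial κ K, P ≠ 0 ∧ ∀ w, eval w P ≠ 0 → ∑ j, w j • v j ≠ 0 →
      ∀ (m : ℕ) (q y τ : Ω), m ≠ 0 → q ∈ Submodule.span K (Set.range v) ^ 2 →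
      y ∈ Submodule.span K (Set.range v) ^ (2 * m - 1) →
      q ^ m = (∑ j, w j • v j) * y → (∑ j, w j • v j) * τ = q →
      IsIntegral (Algebra.adjoin K (Set.range fun i : {i // i ≠ a} => z i / z a)) (τ / z a) := by
    intro a
    have ha := hz.ne_zero a
    obtain ⟨P, hP0, hP⟩ := exists_forall_isIntegral_adjoin (v := fun j => v j / z a)
      (hz.algebraicIndependent a) (fun j => by
        refine isIntegral_of_forall_mem_valuationSubring (R := (Algebra.adjoin K
          (Set.range fun i : {i // i ≠ a} => z i / z a)).toSubring) fun A hA => ?_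
        have hval : ∀ i, A.valuation (z i) ≤ A.valuation (z a) := by
          intro i
          by_cases hi : i = a
          · rw [hi]
          · have h1 : z i / z a ∈ A := hA (Algebra.subset_adjoin ⟨⟨i, hi⟩, rfl⟩)
            rw [← A.valuation_le_one_iff, map_div₀] at h1
            exact (div_le_one₀ (by rw [zero_lt_iff]; simpa using ha)).1 h1
        rw [← A.valuation_le_one_iff, map_div₀]
        refine div_le_one_of_le₀ (hv j A (fun x hx => ?_) _ ?_ fun y hy => ?_) zero_le
        · exact hA (Subalgebra.algebraMap_mem _ (⟨x, hx⟩ : K))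
        · have := hval 0
          rwa [hz0, map_one] at this
        · obtain ⟨b, rfl⟩ := (List.mem_ofFn' _ _).1 hy
          exact hval _) (by
        obtain ⟨w, hw⟩ := (Submodule.mem_span_range_iff_exists_fun K).1 (hzv a)
        refine (Submodule.mem_span_range_iff_exists_fun K).2 ⟨w, ?_⟩
        rw [← div_self ha]
        nth_rewrite 2 [← hw]
        rw [Finset.sum_div]
        exact Finset.sum_congr rfl fun j _ => (smul_div_assoc _ _ _).symm)
    refine ⟨P, hP0, fun w hw hg m q y τ hm hq hy hqy hτ => ?_⟩
    have hsum : ∑ j, w j • (v j / z a) = (∑ j, w j • v j) / z a := by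
      rw [Finset.sum_div]
      exact Finset.sum_congr rfl fun j _ => (smul_div_assoc _ _ _).symm
    refine hP w hw m (q / z a ^ 2) (y / z a ^ (2 * m - 1)) _ hm ?_ (div_pow_mem_adjoin hq)
      (div_pow_mem_adjoin hy) ?_ ?_
    · rw [hsum]
      exact div_ne_zero hg ha
    · rw [hsum, ← mul_div_mul_comm, ← hqy, div_pow, ← pow_mul, ← pow_succ']
      congr 2
      omega
    · rw [hsum, ← mul_div_mul_comm, hτ, sq]
  choose P hP0 hP using hchart
  refine ⟨∏ a, P a, Finset.prod_ne_zero_iff.2 fun a _ => hP0 a,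
    fun w hw hg m q y τ hm hq hy hqy hτ A hA γ hγ hl => ?_⟩
  rw [map_prod, Finset.prod_ne_zero_iff] at hw
  obtain ⟨a, ha⟩ := Finite.exists_max fun i => A.valuation (z i)
  have h0 : 0 < A.valuation (z a) := by
    rw [zero_lt_iff]; simpa using hz.ne_zero a
  have h1 : τ / z a ∈ A := by
    refine ValuationSubring.mem_of_isIntegral (fun x => ?_)
      (hP a w (hw a (Finset.mem_univ a)) hg m q y τ hm hq hy hqy hτ)
    obtain ⟨x, hx⟩ := x
    change x ∈ A
    induction hx using Algebra.adjoin_induction with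
    | mem x hx =>
      obtain ⟨i, rfl⟩ := hx
      rw [← A.valuation_le_one_iff, map_div₀]
      exact div_le_one_of_le₀ (ha i) zero_le
    | algebraMap x => exact hA x.2
    | add x y _ _ hx hy => exact add_mem hx hy
    | mul x y _ _ hx hy => exact mul_mem hx hy
  rw [← A.valuation_le_one_iff, map_div₀, div_le_one₀ h0] at h1
  refine h1.trans ?_
  rcases hmem a with h | h
  · rwa [h, map_one]
  · exact hl _ h

end ProjectiveCoordinates

section LinearNormalization

variable {Ω : Type} [Field Ω] {K : Subfield Ω}

lemma aeval_sub_smul_mem {ι : Type*} {y : ι → Ω} {a : ι → K} {t : Ω} {Y Y' : Submodule K Ω}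
    (hY : Y' ≤ Y) (ht : t ∈ Y) (hy : ∀ i, y i - a i • t ∈ Y') {D : ℕ} {f : MvPolynomial ι K}
    (hf : f ∈ homogeneousSubmodule ι K (D + 1)) :
    aeval y f - eval a f • t ^ (D + 1) ∈ Y' * Y ^ D ∧ aeval y f ∈ Y ^ (D + 1) := by
  have hyY : ∀ i, y i ∈ Y := fun i => by
    rw [← sub_add_cancel (y i) (a i • t)]
    exact add_mem (hY (hy i)) (Submodule.smul_mem _ _ ht)
  have hlin : ∀ g ∈ homogeneousSubmodule ι K 1, aeval y g - eval a g • t ∈ Y' ∧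
      aeval y g ∈ Y := by
    intro g hg
    rw [homogeneousSubmodule_one_eq_span_X] at hg
    induction hg using Submodule.span_induction with
    | mem x hx =>
      obtain ⟨i, rfl⟩ := hx
      rw [aeval_X, eval_X]
      exact ⟨hy i, hyY i⟩
    | zero => simp
    | add p q _ _ hp hq =>
      rw [map_add, map_add, add_smul, add_sub_add_comm]
      exact ⟨add_mem hp.1 hq.1, add_mem hp.2 hq.2⟩
    | smul c p _ hp =>
      rw [map_smul, smul_eval, mul_smul, ← smul_sub]
      exact ⟨Submodule.smul_mem _ _ hp.1, Submodule.smul_mem _ _ hp.2⟩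
  induction D generalizing f with
  | zero => simpa using hlin f hf
  | succ D ih =>
    rw [← homogeneousSubmodule_one_pow, pow_succ', homogeneousSubmodule_one_pow] at hf
    induction hf using Submodule.mul_induction_on' with
    | mem_mul_mem p hp q hq =>
      obtain ⟨h1, h2⟩ := hlin p hp
      obtain ⟨h3, h4⟩ := ih hq
      constructor
      · have h5 : aeval y (p * q) - eval a (p * q) • t ^ (D + 1 + 1) =
            (aeval y p - eval a p • t) * aeval y q +
            (eval a p • t) * (aeval y q - eval a q • t ^ (D + 1)) := by
          simp only [map_mul, Algebra.smul_def]
          ring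
        rw [h5]
        refine add_mem (Submodule.mul_mem_mul h1 h4) ?_
        rw [pow_succ', mul_left_comm]
        exact Submodule.mul_mem_mul (Submodule.smul_mem _ _ ht) h3
      · rw [map_mul, pow_succ']
        exact Submodule.mul_mem_mul h2 h4
    | add p _ q _ hp hq =>
      rw [map_add, map_add, add_smul, add_sub_add_comm]
      exact ⟨add_mem hp.1 hq.1, add_mem hp.2 hq.2⟩

lemma Submodule.sup_pow_le {R A : Type*} [CommSemiring R] [CommSemiring A] [Algebra R A]
    (P T : Submodule R A) (D : ℕ) : (P ⊔ T) ^ (D + 1) ≤ P * (P ⊔ T) ^ D ⊔ T ^ (D + 1) := by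
  induction D with
  | zero => simp
  | succ D ih =>
    rw [pow_succ', Submodule.sup_mul]
    refine sup_le le_sup_left ?_
    refine (mul_le_mul_right ih T).trans ?_
    rw [Submodule.mul_sup, ← pow_succ', mul_left_comm]
    refine sup_le_sup_right (mul_le_mul_right ?_ P) _
    rw [pow_succ' (P ⊔ T)]
    exact mul_le_mul_left le_sup_right _

/-- A form of the Noether normalization lemma with linear coordinates. -/
theorem exists_homogIndep [Infinite K] (V : Submodule K Ω) [FiniteDimensional K V] (hV : V ≠ ⊥) :
    ∃ (r : ℕ) (y : Fin (r + 1) → Ω), HomogIndep K y ∧ (∀ i, y i ∈ V) ∧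
      ∃ m, V ^ (m + 1) ≤ Submodule.span K (Set.range y) * V ^ m := by
  have hex : ∃ s, ∃ Y ≤ V, Module.finrank K Y = s ∧ ∃ m, V ^ (m + 1) ≤ Y * V ^ m :=
    ⟨_, V, le_rfl, rfl, 0, by simp⟩
  classical
  obtain ⟨Y, hYV, hYs, m, hm⟩ := Nat.find_spec hex
  have hmin := fun s => Nat.find_min hex (m := s)
  rw [← hYs] at hmin
  have : FiniteDimensional K Y := Submodule.finiteDimensional_of_le hYV
  have hY : Y ≠ ⊥ := by
    rintro rfl
    obtain ⟨x, hx, hx0⟩ := Submodule.exists_mem_ne_zero_of_ne_bot hV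
    have := hm (Submodule.pow_mem_pow V hx (m + 1))
    rw [Submodule.bot_mul, Submodule.mem_bot] at this
    exact hx0 (pow_eq_zero_iff (Nat.succ_ne_zero m) |>.1 this)
  obtain ⟨r, hr⟩ : ∃ r, Module.finrank K Y = r + 1 :=
    Nat.exists_eq_succ_of_ne_zero fun h => hY (Submodule.finrank_eq_zero.1 h)
  let b := Module.finBasisOfFinrankEq K Y hr
  have hspan : Submodule.span K (Set.range fun i => (b i : Ω)) = Y := by
    have h1 := congrArg (Submodule.map Y.subtype) b.span_eq
    rwa [Submodule.map_span, ← Set.range_comp, Submodule.map_top, Submodule.range_subtype] at h1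
  refine ⟨r, fun i => b i, ?_, fun i => hYV (b i).2, m, by rwa [hspan]⟩
  intro D G hG hG0
  by_contra hne
  obtain ⟨a, ha⟩ : ∃ a, eval a G ≠ 0 := by
    by_contra hcon
    push Not at hcon
    exact hne (MvPolynomial.funext fun x => by rw [hcon x, map_zero])
  cases D with
  | zero =>
    rw [← totalDegree_zero_iff_isHomogeneous, totalDegree_eq_zero_iff_eq_C] at hG
    rw [hG, aeval_C] at hG0
    exact hne (by rw [hG, (map_eq_zero _).1 hG0, C_0])
  | succ D =>
    obtain ⟨i₀, hi₀⟩ : ∃ i, a i ≠ 0 := by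
      by_contra hcon
      push Not at hcon
      have h1 : a = fun i => 0 * a i := by funext i; rw [hcon i, zero_mul]
      have h2 := aeval_mul_of_isHomogeneous hG (0 : K) a
      rw [← h1, zero_pow (Nat.succ_ne_zero D), zero_mul] at h2
      exact ha h2
    set t : Ω := (a i₀)⁻¹ • (b i₀ : Ω) with ht
    have htY : t ∈ Y := Submodule.smul_mem _ _ (b i₀).2
    set Y' : Submodule K Ω :=
      Submodule.span K (Set.range fun i : {i // i ≠ i₀} => (b i : Ω) - a i • t) with hY'
    have hY'Y : Y' ≤ Y := Submodule.span_le.2 (by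
      rintro _ ⟨i, rfl⟩
      exact sub_mem (b i).2 (Submodule.smul_mem _ _ htY))
    have hmem : ∀ i, (b i : Ω) - a i • t ∈ Y' := by
      intro i
      by_cases hi : i = i₀
      · rw [hi, ht, smul_smul, mul_inv_cancel₀ hi₀, one_smul, sub_self]
        exact zero_mem _
      · exact Submodule.subset_span ⟨⟨i, hi⟩, rfl⟩
    have h1 := (aeval_sub_smul_mem hY'Y htY hmem hG).1
    rw [hG0, zero_sub, neg_mem_iff, Submodule.smul_mem_iff _ ha] at h1
    have hsup : Y' ⊔ Submodule.span K {t} = Y := by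
      refine le_antisymm (sup_le hY'Y ((Submodule.span_singleton_le_iff_mem _ _).2 htY)) ?_
      rw [← hspan, Submodule.span_le]
      rintro _ ⟨i, rfl⟩
      have h2 := Submodule.add_mem_sup (hmem i)
        (Submodule.smul_mem _ (a i) (Submodule.mem_span_singleton_self t))
      simpa using h2
    have h2 : Y ^ (D + 1) ≤ Y' * Y ^ D := by
      have h3 := Submodule.sup_pow_le Y' (Submodule.span K {t}) D
      rw [hsup, Submodule.span_pow, Set.singleton_pow] at h3
      exact h3.trans (sup_le le_rfl ((Submodule.span_singleton_le_iff_mem _ _).2 h1))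
    have h3 : ∀ j, V ^ (m + j) ≤ Y ^ j * V ^ m := by
      intro j
      induction j with
      | zero => simp
      | succ j ih =>
        calc V ^ (m + (j + 1)) = V * V ^ (m + j) := by rw [← pow_succ', add_assoc]
          _ ≤ V * (Y ^ j * V ^ m) := mul_le_mul_right ih _
          _ = Y ^ j * V ^ (m + 1) := by rw [pow_succ']; ring
          _ ≤ Y ^ j * (Y * V ^ m) := mul_le_mul_right hm _
          _ = Y ^ (j + 1) * V ^ m := by ring
    refine hmin (Module.finrank K Y') ?_ ⟨Y', hY'Y.trans hYV, rfl, m + D, ?_⟩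
    · calc Module.finrank K Y' ≤ Fintype.card {i // i ≠ i₀} := finrank_range_le_card _
        _ < Fintype.card (Fin (r + 1)) := Fintype.card_subtype_lt (x := i₀) (by simp)
        _ = Module.finrank K Y := by rw [Fintype.card_fin, hr]
    · calc V ^ (m + D + 1) = V ^ (m + (D + 1)) := rfl
        _ ≤ Y ^ (D + 1) * V ^ m := h3 _
        _ ≤ Y' * Y ^ D * V ^ m := mul_le_mul_left h2 _
        _ = Y' * (Y ^ D * V ^ m) := mul_assoc _ _ _
        _ ≤ Y' * (V ^ D * V ^ m) :=
          mul_le_mul_right (mul_le_mul_left (pow_le_pow_left' hYV D) _) _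
        _ = Y' * V ^ (m + D) := by rw [← pow_add, add_comm]

lemma HomogIndep.div {ι : Type*} {y : ι → Ω} (hy : HomogIndep K y) {s : Ω} (hs : s ≠ 0) :
    HomogIndep K fun i => y i / s := by
  intro m f hf h
  refine hy m f hf ?_
  rw [← aeval_div_mul_pow y hs hf, h, zero_mul]

lemma span_range_div {ι : Type*} (y : ι → Ω) (s : Ω) :
    Submodule.span K (Set.range fun i => y i / s) =
      Submodule.span K {s⁻¹} * Submodule.span K (Set.range y) := by
  rw [Submodule.span_mul_span, Set.singleton_mul, ← Set.range_comp]
  congr 2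
  funext i
  exact div_eq_inv_mul _ _

lemma dom_of_pow_le_mul_pow {V : Submodule K Ω} [FiniteDimensional K V] (h1 : 1 ∈ V) {l : List Ω}
    {Z : Submodule K Ω} (hZ : ∀ x ∈ Z, Dom K l x) {m : ℕ} (hm : V ^ (m + 1) ≤ Z * V ^ m) :
    ∀ x ∈ V, Dom K l x := by
  intro x hx A hA γ hγ hl
  have hsmul : ∀ (c : K) (t : Ω) (β : A.ValueGroup), A.valuation t ≤ β →
      A.valuation (c • t) ≤ β := by
    intro c t β ht
    rw [Algebra.smul_def, map_mul]
    exact mul_le_of_le_one_of_le ((A.valuation_le_one_iff _).2 (hA c.2)) ht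
  have h1m : (1 : Ω) ∈ V ^ m := by
    have := Submodule.pow_mem_pow V h1 m
    rwa [one_pow] at this
  have hfg : (V ^ m).FG := (Module.Finite.iff_fg.1 (inferInstance : Module.Finite K V)).pow m
  obtain ⟨S, hS⟩ := hfg
  have hSne : S.Nonempty := by
    rw [Finset.nonempty_iff_ne_empty]
    rintro rfl
    rw [Finset.coe_empty, Submodule.span_empty] at hS
    rw [← hS, Submodule.mem_bot] at h1m
    exact one_ne_zero h1m
  obtain ⟨b, hbS, hb⟩ := S.exists_max_image (fun s => A.valuation s) hSne
  have hVm : ∀ t ∈ V ^ m, A.valuation t ≤ A.valuation b := by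
    intro t ht
    rw [← hS] at ht
    induction ht using Submodule.span_induction with
    | mem t ht => exact hb t ht
    | zero => simp
    | add p q _ _ hp hq => exact A.valuation.map_add_le hp hq
    | smul c p _ hp => exact hsmul c p _ hp
  have hb0 : 0 < A.valuation b := by
    have := hVm 1 h1m
    rw [map_one] at this
    exact zero_lt_one.trans_le this
  have hxb : x * b ∈ Z * V ^ m := hm (by
    rw [pow_succ']
    exact Submodule.mul_mem_mul hx (hS ▸ Submodule.subset_span hbS))
  have h2 : ∀ t ∈ Z * V ^ m, A.valuation t ≤ γ * A.valuation b := by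
    intro t ht
    induction ht using Submodule.mul_induction_on' with
    | mem_mul_mem p hp q hq =>
      rw [map_mul]
      exact mul_le_mul' (hZ p hp A hA γ hγ hl) (hVm q hq)
    | add p _ q _ hp hq => exact A.valuation.map_add_le hp hq
  have h3 := h2 _ hxb
  rw [map_mul] at h3
  exact le_of_mul_le_mul_right h3 hb0

end LinearNormalization

section ListIndependence

variable {Ω : Type} [Field Ω] [CharZero Ω]

lemma AlgebraicIndependent.over_aadj {K : Subfield Ω} {r : ℕ} {y : Fin (r + 1) → Ω}
    (hy : AlgebraicIndependent K y) :
    AlgebraicIndependent (aadj K (y 0)) fun i : Fin r => y i.succ := by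
  have h1 : AlgebraicIndependent K (Sum.elim (fun i : Fin r => y i.succ) fun _ : Unit => y 0) := by
    have := hy.comp (Sum.elim Fin.succ fun _ : Unit => 0) (by
      rintro (i | i) (j | j) h
      · simpa using h
      · exact absurd h (Fin.succ_ne_zero i)
      · exact absurd h.symm (Fin.succ_ne_zero j)
      · rfl)
    rwa [Sum.comp_elim] at this
  have h2 := (AlgebraicIndependent.sumElim_iff.1 h1).2
  rw [Set.range_const] at h2
  have hle : ∀ x ∈ Algebra.adjoin K {y 0}, x ∈ aadj K (y 0) := by
    intro x hx
    induction hx using Algebra.adjoin_induction with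
    | mem x hx => rw [Set.mem_singleton_iff.1 hx]; exact self_mem_aadj K _
    | algebraMap x => exact le_aadj K _ x.2
    | add x y _ _ hx hy => exact add_mem hx hy
    | mul x y _ _ hx hy => exact mul_mem hx hy
  let φ : Algebra.adjoin K {y 0} →+* aadj K (y 0) :=
    ((Algebra.adjoin K {y 0}).val : Algebra.adjoin K {y 0} →+* Ω).codRestrict
      (aadj K (y 0)).toSubring fun x => hle _ x.2
  let _ : Algebra (Algebra.adjoin K {y 0}) (aadj K (y 0)) := φ.toAlgebra
  have : IsScalarTower (Algebra.adjoin K {y 0}) (aadj K (y 0)) Ω :=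
    IsScalarTower.of_algebraMap_eq fun _ => rfl
  have : Algebra.IsAlgebraic (Algebra.adjoin K {y 0}) (aadj K (y 0)) := by
    refine ⟨fun x => ?_⟩
    have h3 : IsAlgebraic (IntermediateField.adjoin K {y 0}).toSubfield (x : Ω) := by
      refine isAlgebraic_of_mem_acl (Set.insert_subset ?_ fun a ha => ?_) x.2
      · exact IntermediateField.subset_adjoin _ _ rfl
      · exact (IntermediateField.adjoin K {y 0}).algebraMap_mem ⟨a, ha⟩
    have h4 : IsAlgebraic (IntermediateField.adjoin K {y 0}) (x : Ω) := h3
    rw [IntermediateField.isAlgebraic_adjoin_iff] at h4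
    exact (isAlgebraic_algebraMap_iff (algebraMap (aadj K (y 0)) Ω).injective).1 h4
  exact h2.extendScalars _

lemma AlgebraicIndependent.aInd {r : ℕ} {K : Subfield Ω} {y : Fin r → Ω}
    (hy : AlgebraicIndependent K y) : AInd K (List.ofFn y) := by
  induction r generalizing K with
  | zero => simp [AInd]
  | succ r ih =>
    rw [List.ofFn_succ]
    refine ⟨fun h => ?_, ih hy.over_aadj⟩
    exact hy.transcendental 0 (isAlgebraic_algebraMap (⟨y 0, h⟩ : K))

lemma HomogIndep.aInd {K : Subfield Ω} {n : ℕ} {z : Fin (n + 1) → Ω} (hz : HomogIndep K z)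
    (hz0 : z 0 = 1) : AInd K (List.ofFn fun i : Fin n => z i.succ) := by
  refine AlgebraicIndependent.aInd ?_
  have h1 := (hz.algebraicIndependent 0).comp (fun i : Fin n => ⟨i.succ, Fin.succ_ne_zero i⟩)
    fun i j h => by simpa using h
  simpa [Function.comp_def, hz0] using h1

end ListIndependence

section HomogeneousForms

lemma finrank_homogeneousSubmodule_fin (R : Type*) [CommRing R] [Nontrivial R] (r m : ℕ) :
    Module.finrank R (homogeneousSubmodule (Fin (r + 1)) R m) = (m + r).choose r := by
  have hs : {d : Fin (r + 1) →₀ ℕ | d.degree = m} =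
      ((Finset.univ : Finset (Fin (r + 1))).finsuppAntidiag m : Set (Fin (r + 1) →₀ ℕ)) := by
    ext d
    simp [Finset.mem_finsuppAntidiag, Finsupp.degree_eq_sum]
  have h1 : homogeneousSubmodule (Fin (r + 1)) R m =
      restrictSupport R {d : Fin (r + 1) →₀ ℕ | d.degree = m} :=
    homogeneousSubmodule_eq_finsupp_supported _ _ _
  rw [h1, Module.finrank_eq_nat_card_basis (basisRestrictSupport R _), hs,
    Nat.card_eq_card_toFinset, Finset.toFinset_coe, Finset.card_finsuppAntidiag_nat_eq_choose,
    Finset.card_univ, Fintype.card_fin, show r + 1 + m - 1 = m + r by omega,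
    Nat.choose_symm_add]

lemma map_aeval_homogeneousSubmodule {ι R A : Type*} [CommSemiring R] [CommSemiring A]
    [Algebra R A] (v : ι → A) (m : ℕ) :
    (homogeneousSubmodule ι R m).map (aeval v : MvPolynomial ι R →ₐ[R] A).toLinearMap =
      Submodule.span R (Set.range v) ^ m := by
  rw [← homogeneousSubmodule_one_pow, Submodule.map_pow, homogeneousSubmodule_one_eq_span_X,
    Submodule.map_span, ← Set.range_comp]
  congr 3
  ext i
  simp

lemma mem_span_pow_iff_aeval {ι R A : Type*} [CommSemiring R] [CommSemiring A]
    [Algebra R A] {v : ι → A} {m : ℕ} {x : A} :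
    x ∈ Submodule.span R (Set.range v) ^ m ↔
      ∃ f : MvPolynomial ι R, f.IsHomogeneous m ∧ aeval v f = x := by
  rw [← map_aeval_homogeneousSubmodule]
  rfl

lemma Submodule.finrank_map_add_finrank_inf_ker {k M N : Type*} [Field k] [AddCommGroup M]
    [Module k M] [AddCommGroup N] [Module k N] (f : M →ₗ[k] N) (p : Submodule k M)
    [FiniteDimensional k p] :
    Module.finrank k (p.map f) + Module.finrank k ↥(p ⊓ LinearMap.ker f) = Module.finrank k p := by
  rw [← LinearMap.finrank_range_add_finrank_ker (f.domRestrict p), LinearMap.range_domRestrict,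
    LinearMap.ker_domRestrict, ← Submodule.finrank_map_subtype_eq p, Submodule.map_comap_subtype]

variable {Ω : Type} [Field Ω] {K : Subfield Ω}

lemma HomogIndep.finrank_span_pow {r : ℕ} {z : Fin (r + 1) → Ω} (hz : HomogIndep K z) (m : ℕ) :
    Module.finrank K ↥(Submodule.span K (Set.range z) ^ m) = (m + r).choose r := by
  rw [← map_aeval_homogeneousSubmodule, ← finrank_homogeneousSubmodule_fin K r m]
  have hfg : FiniteDimensional K (homogeneousSubmodule (Fin (r + 1)) K m) :=
    Module.Finite.iff_fg.2 (homogeneousSubmodule_fg _ _ _)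
  rw [← Submodule.finrank_map_add_finrank_inf_ker (aeval z : MvPolynomial _ K →ₐ[K] Ω).toLinearMap,
    (Submodule.eq_bot_iff (_ ⊓ LinearMap.ker _)).2 fun f (hf : _ ∧ _) =>
      hz m f hf.1 (LinearMap.mem_ker.1 hf.2), finrank_bot, add_zero]

lemma range_eq_singleton_union {n : ℕ} {z : Fin (n + 1) → Ω} (hz0 : z 0 = 1) :
    Set.range z = {1} ∪ {x | x ∈ List.ofFn fun i : Fin n => z i.succ} := by
  ext x
  simp only [Set.mem_range, Fin.exists_fin_succ, hz0, Set.mem_union, Set.mem_singleton_iff,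
    Set.mem_ofPred_eq, List.mem_ofFn, eq_comm]

lemma exists_mem_pow_of_mem_adjoin {S : Set Ω} {Z : Submodule K Ω} (h1 : 1 ∈ Z) (hS : S ⊆ Z)
    {x : Ω} (hx : x ∈ Algebra.adjoin K S) : ∃ b, x ∈ Z ^ b := by
  have hle : 1 ≤ Z := Submodule.one_le.2 h1
  induction hx using Algebra.adjoin_induction with
  | mem x hx => exact ⟨1, by rw [pow_one]; exact hS hx⟩
  | algebraMap a => exact ⟨0, by rw [pow_zero]; exact Submodule.algebraMap_mem a⟩
  | add x y _ _ hx hy =>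
    obtain ⟨b, hb⟩ := hx
    obtain ⟨b', hb'⟩ := hy
    exact ⟨b + b', add_mem (pow_le_pow_right' hle (Nat.le_add_right _ _) hb)
      (pow_le_pow_right' hle (Nat.le_add_left _ _) hb')⟩
  | mul x y _ _ hx hy =>
    obtain ⟨b, hb⟩ := hx
    obtain ⟨b', hb'⟩ := hy
    exact ⟨b + b', by rw [pow_add]; exact Submodule.mul_mem_mul hb hb'⟩

lemma exists_mem_pow_forall_mul_mem_pow {S : Set Ω} {Z : Submodule K Ω} (h1 : 1 ∈ Z) (hS : S ⊆ Z)
    {ι : Type*} (s : Finset ι) (x : ι → Ω) (hx : ∀ i ∈ s, x i ∈ fadj K S) :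
    ∃ b, ∃ g ∈ Z ^ b, g ≠ 0 ∧ ∀ i ∈ s, g * x i ∈ Z ^ b := by
  classical
  have hle : 1 ≤ Z := Submodule.one_le.2 h1
  induction s using Finset.induction_on with
  | empty => exact ⟨0, 1, by rw [pow_zero]; exact Submodule.one_le.1 le_rfl, one_ne_zero, by simp⟩
  | insert a s ha ih =>
    obtain ⟨b, g, hg, hg0, h⟩ := ih fun i hi => hx i (Finset.mem_insert_of_mem hi)
    obtain ⟨r, hr, q, hq, hrq⟩ := (IntermediateField.mem_adjoin_iff_div).1
      (mem_fadj_iff.1 (hx a (Finset.mem_insert_self _ _)))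
    by_cases hq0 : q = 0
    · refine ⟨b, g, hg, hg0, fun i hi => ?_⟩
      rcases Finset.mem_insert.1 hi with rfl | hi
      · rw [hrq, hq0, div_zero, mul_zero]; exact zero_mem _
      · exact h i hi
    · obtain ⟨b₁, hb₁⟩ := exists_mem_pow_of_mem_adjoin h1 hS hr
      obtain ⟨b₂, hb₂⟩ := exists_mem_pow_of_mem_adjoin h1 hS hq
      have hq' : q ∈ Z ^ (b₁ + b₂) := pow_le_pow_right' hle (Nat.le_add_left _ _) hb₂
      refine ⟨b + (b₁ + b₂), g * q, ?_, mul_ne_zero hg0 hq0, fun i hi => ?_⟩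
      · rw [pow_add]; exact Submodule.mul_mem_mul hg hq'
      · rw [pow_add]
        rcases Finset.mem_insert.1 hi with rfl | hi
        · rw [hrq, mul_assoc, mul_div_cancel₀ _ hq0]
          exact Submodule.mul_mem_mul hg (pow_le_pow_right' hle (Nat.le_add_right _ _) hb₁)
        · rw [mul_right_comm]
          exact Submodule.mul_mem_mul (h i hi) hq'

lemma Submodule.finrank_mul_le_mul (M N : Submodule K Ω) [FiniteDimensional K M]
    [FiniteDimensional K N] :
    Module.finrank K ↥(M * N) ≤ Module.finrank K M * Module.finrank K N := by
  rw [← Submodule.mulMap_range, ← Module.finrank_tensorProduct]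
  exact LinearMap.finrank_range_le _

lemma Submodule.finiteDimensional_pow (M : Submodule K Ω) [FiniteDimensional K M] (m : ℕ) :
    FiniteDimensional K ↥(M ^ m) :=
  Module.Finite.iff_fg.2 (Submodule.FG.pow (Module.Finite.iff_fg.1 ‹_›) m)

lemma mem_of_mem_pow {F : Type*} [SetLike F Ω] [SubringClass F Ω] {A : F}
    {V : Submodule K Ω} (hK : ∀ a ∈ K, a ∈ A) (hV : ∀ v ∈ V, v ∈ A) (m : ℕ) :
    ∀ v ∈ V ^ m, v ∈ A := by
  intro v hv
  induction hv using Submodule.pow_induction_on_left' with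
  | algebraMap r => exact hK r r.2
  | add x y i _ _ hx hy => exact add_mem hx hy
  | mem_mul x hx i y _ hy => exact mul_mem (hV x hx) hy

lemma exists_finrank_pow_le {S : Set Ω} (F : IntermediateField (fadj K S) Ω)
    [FiniteDimensional (fadj K S) F] {Z V : Submodule K Ω} [FiniteDimensional K Z]
    [FiniteDimensional K V] (h1 : 1 ∈ Z) (hS : S ⊆ Z) (hVF : ∀ v ∈ V, v ∈ F) {m : ℕ}
    (hm : V ^ (m + 1) ≤ Z * V ^ m) :
    ∃ b, ∀ j, Module.finrank K ↥(V ^ (m + j)) ≤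
      Module.finrank K ↥(Z ^ (j + b)) * Module.finrank (fadj K S) F := by
  have hfin : ∀ i, FiniteDimensional K ↥(Z ^ i) := Z.finiteDimensional_pow
  have hfinV : ∀ i, FiniteDimensional K ↥(V ^ i) := V.finiteDimensional_pow
  have hVmF := mem_of_mem_pow (fun a ha => F.algebraMap_mem ⟨a, le_fadj _ _ ha⟩) hVF m
  let f := Module.finBasis (fadj K S) F
  let W : Submodule K Ω := Submodule.span K (Set.range fun i => (f i : Ω))
  let e := Module.finBasis K ↥(V ^ m)
  let c : Fin _ × Fin _ → Ω := fun p => (f.repr ⟨e p.1, hVmF _ (e p.1).2⟩ p.2 : fadj K S)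
  obtain ⟨b, g, hg, hg0, hgc⟩ := exists_mem_pow_forall_mul_mem_pow h1 hS Finset.univ c
    fun i _ => SetLike.coe_mem _
  have hgV : Submodule.span K {g} * V ^ m ≤ Z ^ b * W := by
    refine Submodule.mul_le.2 fun x hx y hy => ?_
    obtain ⟨a, rfl⟩ := Submodule.mem_span_singleton.1 hx
    rw [smul_mul_assoc]
    refine Submodule.smul_mem _ _ ?_
    have hy' : y = ∑ i, (e.repr ⟨y, hy⟩ i) • (e i : Ω) := by
      have := congrArg Subtype.val (e.sum_repr ⟨y, hy⟩)
      rw [AddSubmonoidClass.coe_finsetSum] at this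
      exact this.symm
    rw [hy', Finset.mul_sum]
    refine sum_mem fun i _ => ?_
    rw [mul_smul_comm]
    refine Submodule.smul_mem _ _ ?_
    have hei : (e i : Ω) = ∑ j, c (i, j) * (f j : Ω) := by
      have := congrArg Subtype.val (f.sum_repr ⟨e i, hVmF _ (e i).2⟩)
      rw [AddSubmonoidClass.coe_finsetSum] at this
      exact this.symm
    rw [hei, Finset.mul_sum]
    refine sum_mem fun j _ => ?_
    rw [← mul_assoc]
    exact Submodule.mul_mem_mul (hgc _ (Finset.mem_univ _)) (Submodule.subset_span ⟨j, rfl⟩)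
  have hZV : ∀ j, V ^ (m + j) ≤ Z ^ j * V ^ m := by
    intro j
    induction j with
    | zero => simp
    | succ j ih =>
      calc V ^ (m + (j + 1)) = V * V ^ (m + j) := by rw [← add_assoc, pow_succ']
        _ ≤ V * (Z ^ j * V ^ m) := mul_le_mul_right ih _
        _ = Z ^ j * V ^ (m + 1) := by ring
        _ ≤ Z ^ j * (Z * V ^ m) := mul_le_mul_right hm _
        _ = Z ^ (j + 1) * V ^ m := by ring
  refine ⟨b, fun j => ?_⟩
  have hle : Submodule.span K {g} * V ^ (m + j) ≤ Z ^ (j + b) * W := by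
    calc _ ≤ Submodule.span K {g} * (Z ^ j * V ^ m) := mul_le_mul_right (hZV j) _
      _ = Z ^ j * (Submodule.span K {g} * V ^ m) := by ring
      _ ≤ Z ^ j * (Z ^ b * W) := mul_le_mul_right hgV _
      _ = Z ^ (j + b) * W := by ring
  have hWfin : FiniteDimensional K W := FiniteDimensional.span_of_finite K (Set.finite_range _)
  have hW : Module.finrank K W ≤ Module.finrank (fadj K S) F := by
    have := finrank_range_le_card (R := K) fun i => (f i : Ω)
    rwa [Fintype.card_fin] at this
  have hZW : FiniteDimensional K ↥(Z ^ (j + b) * W) := Module.Finite.iff_fg.2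
    ((Module.Finite.iff_fg.1 (hfin _)).mul (Module.Finite.iff_fg.1 hWfin))
  calc Module.finrank K ↥(V ^ (m + j)) =
      Module.finrank K ((V ^ (m + j)).map (LinearMap.mulLeft K g)) :=
        (Submodule.equivMapOfInjective _ (mul_right_injective₀ hg0) _).finrank_eq
    _ ≤ Module.finrank K ↥(Z ^ (j + b) * W) := by
        refine Submodule.finrank_mono (le_trans ?_ hle)
        rintro _ ⟨x, hx, rfl⟩
        exact Submodule.mul_mem_mul (Submodule.mem_span_singleton_self g) hx
    _ ≤ _ := (Submodule.finrank_mul_le_mul _ _).trans (Nat.mul_le_mul_left _ hW)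

end HomogeneousForms

section Growth

open Filter Topology

lemma tendsto_choose_add_mul_factorial_div_pow (r s : ℕ) :
    Tendsto (fun m : ℕ => ((m + s).choose r : ℝ) * r.factorial / (m : ℝ) ^ r) atTop (𝓝 1) := by
  have h1 : Tendsto (fun m : ℕ => (m.choose r : ℝ) / ((m : ℝ) ^ r / r.factorial)) atTop (𝓝 1) :=
    (Asymptotics.isEquivalent_iff_tendsto_one (by
      filter_upwards [eventually_ge_atTop 1] with m hm
      positivity)).1 (isEquivalent_choose r)
  have h2 := h1.comp (tendsto_add_atTop_nat s)
  have h3 : Tendsto (fun m : ℕ => (1 + (s : ℝ) / m) ^ r) atTop (𝓝 1) := by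
    have := ((tendsto_const_nhds (x := (1 : ℝ))).add
      (tendsto_const_div_atTop_nhds_zero_nat (s : ℝ))).pow r
    simpa using this
  have h4 := h2.mul h3
  rw [one_mul] at h4
  refine h4.congr' ?_
  filter_upwards [eventually_ge_atTop 1] with m hm
  have : (m : ℝ) ≠ 0 := by positivity
  have : ((m : ℝ) + s) ≠ 0 := by positivity
  simp only [Function.comp_apply, Nat.cast_add]
  rw [show 1 + (s : ℝ) / m = (m + s) / m by field_simp, div_pow]
  field_simp

/-- Comparison of the order of growth and of the leading coefficient of a polynomially bounded
sequence. -/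
lemma eq_and_le_of_growth {a : ℕ → ℕ} {r n d D b m₀ : ℕ} (hlow : ∀ m, (m + r).choose r ≤ a m)
    (hupp : ∀ j, a (m₀ + j) ≤ (j + b + r).choose r * D) (hd : 0 < d)
    (hlim : Tendsto (fun m : ℕ => (a m : ℝ) * n.factorial / (m : ℝ) ^ n) atTop (𝓝 (d : ℝ))) :
    r = n ∧ d ≤ D := by
  have hL := tendsto_choose_add_mul_factorial_div_pow r r
  have hU := (tendsto_choose_add_mul_factorial_div_pow r (b + r)).mul_const (D : ℝ)
  rw [one_mul] at hU
  have hlow' : ∀ m : ℕ, ((m + r).choose r : ℝ) * r.factorial / (m : ℝ) ^ r ≤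
      (a m : ℝ) * r.factorial / (m : ℝ) ^ r := by
    intro m
    have := hlow m
    gcongr
  have hupp' : ∀ᶠ m : ℕ in atTop, (a m : ℝ) * r.factorial / (m : ℝ) ^ r ≤
      ((m + (b + r)).choose r : ℝ) * r.factorial / (m : ℝ) ^ r * D := by
    filter_upwards [eventually_ge_atTop m₀] with m hm
    have h1 := hupp (m - m₀)
    rw [Nat.add_sub_cancel' hm] at h1
    have h2 : (m - m₀ + b + r).choose r ≤ (m + (b + r)).choose r :=
      Nat.choose_le_choose r (by omega)
    have h3 : (a m : ℝ) ≤ ((m + (b + r)).choose r : ℝ) * D := by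
      exact_mod_cast h1.trans (Nat.mul_le_mul_right D h2)
    calc _ ≤ (((m + (b + r)).choose r : ℝ) * D) * r.factorial / (m : ℝ) ^ r := by gcongr
      _ = _ := by ring
  have hdpos : (0 : ℝ) < d := by exact_mod_cast hd
  have hrn : r = n := by
    rcases lt_trichotomy r n with h | h | h
    · exfalso
      obtain ⟨e, he, rfl⟩ : ∃ e, e ≠ 0 ∧ n = r + e := ⟨n - r, by omega, by omega⟩
      have hz : Tendsto (fun m : ℕ => ((m + (b + r)).choose r : ℝ) * r.factorial / (m : ℝ) ^ r * D *
          (((r + e).factorial / r.factorial : ℝ) * ((m : ℝ) ^ e)⁻¹)) atTop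
          (𝓝 ((D : ℝ) * (((r + e).factorial / r.factorial : ℝ) * 0))) := by
        refine hU.mul (Tendsto.const_mul _ ?_)
        exact tendsto_inv_atTop_zero.comp ((tendsto_pow_atTop he).comp tendsto_natCast_atTop_atTop)
      have := le_of_tendsto_of_tendsto hlim hz (by
        filter_upwards [hupp', eventually_ge_atTop 1] with m hm hm1
        have h0 : (m : ℝ) ≠ 0 := by positivity
        calc (a m : ℝ) * (r + e).factorial / (m : ℝ) ^ (r + e) =
            (a m : ℝ) * r.factorial / (m : ℝ) ^ r *
              (((r + e).factorial / r.factorial : ℝ) * ((m : ℝ) ^ e)⁻¹) := by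
                rw [pow_add]; field_simp
          _ ≤ _ := by gcongr)
      simp only [mul_zero] at this
      linarith
    · exact h
    · exfalso
      obtain ⟨e, he, rfl⟩ : ∃ e, e ≠ 0 ∧ r = n + e := ⟨r - n, by omega, by omega⟩
      have hz : Tendsto (fun m : ℕ => ((a m : ℝ) * n.factorial / (m : ℝ) ^ n *
          ((n + e).factorial / n.factorial : ℝ)) * ((m : ℝ) ^ e)⁻¹) atTop
          (𝓝 (((d : ℝ) * ((n + e).factorial / n.factorial : ℝ)) * 0)) := by
        refine (hlim.mul_const _).mul ?_
        exact tendsto_inv_atTop_zero.comp ((tendsto_pow_atTop he).comp tendsto_natCast_atTop_atTop)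
      have := le_of_tendsto_of_tendsto hL hz (by
        filter_upwards [eventually_ge_atTop 1] with m hm1
        have h0 : (m : ℝ) ≠ 0 := by positivity
        refine (hlow' m).trans (le_of_eq ?_)
        rw [pow_add]
        field_simp)
      simp only [mul_zero] at this
      linarith
  subst hrn
  refine ⟨rfl, ?_⟩
  exact_mod_cast le_of_tendsto_of_tendsto hlim hU hupp'

end Growth

section GeneralDivisor

variable {Ω : Type} [Field Ω] [CharZero Ω] {K : Subfield Ω}

/-- If `V` is spanned by the homogeneous coordinates of a nondegenerate projective variety and
`V ^ 2` has the dimension forced by having three quadrics less than the maximal number, then for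
the generic element `g` of `V`, every element of `V ^ 2` with a power divisible by `g` is divisible
by `g`. -/
theorem exists_forall_mem_of_pow_eq_mul (hK : AclClosed K) {n c d : ℕ} (hn : 2 ≤ n) (hc : 2 ≤ c)
    (hd : c + 3 ≤ d) {κ : Type*} [Fintype κ] {v : κ → Ω} {r : ℕ} {z : Fin (r + 1) → Ω}
    (hz : HomogIndep K z) (hz0 : z 0 = 1) (hzv : ∀ i, z i ∈ Submodule.span K (Set.range v))
    {m₀ : ℕ} (hm₀ : Submodule.span K (Set.range v) ^ (m₀ + 1) ≤
      Submodule.span K (Set.range z) * Submodule.span K (Set.range v) ^ m₀)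
    (hV : Module.finrank K (Submodule.span K (Set.range v)) = n + c + 1)
    (hV2 : Module.finrank K ↥(Submodule.span K (Set.range v) ^ 2) =
      (n + 2).choose 2 + c * (n + 1) + 3)
    (hlim : Filter.Tendsto (fun m : ℕ =>
      (Module.finrank K ↥(Submodule.span K (Set.range v) ^ m) : ℝ) * n.factorial / (m : ℝ) ^ n)
      Filter.atTop (nhds (d : ℝ))) :
    ∃ P : MvPolynomial κ K, P ≠ 0 ∧ ∀ w, eval w P ≠ 0 → ∑ j, w j • v j ≠ 0 →
      ∀ (m : ℕ) (q y : Ω), m ≠ 0 → q ∈ Submodule.span K (Set.range v) ^ 2 →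
      y ∈ Submodule.span K (Set.range v) ^ (2 * m - 1) → q ^ m = (∑ j, w j • v j) * y →
      ∃ τ ∈ Submodule.span K (Set.range v), (∑ j, w j • v j) * τ = q := by
  obtain ⟨V, hVdef⟩ : ∃ V, V = Submodule.span K (Set.range v) := ⟨_, rfl⟩
  obtain ⟨l, hl⟩ : ∃ l, l = List.ofFn fun i : Fin r => z i.succ := ⟨_, rfl⟩
  have hZ : Submodule.span K (Set.range z) = Submodule.span K ({1} ∪ {x | x ∈ l} : Set Ω) := by
    rw [range_eq_singleton_union hz0, hl]
  have hAI : AInd K l := hl ▸ hz.aInd hz0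
  have hVfin : FiniteDimensional K V :=
    hVdef ▸ FiniteDimensional.span_of_finite K (Set.finite_range _)
  have hZfin : FiniteDimensional K (Submodule.span K (Set.range z)) :=
    FiniteDimensional.span_of_finite K (Set.finite_range _)
  have h1 : (1 : Ω) ∈ V := by rw [hVdef, ← hz0]; exact hzv 0
  have hlV : ∀ x ∈ l, x ∈ V := by
    intro x hx
    rw [hl, List.mem_ofFn] at hx
    obtain ⟨i, rfl⟩ := hx
    rw [hVdef]
    exact hzv _
  have hdomZ : ∀ x ∈ Submodule.span K (Set.range z), Dom K l x := by
    intro x hx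
    rw [hZ] at hx
    induction hx using Submodule.span_induction with
    | mem x hx =>
      rcases hx with rfl | hx
      · exact Dom.of_mem (one_mem K)
      · exact Dom.of_mem_list hx
    | zero => exact Dom.of_mem (zero_mem K)
    | add x y _ _ hx hy => exact hx.add hy
    | smul a x _ hx => exact hx.smul a.2
  rw [← hVdef] at hm₀ hV hV2 hlim
  have hdom : ∀ x ∈ V, Dom K l x := dom_of_pow_le_mul_pow h1 hdomZ hm₀
  let F := IntermediateField.adjoin (fadj K {x | x ∈ l}) (V : Set Ω)
  have hVF : ∀ x ∈ V, x ∈ F := fun x hx => IntermediateField.subset_adjoin _ _ hx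
  have hFfin : FiniteDimensional (fadj K {x | x ∈ l}) F := by
    have h2 : F = IntermediateField.adjoin (fadj K {x | x ∈ l}) (Set.range v) := by
      refine le_antisymm (IntermediateField.adjoin_le_iff.2 fun x (hx : x ∈ V) => ?_)
        (IntermediateField.adjoin.mono _ _ _ ?_)
      · rw [hVdef] at hx
        induction hx using Submodule.span_induction with
        | mem x hx => exact IntermediateField.subset_adjoin _ _ hx
        | zero => exact zero_mem _
        | add x y _ _ hx hy => exact add_mem hx hy
        | smul a x _ hx =>
          exact mul_mem (IntermediateField.algebraMap_mem _
            (⟨a, le_fadj _ _ a.2⟩ : fadj K {x | x ∈ l})) hx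
      · rw [hVdef]; exact Submodule.subset_span
    rw [h2]
    refine IntermediateField.finiteDimensional_adjoin ?_
    rintro _ ⟨j, rfl⟩
    exact ((hdom _ (hVdef ▸ Submodule.subset_span ⟨j, rfl⟩)).reg.isAlgebraic hK).isIntegral
  obtain ⟨b, hb⟩ := exists_finrank_pow_le (S := {x | x ∈ l}) F
    (Z := Submodule.span K (Set.range z)) (hZ ▸ Submodule.subset_span (Or.inl rfl))
    (fun x hx => hZ ▸ Submodule.subset_span (Or.inr hx)) hVF hm₀
  have hrd := eq_and_le_of_growth (a := fun m => Module.finrank K ↥(V ^ m)) (r := r)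
    (n := n) (d := d)
    (D := Module.finrank (fadj K {x | x ∈ l}) F) (b := b) (m₀ := m₀)
    (fun m => by
      have := V.finiteDimensional_pow m
      rw [← hz.finrank_span_pow m]
      refine Submodule.finrank_mono (pow_le_pow_left' (Submodule.span_le.2 ?_) m)
      rintro _ ⟨i, rfl⟩
      exact hVdef ▸ hzv i)
    (fun j => by rw [← hz.finrank_span_pow]; exact hb j) (by omega) hlim
  obtain ⟨rfl, hdD⟩ := hrd
  obtain ⟨h, hhV, hh⟩ := exists_mem_of_mul_mem hK hAI h1 hlV hdom hn hc hV
    (by rw [← hZ, ← pow_one (Submodule.span K (Set.range z)), hz.finrank_span_pow,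
      add_comm, Nat.choose_succ_self_right])
    (by rw [← hZ, ← pow_two, hz.finrank_span_pow, add_comm 2 r, Nat.choose_symm_add])
    (by rw [← pow_two, hV2]) (hd.trans hdD)
  obtain ⟨P₁, hP₁, hP₁'⟩ := exists_ne_zero_mem_of_mul_mem hK hAI h1 hlV hdom F hVF hVdef hhV
    fun t _ => hh t
  obtain ⟨P₂, hP₂, hP₂'⟩ := exists_forall_dom_of_pow_eq_mul hz hz0
    (fun j => hl ▸ hdom (v j) (hVdef ▸ Submodule.subset_span ⟨j, rfl⟩)) hzv
  refine ⟨P₁ * P₂, mul_ne_zero hP₁ hP₂, fun w hw hg m q y hm hq hy hqy => ?_⟩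
  rw [map_mul] at hw
  have hgq : (∑ j, w j • v j) * (q / ∑ j, w j • v j) = q := mul_div_cancel₀ _ hg
  have hgV : ∑ j, w j • v j ∈ V := by
    rw [hVdef]
    exact sum_mem fun j _ => Submodule.smul_mem _ _ (Submodule.subset_span ⟨j, rfl⟩)
  refine ⟨q / ∑ j, w j • v j, ?_, hgq⟩
  rw [← hVdef] at hq ⊢
  refine hP₁' w (left_ne_zero_of_mul hw) _ (div_mem ?_ (hVF _ hgV)) ?_ ?_
  · exact mem_of_mem_pow (fun a ha => F.algebraMap_mem ⟨a, le_fadj _ _ ha⟩) hVF 2 q hq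
  · rw [hl]
    exact hP₂' w (right_ne_zero_of_mul hw) hg m q y _ hm (hVdef ▸ hq) hy hqy hgq
  · rwa [hgq, ← pow_two]

end GeneralDivisor

section HomogeneousCoordinates

variable {Ω : Type} [Field Ω] {K : Subfield Ω}

lemma mem_span_range_pow_iff_div {κ : Type*} {x : κ → Ω} {s : Ω} (hs : s ≠ 0) {m : ℕ} {u : Ω} :
    u ∈ Submodule.span K (Set.range x) ^ m ↔
      u / s ^ m ∈ Submodule.span K (Set.range fun i => x i / s) ^ m := by
  have hsm : s ^ m ≠ 0 := pow_ne_zero _ hs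
  simp only [mem_span_pow_iff_aeval]
  refine exists_congr fun f => and_congr_right fun hf => ?_
  rw [← aeval_div_mul_pow x hs hf, eq_div_iff hsm]

lemma finrank_span_range_div_pow {κ : Type*} (x : κ → Ω) {s : Ω} (hs : s ≠ 0) (m : ℕ) :
    Module.finrank K ↥(Submodule.span K (Set.range fun i => x i / s) ^ m) =
      Module.finrank K ↥(Submodule.span K (Set.range x) ^ m) := by
  have hsm : s ^ m ≠ 0 := pow_ne_zero _ hs
  have h : (Submodule.span K (Set.range fun i => x i / s) ^ m).map (LinearMap.mulLeft K (s ^ m)) =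
      Submodule.span K (Set.range x) ^ m := by
    ext u
    rw [mem_span_range_pow_iff_div hs]
    constructor
    · rintro ⟨t, ht, rfl⟩
      rwa [LinearMap.mulLeft_apply, mul_div_cancel_left₀ _ hsm]
    · exact fun hu => ⟨_, hu, mul_div_cancel₀ _ hsm⟩
  rw [← h]
  exact (Submodule.equivMapOfInjective _ (mul_right_injective₀ hsm) _).finrank_eq

/-- A version of `exists_forall_mem_of_pow_eq_mul` without any normalization of coordinates. -/
theorem exists_forall_mem_span_of_pow_eq_mul [CharZero Ω] (hK : AclClosed K) [Infinite K]
    {n c d : ℕ} (hn : 2 ≤ n) (hc : 2 ≤ c) (hd : c + 3 ≤ d) {κ : Type*} [Fintype κ] {x : κ → Ω}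
    (hV : Module.finrank K (Submodule.span K (Set.range x)) = n + c + 1)
    (hV2 : Module.finrank K ↥(Submodule.span K (Set.range x) ^ 2) =
      (n + 2).choose 2 + c * (n + 1) + 3)
    (hlim : Filter.Tendsto (fun m : ℕ =>
      (Module.finrank K ↥(Submodule.span K (Set.range x) ^ m) : ℝ) * n.factorial / (m : ℝ) ^ n)
      Filter.atTop (nhds (d : ℝ))) :
    ∃ P : MvPolynomial κ K, P ≠ 0 ∧ ∀ w, eval w P ≠ 0 → ∑ j, w j • x j ≠ 0 →
      ∀ (m : ℕ) (q y : Ω), m ≠ 0 → q ∈ Submodule.span K (Set.range x) ^ 2 →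
      y ∈ Submodule.span K (Set.range x) ^ (2 * m - 1) → q ^ m = (∑ j, w j • x j) * y →
      ∃ τ ∈ Submodule.span K (Set.range x), (∑ j, w j • x j) * τ = q := by
  have hfin : FiniteDimensional K (Submodule.span K (Set.range x)) :=
    FiniteDimensional.span_of_finite K (Set.finite_range _)
  obtain ⟨r, y, hy, hyx, m₀, hm₀⟩ := exists_homogIndep (Submodule.span K (Set.range x)) (by
    intro h
    rw [h, finrank_bot] at hV
    omega)
  obtain ⟨s, hs⟩ : ∃ s, s = y 0 := ⟨_, rfl⟩
  have hs0 : s ≠ 0 := hs ▸ hy.ne_zero 0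
  obtain ⟨P, hP, hP'⟩ := exists_forall_mem_of_pow_eq_mul hK hn hc hd (v := fun j => x j / s)
    (hy.div hs0) (by rw [← hs, div_self hs0]) (fun i => by
      rw [← pow_one (Submodule.span K _)]
      rw [← pow_one (Submodule.span K _)] at hyx
      have := (mem_span_range_pow_iff_div hs0).1 (hyx i)
      rwa [pow_one s] at this) (m₀ := m₀) (by
      rw [span_range_div, span_range_div, mul_pow, mul_pow, pow_succ (Submodule.span K {s⁻¹}),
        mul_mul_mul_comm, mul_comm (Submodule.span K {s⁻¹})]
      exact mul_le_mul_right hm₀ _) (by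
      rw [← hV, ← pow_one (Submodule.span K _), finrank_span_range_div_pow x hs0, pow_one])
      (by rw [finrank_span_range_div_pow x hs0, hV2])
      (by simpa only [finrank_span_range_div_pow x hs0] using hlim)
  have hsum : ∀ w : κ → K, ∑ j, w j • (x j / s) = (∑ j, w j • x j) / s := fun w => by
    rw [Finset.sum_div]
    exact Finset.sum_congr rfl fun j _ => (smul_div_assoc _ _ _).symm
  refine ⟨P, hP, fun w hw hg m q u hm hq hu hqu => ?_⟩
  have := hP' w hw (by rw [hsum]; exact div_ne_zero hg hs0) m _ _ hm
    ((mem_span_range_pow_iff_div hs0).1 hq) ((mem_span_range_pow_iff_div hs0).1 hu) (by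
      rw [hsum, div_pow, ← pow_mul, hqu, div_mul_div_comm, ← pow_succ',
        show 2 * m - 1 + 1 = 2 * m by omega])
  obtain ⟨τ, hτ, hτq⟩ := this
  refine ⟨s * τ, ?_, ?_⟩
  · rw [← pow_one (Submodule.span K _), mem_span_range_pow_iff_div hs0, pow_one, pow_one,
      mul_div_cancel_left₀ _ hs0]
    exact hτ
  · rw [hsum, eq_div_iff (pow_ne_zero _ hs0)] at hτq
    rw [← hτq]
    field_simp

end HomogeneousCoordinates

section BaseField

variable {k Ω : Type} [Field k] [Field Ω] [Algebra k Ω]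

lemma aclClosed_fieldRange [CharZero Ω] [IsAlgClosed k] :
    AclClosed (algebraMap k Ω).fieldRange := by
  refine le_antisymm (fun t ht => ?_) (subset_acl _)
  have hK : IsAlgClosed (algebraMap k Ω).fieldRange :=
    IsAlgClosed.of_ringEquiv k _ (algebraMap k Ω).rangeRestrictFieldEquiv
  have h1 : IsIntegral (algebraMap k Ω).fieldRange t := (mem_acl_coe.1 ht).isIntegral
  obtain ⟨a, rfl⟩ := minpoly.mem_range_of_degree_eq_one _ _
    (IsAlgClosed.degree_eq_one_of_irreducible _ (minpoly.irreducible h1))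
  exact a.2

/-- The field `k` and its image in `Ω` give the same powers of spans. -/
lemma mem_span_fieldRange_pow_iff {κ : Type*} {x : κ → Ω} {m : ℕ} {u : Ω} :
    u ∈ Submodule.span (algebraMap k Ω).fieldRange (Set.range x) ^ m ↔
      u ∈ Submodule.span k (Set.range x) ^ m := by
  simp only [mem_span_pow_iff_aeval]
  let e := (algebraMap k Ω).rangeRestrictField
  have he : ∀ f : MvPolynomial κ k, aeval x (map e f) = aeval x f := fun f => by
    rw [aeval_def, aeval_def, eval₂_map]
    rfl
  constructor
  · rintro ⟨f, hf, rfl⟩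
    obtain ⟨g, rfl⟩ := map_surjective _ (algebraMap k Ω).rangeRestrictField_bijective.2 f
    refine ⟨g, fun d hd => hf ?_, (he g).symm⟩
    rw [coeff_map]
    exact fun h => hd ((algebraMap k Ω).rangeRestrictField_bijective.1 (h.trans (map_zero _).symm))
  · rintro ⟨f, hf, rfl⟩
    exact ⟨map e f, hf.map e, he f⟩

lemma finrank_span_fieldRange_pow {κ : Type*} (x : κ → Ω) (m : ℕ) :
    Module.finrank (algebraMap k Ω).fieldRange
        ↥(Submodule.span (algebraMap k Ω).fieldRange (Set.range x) ^ m) =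
      Module.finrank k ↥(Submodule.span k (Set.range x) ^ m) := by
  let j : ↥(Submodule.span k (Set.range x) ^ m) ≃+
      ↥(Submodule.span (algebraMap k Ω).fieldRange (Set.range x) ^ m) :=
    { toFun := fun u => ⟨u, mem_span_fieldRange_pow_iff.2 u.2⟩
      invFun := fun u => ⟨u, mem_span_fieldRange_pow_iff.1 u.2⟩
      left_inv := fun _ => rfl
      right_inv := fun _ => rfl
      map_add' := fun _ _ => rfl }
  rw [Module.finrank, Module.finrank, rank_eq_of_equiv_equiv (algebraMap k Ω).rangeRestrictField j
    (algebraMap k Ω).rangeRestrictField_bijective]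
  intro r u
  ext
  exact Algebra.smul_def r (u : Ω)

/-- A version of `exists_forall_mem_span_of_pow_eq_mul` over an arbitrary field of constants. -/
theorem exists_forall_mem_span_of_pow_eq_mul_of_isAlgClosed [CharZero Ω] [IsAlgClosed k]
    {n c d : ℕ} (hn : 2 ≤ n) (hc : 2 ≤ c) (hd : c + 3 ≤ d) {κ : Type*} [Fintype κ] {x : κ → Ω}
    (hV : Module.finrank k (Submodule.span k (Set.range x)) = n + c + 1)
    (hV2 : Module.finrank k ↥(Submodule.span k (Set.range x) ^ 2) =
      (n + 2).choose 2 + c * (n + 1) + 3)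
    (hlim : Filter.Tendsto (fun m : ℕ =>
      (Module.finrank k ↥(Submodule.span k (Set.range x) ^ m) : ℝ) * n.factorial / (m : ℝ) ^ n)
      Filter.atTop (nhds (d : ℝ))) :
    ∃ P : MvPolynomial κ k, P ≠ 0 ∧ ∀ w, eval w P ≠ 0 → ∑ j, w j • x j ≠ 0 →
      ∀ (m : ℕ) (q y : Ω), m ≠ 0 → q ∈ Submodule.span k (Set.range x) ^ 2 →
      y ∈ Submodule.span k (Set.range x) ^ (2 * m - 1) → q ^ m = (∑ j, w j • x j) * y →
      ∃ τ ∈ Submodule.span k (Set.range x), (∑ j, w j • x j) * τ = q := by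
  let e := (algebraMap k Ω).rangeRestrictField
  have hinf : Infinite (algebraMap k Ω).fieldRange :=
    Infinite.of_injective e (algebraMap k Ω).rangeRestrictField_bijective.1
  obtain ⟨P, hP, hP'⟩ := exists_forall_mem_span_of_pow_eq_mul (aclClosed_fieldRange (k := k)) hn hc
    hd (x := x)
    (by rw [← hV, ← pow_one (Submodule.span k _), ← finrank_span_fieldRange_pow, pow_one])
    (by rw [finrank_span_fieldRange_pow, hV2])
    (by simpa only [finrank_span_fieldRange_pow] using hlim)
  obtain ⟨P, rfl⟩ := map_surjective _ (algebraMap k Ω).rangeRestrictField_bijective.2 P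
  refine ⟨P, fun h => hP (by rw [h, map_zero]), fun w hw hg m q y hm hq hy hqy => ?_⟩
  have hsum : ∑ j, e (w j) • x j = ∑ j, w j • x j := Finset.sum_congr rfl fun j _ => by
    rw [Algebra.smul_def (w j)]; rfl
  obtain ⟨τ, hτ, hτq⟩ := hP' (fun j => e (w j)) (by
    rw [eval_map]
    exact fun h => hw (e.injective ((eval₂_comp e w P).trans (h.trans (map_zero _).symm))))
    (hsum ▸ hg) m q y hm
    (mem_span_fieldRange_pow_iff.2 hq) (mem_span_fieldRange_pow_iff.2 hy) (by rw [hsum, hqy])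
  refine ⟨τ, ?_, by rw [← hsum, hτq]⟩
  rw [← pow_one (Submodule.span k _)]
  rw [← pow_one (Submodule.span _ _)] at hτ
  exact mem_span_fieldRange_pow_iff.1 hτ

end BaseField

section HomogeneousComponents

variable {R ι : Type*} [CommRing R]

theorem homogeneousComponent_succ_mul {h : MvPolynomial ι R} (hh : h.IsHomogeneous 1)
    (m : ℕ) (s : MvPolynomial ι R) :
    homogeneousComponent (m + 1) (h * s) = h * homogeneousComponent m s := by
  conv_lhs => rw [← sum_homogeneousComponent s, Finset.mul_sum, map_sum]
  have key : ∀ j, homogeneousComponent (m + 1) (h * homogeneousComponent j s) =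
      if j = m then h * homogeneousComponent m s else 0 := by
    intro j
    have hj : (h * homogeneousComponent j s) ∈ homogeneousSubmodule ι R (1 + j) :=
      hh.mul (homogeneousComponent_isHomogeneous j s)
    rw [homogeneousComponent_of_mem hj]
    by_cases hjm : j = m
    · subst hjm; rw [if_pos (by omega), if_pos rfl]
    · rw [if_neg (by omega), if_neg hjm]
  simp only [key, Finset.sum_ite_eq', Finset.mem_range]
  split_ifs with hm
  · rfl
  · rw [homogeneousComponent_eq_zero m s (by omega), mul_zero]

theorem eval_smul_eq_sum_homogeneousComponent (f : MvPolynomial ι R) (t : R) (x : ι → R) :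
    eval (t • x) f =
      ∑ m ∈ Finset.range (f.totalDegree + 1), eval x (homogeneousComponent m f) * t ^ m := by
  conv_lhs => rw [← sum_homogeneousComponent f, map_sum]
  refine Finset.sum_congr rfl fun m _ => ?_
  have hm := homogeneousComponent_isHomogeneous m f
  rw [eval_eq, eval_eq, Finset.sum_mul]
  refine Finset.sum_congr rfl fun e he => ?_
  have hdeg : e.degree = m := by
    by_contra hne
    exact (mem_support_iff.1 he) (hm.coeff_eq_zero hne)
  have hprod : ∏ i ∈ e.support, t ^ e i = t ^ m := by
    rw [Finset.prod_pow_eq_pow_sum, ← hdeg]; rfl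
  simp only [Pi.smul_apply, smul_eq_mul, mul_pow, Finset.prod_mul_distrib, hprod]
  ring

end HomogeneousComponents

section GenericPoint

theorem exists_generic_point {k ι : Type} [Field k] (I : Ideal (MvPolynomial ι k))
    (hI : I.IsPrime) : ∃ (Ω : Type) (_ : Field Ω) (_ : Algebra k Ω) (x : ι → Ω),
      ∀ f : MvPolynomial ι k, aeval x f = 0 ↔ f ∈ I := by
  have := hI
  let A := MvPolynomial ι k ⧸ I
  let φ : MvPolynomial ι k →ₐ[k] FractionRing A :=
    (IsScalarTower.toAlgHom k A (FractionRing A)).comp (Ideal.Quotient.mkₐ k I)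
  refine ⟨FractionRing A, inferInstance, inferInstance, fun i => φ (X i), fun f => ?_⟩
  have : aeval (fun i => φ (X i)) f = φ f := by
    rw [← comp_aeval_apply, aeval_X_left_apply]
  rw [this]
  change algebraMap A (FractionRing A) (Ideal.Quotient.mk I f) = 0 ↔ _
  rw [map_eq_zero_iff _ (IsFractionRing.injective A (FractionRing A)),
    Ideal.Quotient.eq_zero_iff_mem]

end GenericPoint

section Cone

variable {k ι : Type} [Field k] {C : Set (ι → k)}

theorem mem_vanIdeal {f : MvPolynomial ι k} :
    f ∈ vanIdeal k ι C ↔ ∀ x ∈ C, eval x f = 0 := by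
  simp [vanIdeal, Submodule.mem_iInf, RingHom.mem_ker]

theorem homogeneousComponent_mem_vanIdeal [Infinite k]
    (hC : ∀ x ∈ C, ∀ t : k, t • x ∈ C) {f : MvPolynomial ι k} (hf : f ∈ vanIdeal k ι C) (m : ℕ) :
    homogeneousComponent m f ∈ vanIdeal k ι C := by
  rw [mem_vanIdeal] at hf ⊢
  intro x hx
  rcases lt_or_ge f.totalDegree m with hm | hm
  · rw [homogeneousComponent_eq_zero m f hm, map_zero]
  let p : Polynomial k := ∑ j ∈ Finset.range (f.totalDegree + 1),
    Polynomial.C (eval x (homogeneousComponent j f)) * Polynomial.X ^ j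
  have hp : p = 0 := by
    refine Polynomial.funext fun t => ?_
    have := hf _ (hC x hx t)
    rw [eval_smul_eq_sum_homogeneousComponent] at this
    simpa [p, Polynomial.eval_finsetSum] using this
  have hcoeff : p.coeff m = eval x (homogeneousComponent m f) := by
    simp only [p, Polynomial.finsetSum_coeff, Polynomial.coeff_C_mul_X_pow, Finset.sum_ite_eq,
      Finset.mem_range]
    rw [if_pos (by omega)]
  rw [← hcoeff, hp, Polynomial.coeff_zero]

/-- For a homogeneous prime ideal with generic point `x`, degree-`m` forms modulo the ideal are
the `m`-th power of the span of the coordinates. -/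
theorem finrank_span_pow_add_finrank_idealPiece [Fintype ι] {Ω : Type} [Field Ω] [Algebra k Ω]
    {x : ι → Ω} {I : Ideal (MvPolynomial ι k)} (hx : ∀ f : MvPolynomial ι k, aeval x f = 0 ↔ f ∈ I) (m : ℕ) :
    Module.finrank k ↥(Submodule.span k (Set.range x) ^ m) + Module.finrank k (idealPiece k ι I m) =
      Module.finrank k (homogeneousSubmodule ι k m) := by
  have : FiniteDimensional k (homogeneousSubmodule ι k m) :=
    Module.Finite.iff_fg.2 (homogeneousSubmodule_fg _ _ _)
  have h := Submodule.finrank_map_add_finrank_inf_ker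
    (aeval x : MvPolynomial ι k →ₐ[k] Ω).toLinearMap (homogeneousSubmodule ι k m)
  rw [map_aeval_homogeneousSubmodule] at h
  have hk : homogeneousSubmodule ι k m ⊓
      LinearMap.ker (aeval x : MvPolynomial ι k →ₐ[k] Ω).toLinearMap = idealPiece k ι I m := by
    ext f
    simp [idealPiece, hx, and_comm]
  rw [hk] at h
  exact h

end Cone

theorem choose_two_add_eq (n c : ℕ) :
    (2 + (n + c)).choose 2 = (n + 2).choose 2 + c * (n + 1) + (c + 1).choose 2 := by
  qify
  simp only [Nat.cast_choose_two]
  push_cast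
  ring

section HyperplaneSection

variable {k ι : Type} [Field k] [Fintype ι] {C : Set (ι → k)}

/-- The linear form with coefficient vector `w`. -/
def linearForm (w : ι → k) : MvPolynomial ι k := ∑ i, MvPolynomial.C (w i) * X i

theorem linearForm_isHomogeneous (w : ι → k) : (linearForm w).IsHomogeneous 1 :=
  IsHomogeneous.sum _ _ _ fun i _ => isHomogeneous_C_mul_X (w i) i

theorem eval_linearForm (w x : ι → k) : eval x (linearForm w) = ∑ i, w i * x i := by
  simp [linearForm]

theorem aeval_linearForm {Ω : Type} [Field Ω] [Algebra k Ω] (w : ι → k) (x : ι → Ω) :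
    aeval x (linearForm w) = ∑ i, w i • x i := by
  simp [linearForm, Algebra.smul_def]

theorem exists_aeval_pow_eq_mul [IsAlgClosed k] (hV : IsProjVariety k ι C) {Ω : Type} [Field Ω]
    [Algebra k Ω] {x : ι → Ω} (hx : ∀ f : MvPolynomial ι k, aeval x f = 0 ↔ f ∈ vanIdeal k ι C)
    (w : ι → k) {q : MvPolynomial ι k}
    (hq : q ∈ quadrics k ι (C ∩ {x | ∑ i, w i * x i = 0})) :
    ∃ m : ℕ, m ≠ 0 ∧ ∃ y ∈ Submodule.span k (Set.range x) ^ (2 * m - 1),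
      aeval x q ^ m = (∑ i, w i • x i) * y := by
  obtain ⟨hqI, hq2⟩ := hq
  have hqI' : q ∈ vanIdeal k ι (C ∩ {x | ∑ i, w i * x i = 0}) := hqI
  have hq2' : q.IsHomogeneous 2 := hq2
  rw [mem_vanIdeal] at hqI'
  have hrad : q ∈ (vanIdeal k ι C ⊔ Ideal.span {linearForm w}).radical := by
    rw [← vanishingIdeal_zeroLocus_eq_radical (K := k), mem_vanishingIdeal_iff]
    intro z hz
    rw [mem_zeroLocus_iff] at hz
    have hzq : eval z q = 0 := by
      refine hqI' z ⟨?_, ?_⟩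
      · rw [hV.closed]
        intro f hf
        simpa [aeval_eq_eval] using hz f (Ideal.mem_sup_left hf)
      · have := hz (linearForm w) (Ideal.mem_sup_right (Ideal.mem_span_singleton_self _))
        simpa [aeval_eq_eval, eval_linearForm] using this
    simpa [aeval_eq_eval] using hzq
  obtain ⟨M, hM⟩ := hrad
  have hM1 : q ^ (M + 1) ∈ vanIdeal k ι C ⊔ Ideal.span {linearForm w} := by
    rw [pow_succ]; exact Ideal.mul_mem_right _ _ hM
  obtain ⟨a, ha, b, hb, hab⟩ := Submodule.mem_sup.1 hM1
  obtain ⟨s, rfl⟩ := Ideal.mem_span_singleton.1 hb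
  have hinf : Infinite k := IsAlgClosed.instInfinite
  have hcomp := congrArg (homogeneousComponent (2 * M + 1 + 1)) hab
  rw [map_add, homogeneousComponent_succ_mul (linearForm_isHomogeneous w),
    homogeneousComponent_eq_self (p := q ^ (M + 1)) (n := 2 * M + 1 + 1)
      (hq2'.pow (M + 1))] at hcomp
  refine ⟨M + 1, M.succ_ne_zero, aeval x (homogeneousComponent (2 * M + 1) s), ?_, ?_⟩
  · exact mem_span_pow_iff_aeval.2 ⟨_, homogeneousComponent_isHomogeneous _ _, rfl⟩
  · rw [← map_pow, ← hcomp, map_add, map_mul, aeval_linearForm,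
      (hx _).2 (homogeneousComponent_mem_vanIdeal hV.smul_mem ha _), zero_add]

theorem map_aeval_quadrics_inter {Ω : Type} [Field Ω] [Algebra k Ω] {x : ι → Ω}
    (w : ι → k)
    (hdiv : ∀ q ∈ quadrics k ι (C ∩ {x | ∑ i, w i * x i = 0}),
      ∃ τ ∈ Submodule.span k (Set.range x), (∑ i, w i • x i) * τ = aeval x q) :
    (quadrics k ι (C ∩ {x | ∑ i, w i * x i = 0})).map
        (aeval x : MvPolynomial ι k →ₐ[k] Ω).toLinearMap =
      (Submodule.span k (Set.range x)).map (LinearMap.mulLeft k (∑ i, w i • x i)) := by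
  refine le_antisymm ?_ ?_
  · rintro _ ⟨q, hq, rfl⟩
    obtain ⟨τ, hτ, h⟩ := hdiv q hq
    exact ⟨τ, hτ, h⟩
  · rintro _ ⟨τ, hτ, rfl⟩
    rw [SetLike.mem_coe, ← pow_one (Submodule.span k (Set.range x)), mem_span_pow_iff_aeval] at hτ
    obtain ⟨l, hl, rfl⟩ := hτ
    refine ⟨linearForm w * l, ⟨?_, (linearForm_isHomogeneous w).mul hl⟩, ?_⟩
    · change linearForm w * l ∈ vanIdeal k ι _
      rw [mem_vanIdeal]
      rintro z ⟨-, hz⟩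
      rw [map_mul, eval_linearForm, hz, zero_mul]
    · simp [aeval_linearForm]

theorem a2_inter_eq_add_finrank_span {Ω : Type} [Field Ω] [Algebra k Ω]
    {x : ι → Ω} (hx : ∀ f : MvPolynomial ι k, aeval x f = 0 ↔ f ∈ vanIdeal k ι C)
    (w : ι → k) (hw : ∑ i, w i • x i ≠ 0)
    (hdiv : ∀ q ∈ quadrics k ι (C ∩ {x | ∑ i, w i * x i = 0}),
      ∃ τ ∈ Submodule.span k (Set.range x), (∑ i, w i • x i) * τ = aeval x q) :
    a2 k ι (C ∩ {x | ∑ i, w i * x i = 0}) =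
      a2 k ι C + Module.finrank k (Submodule.span k (Set.range x)) := by
  have : FiniteDimensional k (homogeneousSubmodule ι k 2) :=
    Module.Finite.iff_fg.2 (homogeneousSubmodule_fg _ _ _)
  have hfin : FiniteDimensional k (quadrics k ι (C ∩ {x | ∑ i, w i * x i = 0})) :=
    Submodule.finiteDimensional_of_le inf_le_right
  have h := Submodule.finrank_map_add_finrank_inf_ker
    (aeval x : MvPolynomial ι k →ₐ[k] Ω).toLinearMap
    (quadrics k ι (C ∩ {x | ∑ i, w i * x i = 0}))
  have hker : quadrics k ι (C ∩ {x | ∑ i, w i * x i = 0}) ⊓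
      LinearMap.ker (aeval x : MvPolynomial ι k →ₐ[k] Ω).toLinearMap = quadrics k ι C := by
    ext f
    simp only [quadrics, idealPiece, Submodule.mem_inf, Submodule.restrictScalars_mem,
      LinearMap.mem_ker, AlgHom.toLinearMap_apply, hx]
    constructor
    · rintro ⟨⟨-, h2⟩, h3⟩
      exact ⟨h3, h2⟩
    · rintro ⟨h3, h2⟩
      exact ⟨⟨mem_vanIdeal.2 fun z hz => mem_vanIdeal.1 h3 z hz.1, h2⟩, h3⟩
  rw [hker, map_aeval_quadrics_inter w hdiv,
    (Submodule.equivMapOfInjective (LinearMap.mulLeft k (∑ i, w i • x i))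
      (mul_right_injective₀ hw) _).finrank_eq.symm] at h
  rw [a2, a2, ← h, add_comm]

end HyperplaneSection

/-- Lemma 3.4. Let `X ⊆ ℙ^{n+c}` be nondegenerate irreducible of
dimension `n ≥ 2`, codimension `c ≥ 4`, degree `d ≥ c + 3`, with `a₂(X) = C(c+1,2) - 3`.
Then a general hyperplane section `Y = X ∩ H` satisfies `a₂(Y) = C(c+1,2) - 3`
(computed in the hyperplane `H ≅ ℙ^{n-1+c}`; inside `ℙ^{n+c}` the quadrics through `Y`
additionally contain the `n + c + 1` products of the equation of `H` with linear forms). -/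
theorem stmt_9 {k : Type} [Field k] [IsAlgClosed k] [CharZero k]
    (n c d : ℕ) (hn : 2 ≤ n) (hc : 4 ≤ c) (hd : c + 3 ≤ d)
    (C : Set (Fin (n + c + 1) → k))
    (hV : IsProjVariety k (Fin (n + c + 1)) C)
    (hnd : Nondeg k (Fin (n + c + 1)) C)
    (hdim : HasDim k (Fin (n + c + 1)) C n)
    (hdeg : HasDegree k (Fin (n + c + 1)) C n d)
    (ha : a2 k (Fin (n + c + 1)) C = Nat.choose (c + 1) 2 - 3) :
    ∃ P : MvPolynomial (Fin (n + c + 1)) k, P ≠ 0 ∧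
      ∀ w : Fin (n + c + 1) → k, MvPolynomial.eval w P ≠ 0 →
        a2 k (Fin (n + c + 1)) (C ∩ {x | ∑ i, w i * x i = 0}) =
          (Nat.choose (c + 1) 2 - 3) + (n + c + 1) := by
  obtain ⟨Ω, _, _, x, hx⟩ := exists_generic_point (vanIdeal k (Fin (n + c + 1)) C) hV.prime
  have : CharZero Ω := charZero_of_injective_algebraMap (algebraMap k Ω).injective
  have hH := finrank_span_pow_add_finrank_idealPiece hx
  have hpiece1 : idealPiece k (Fin (n + c + 1)) (vanIdeal k (Fin (n + c + 1)) C) 1 = ⊥ := by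
    rw [eq_bot_iff]
    rintro f ⟨hf, hf1⟩
    exact hnd f hf1 (mem_vanIdeal.1 hf)
  have hfr1 : Module.finrank k (Submodule.span k (Set.range x)) = n + c + 1 := by
    have := hH 1
    rw [hpiece1, finrank_bot, finrank_homogeneousSubmodule_fin, pow_one, add_zero,
      ← Nat.choose_symm_add, Nat.choose_one_right] at this
    omega
  have hfr2 : Module.finrank k ↥(Submodule.span k (Set.range x) ^ 2) =
      (n + 2).choose 2 + c * (n + 1) + 3 := by
    have h2 := hH 2
    change _ + a2 k (Fin (n + c + 1)) C = _ at h2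
    rw [ha, finrank_homogeneousSubmodule_fin, ← Nat.choose_symm_add] at h2
    have h3 : 3 ≤ (c + 1).choose 2 :=
      le_trans (by decide : 3 ≤ Nat.choose 3 2) (Nat.choose_le_choose 2 (by omega))
    have h4 := choose_two_add_eq n c
    omega
  have hlim : Filter.Tendsto (fun m : ℕ =>
      (Module.finrank k ↥(Submodule.span k (Set.range x) ^ m) : ℝ) * n.factorial / (m : ℝ) ^ n)
      Filter.atTop (nhds (d : ℝ)) := by
    refine hdeg.congr fun m => ?_
    rw [hilb, idealHilb, ← hH m, Nat.add_sub_cancel]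
  obtain ⟨P, hP0, hP⟩ := exists_forall_mem_span_of_pow_eq_mul_of_isAlgClosed hn (by omega) hd
    hfr1 hfr2 hlim
  refine ⟨P * X 0, mul_ne_zero hP0 (X_ne_zero _), fun w hw => ?_⟩
  rw [map_mul, eval_X] at hw
  have hg : ∑ i, w i • x i ≠ 0 := by
    rw [← aeval_linearForm, Ne, hx]
    intro hmem
    have h0 := hnd _ (linearForm_isHomogeneous w) (mem_vanIdeal.1 hmem)
    have := eval_linearForm w (Pi.single 0 1)
    rw [h0] at this
    refine right_ne_zero_of_mul hw ?_
    simpa [Pi.single_apply] using this.symm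
  rw [a2_inter_eq_add_finrank_span hx w hg, ha, hfr1]
  intro q hq
  obtain ⟨m, hm, y, hy, hqy⟩ := exists_aeval_pow_eq_mul hV hx w hq
  exact hP w (left_ne_zero_of_mul hw) hg m _ y hm
    (mem_span_pow_iff_aeval.2 ⟨q, hq.2, rfl⟩) hy hqy
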